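/- (Hessian bound.) Let 0<L_s<∞ and suppose ‖u₀‖_{W^{1,4}}<∞. There exists a constant C=C(Γ)>0 such that every classical solution of the Boussinesq system with 0≤T₀≤1 satisfies ⟨‖∇²u‖_{L²}²⟩ ≤ C·( L_s^{−2} + max{1, L_s^{−3}}·(‖u₀‖_{W^{1,4}} + Ra)/(Pr·L_s) + L_s^{−1}·Nu^{−1/2}·Ra^{1/2} + Ra^{1/2} )·Nu·Ra, where ∇²u denotes the tensor of all second spatial derivatives of u. -/

import Mathlib

noncomputable section
open MeasureTheory Filter Set
open scoped ENNReal

namespace RB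

/-- A time-dependent scalar field: arguments t, x₁, x₂. -/
abbrev TField := ℝ → ℝ → ℝ → ℝ
/-- A static scalar field: arguments x₁, x₂. -/
abbrev SField := ℝ → ℝ → ℝ

def tsmooth (f : TField) : Prop :=
  ContDiff ℝ (⊤ : ℕ∞) (fun q : ℝ × ℝ × ℝ => f q.1 q.2.1 q.2.2)
def ssmooth (f : SField) : Prop :=
  ContDiff ℝ (⊤ : ℕ∞) (fun q : ℝ × ℝ => f q.1 q.2)
def tperiodic (Γ : ℝ) (f : TField) : Prop := ∀ t x1 x2, f t (x1 + Γ) x2 = f t x1 x2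
def speriodic (Γ : ℝ) (f : SField) : Prop := ∀ x1 x2, f (x1 + Γ) x2 = f x1 x2

/-- time derivative -/
def dt (f : TField) : TField := fun t x1 x2 => deriv (fun s => f s x1 x2) t
/-- partial derivative in x₁ (time-dependent field) -/
def d1 (f : TField) : TField := fun t x1 x2 => deriv (fun y => f t y x2) x1
/-- partial derivative in x₂ (time-dependent field) -/
def d2 (f : TField) : TField := fun t x1 x2 => deriv (fun y => f t x1 y) x2
/-- partial derivative in x₁ (static field) -/
def q1 (f : SField) : SField := fun x1 x2 => deriv (fun y => f y x2) x1
/-- partial derivative in x₂ (static field) -/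
def q2 (f : SField) : SField := fun x1 x2 => deriv (fun y => f x1 y) x2

/-- Integral over Ω = [0,Γ]×[0,1]. -/
def intΩ (Γ : ℝ) (g : SField) : ℝ :=
  ∫ x1 in Ioc (0:ℝ) Γ, ∫ x2 in Ioc (0:ℝ) 1, g x1 x2

/-- Long-time horizontal average ⟨f⟩ of a quantity f(t, x₁). -/
def ltavg (Γ : ℝ) (f : ℝ → ℝ → ℝ) : ℝ :=
  limsup (fun t => (1/t) * ∫ s in Ioc (0:ℝ) t, (1/Γ) * ∫ x1 in Ioc (0:ℝ) Γ, f s x1) atTop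

/-- spatial L² norm of a static scalar field over Ω -/
def sL2 (Γ : ℝ) (f : SField) : ℝ := Real.sqrt (intΩ Γ (fun x1 x2 => f x1 x2 ^ 2))
/-- spatial L^r norm of a static scalar field over Ω -/
def sLr (Γ r : ℝ) (f : SField) : ℝ := (intΩ Γ (fun x1 x2 => |f x1 x2| ^ r)) ^ (1/r)
/-- H¹ norm of a static scalar field over Ω -/
def sH1 (Γ : ℝ) (f : SField) : ℝ :=
  Real.sqrt (intΩ Γ (fun x1 x2 => f x1 x2 ^ 2 + q1 f x1 x2 ^ 2 + q2 f x1 x2 ^ 2))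

/-- A classical solution of the Boussinesq system on Ω = [0,Γ]×[0,1] with
Rayleigh number Ra, Prandtl number Pr, slip length Ls ∈ (0,∞]
(Navier-slip with friction coefficient `(Ls⁻¹).toReal`; for Ls = ∞ this is free-slip). -/
structure Sol (Γ Ra Pr : ℝ) (Ls : ℝ≥0∞) where
  u1 : TField
  u2 : TField
  T : TField
  p : TField
  smooth_u1 : tsmooth u1
  smooth_u2 : tsmooth u2
  smooth_T : tsmooth T
  smooth_p : tsmooth p
  periodic_u1 : tperiodic Γ u1
  periodic_u2 : tperiodic Γ u2
  periodic_T : tperiodic Γ T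
  periodic_p : tperiodic Γ p
  momentum1 : ∀ t x1 x2, 0 ≤ t → x2 ∈ Icc (0:ℝ) 1 →
    Pr⁻¹ * (dt u1 t x1 x2 + u1 t x1 x2 * d1 u1 t x1 x2 + u2 t x1 x2 * d2 u1 t x1 x2)
      - (d1 (d1 u1) t x1 x2 + d2 (d2 u1) t x1 x2) + d1 p t x1 x2 = 0
  momentum2 : ∀ t x1 x2, 0 ≤ t → x2 ∈ Icc (0:ℝ) 1 →
    Pr⁻¹ * (dt u2 t x1 x2 + u1 t x1 x2 * d1 u2 t x1 x2 + u2 t x1 x2 * d2 u2 t x1 x2)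
      - (d1 (d1 u2) t x1 x2 + d2 (d2 u2) t x1 x2) + d2 p t x1 x2 = Ra * T t x1 x2
  incomp : ∀ t x1 x2, 0 ≤ t → x2 ∈ Icc (0:ℝ) 1 →
    d1 u1 t x1 x2 + d2 u2 t x1 x2 = 0
  heat : ∀ t x1 x2, 0 ≤ t → x2 ∈ Icc (0:ℝ) 1 →
    dt T t x1 x2 + u1 t x1 x2 * d1 T t x1 x2 + u2 t x1 x2 * d2 T t x1 x2
      - (d1 (d1 T) t x1 x2 + d2 (d2 T) t x1 x2) = 0
  T_bot : ∀ t x1, 0 ≤ t → T t x1 0 = 1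
  T_top : ∀ t x1, 0 ≤ t → T t x1 1 = 0
  u2_bot : ∀ t x1, 0 ≤ t → u2 t x1 0 = 0
  u2_top : ∀ t x1, 0 ≤ t → u2 t x1 1 = 0
  slip_top : ∀ t x1, 0 ≤ t → d2 u1 t x1 1 = -(Ls⁻¹).toReal * u1 t x1 1
  slip_bot : ∀ t x1, 0 ≤ t → d2 u1 t x1 0 = (Ls⁻¹).toReal * u1 t x1 0

variable {Γ Ra Pr : ℝ} {Ls : ℝ≥0∞}

/-- The Nusselt number Nu = ⟨∫₀¹ (u₂T − ∂₂T) dx₂⟩. -/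
def Nu (S : Sol Γ Ra Pr Ls) : ℝ :=
  ltavg Γ (fun t x1 => ∫ x2 in (0:ℝ)..1, (S.u2 t x1 x2 * S.T t x1 x2 - d2 S.T t x1 x2))

/-- The initial temperature satisfies 0 ≤ T₀ ≤ 1 on Ω. -/
def T0cond (S : Sol Γ Ra Pr Ls) : Prop :=
  ∀ x1 x2, x2 ∈ Icc (0:ℝ) 1 → S.T 0 x1 x2 ∈ Icc (0:ℝ) 1

/-- The vorticity ω = ∂₁u₂ − ∂₂u₁. -/
def vort (S : Sol Γ Ra Pr Ls) : TField :=
  fun t x1 x2 => d1 S.u2 t x1 x2 - d2 S.u1 t x1 x2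

/-- |∇u|² pointwise. -/
def gradSq (S : Sol Γ Ra Pr Ls) : TField := fun t x1 x2 =>
  d1 S.u1 t x1 x2 ^ 2 + d2 S.u1 t x1 x2 ^ 2 + d1 S.u2 t x1 x2 ^ 2 + d2 S.u2 t x1 x2 ^ 2

/-- |∇²u|² pointwise: sum of squares of all second spatial derivatives of u. -/
def hessSq (S : Sol Γ Ra Pr Ls) : TField := fun t x1 x2 =>
  d1 (d1 S.u1) t x1 x2 ^ 2 + d1 (d2 S.u1) t x1 x2 ^ 2 +
  d2 (d1 S.u1) t x1 x2 ^ 2 + d2 (d2 S.u1) t x1 x2 ^ 2 +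
  d1 (d1 S.u2) t x1 x2 ^ 2 + d1 (d2 S.u2) t x1 x2 ^ 2 +
  d2 (d1 S.u2) t x1 x2 ^ 2 + d2 (d2 S.u2) t x1 x2 ^ 2

/-- ‖u(t)‖_{L²}. -/
def uL2 (S : Sol Γ Ra Pr Ls) (t : ℝ) : ℝ :=
  Real.sqrt (intΩ Γ (fun x1 x2 => S.u1 t x1 x2 ^ 2 + S.u2 t x1 x2 ^ 2))

/-- ‖u₀‖_{W^{1,4}}. -/
def W14u0 (S : Sol Γ Ra Pr Ls) : ℝ :=
  (intΩ Γ (fun x1 x2 =>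
    (S.u1 0 x1 x2 ^ 2 + S.u2 0 x1 x2 ^ 2) ^ 2 + (gradSq S 0 x1 x2) ^ 2)) ^ ((1:ℝ)/4)

/-- ‖ω(t)‖_{L⁴}. -/
def omegaL4 (S : Sol Γ Ra Pr Ls) (t : ℝ) : ℝ :=
  (intΩ Γ (fun x1 x2 => vort S t x1 x2 ^ 4)) ^ ((1:ℝ)/4)


/-! Smooth fields and their partial derivatives -/

/-- chain rule along a curve -/
lemma line_hasDerivAt {E : Type*} [NormedAddCommGroup E] [NormedSpace ℝ E] {F : E → ℝ}
    (hF : ContDiff ℝ (⊤ : ℕ∞) F) {γ : ℝ → E} {v : E} {s : ℝ} (hγ : HasDerivAt γ v s) :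
    HasDerivAt (fun y => F (γ y)) (fderiv ℝ F (γ s) v) s :=
  ((hF.differentiable (by simp)) (γ s)).hasFDerivAt.comp_hasDerivAt s hγ

lemma dir_contDiff {E : Type*} [NormedAddCommGroup E] [NormedSpace ℝ E] {F : E → ℝ}
    (hF : ContDiff ℝ (⊤ : ℕ∞) F) (v : E) : ContDiff ℝ (⊤ : ℕ∞) (fun x => fderiv ℝ F x v) :=
  (hF.fderiv_right (m := (⊤ : ℕ∞)) (by simp)).clm_apply contDiff_const

lemma dir_comm {E : Type*} [NormedAddCommGroup E] [NormedSpace ℝ E] {F : E → ℝ}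
    (hF : ContDiff ℝ (⊤ : ℕ∞) F) (v w : E) (x : E) :
    fderiv ℝ (fun x => fderiv ℝ F x v) x w = fderiv ℝ (fun x => fderiv ℝ F x w) x v := by
  have hd : DifferentiableAt ℝ (fderiv ℝ F) x :=
    (hF.fderiv_right (m := (⊤ : ℕ∞)) (by simp)).differentiable (by simp) x
  have key : ∀ a b : E, fderiv ℝ (fun x => fderiv ℝ F x a) x b = fderiv ℝ (fderiv ℝ F) x b a := by
    intro a b
    rw [fderiv_clm_apply hd (by fun_prop)]
    simp
  rw [key, key]
  have := (hF.contDiffAt (x := x)).isSymmSndFDerivAt (by simp only [minSmoothness_of_isRCLikeNormedField]; exact WithTop.coe_le_coe.2 (le_top : (2:ℕ∞) ≤ ⊤))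
  exact this w v

lemma curve1 (x1 x2 : ℝ) : HasDerivAt (fun y : ℝ => (y, x2)) ((1:ℝ), (0:ℝ)) x1 :=
  (hasDerivAt_id x1).prodMk (hasDerivAt_const x1 x2)
lemma curve2 (x1 x2 : ℝ) : HasDerivAt (fun y : ℝ => (x1, y)) ((0:ℝ), (1:ℝ)) x2 :=
  (hasDerivAt_const x2 x1).prodMk (hasDerivAt_id x2)

lemma q1_eq {f : SField} (hf : ssmooth f) (x1 x2 : ℝ) :
    q1 f x1 x2 = fderiv ℝ (fun q : ℝ × ℝ => f q.1 q.2) (x1, x2) (1, 0) :=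
  (line_hasDerivAt hf (curve1 x1 x2)).deriv
lemma q2_eq {f : SField} (hf : ssmooth f) (x1 x2 : ℝ) :
    q2 f x1 x2 = fderiv ℝ (fun q : ℝ × ℝ => f q.1 q.2) (x1, x2) (0, 1) :=
  (line_hasDerivAt hf (curve2 x1 x2)).deriv
lemma ss_hd1 {f : SField} (hf : ssmooth f) (x1 x2 : ℝ) :
    HasDerivAt (fun y => f y x2) (q1 f x1 x2) x1 := by
  rw [q1_eq hf]; exact line_hasDerivAt hf (curve1 x1 x2)
lemma ss_hd2 {f : SField} (hf : ssmooth f) (x1 x2 : ℝ) :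
    HasDerivAt (fun y => f x1 y) (q2 f x1 x2) x2 := by
  rw [q2_eq hf]; exact line_hasDerivAt hf (curve2 x1 x2)
lemma ss_q1 {f : SField} (hf : ssmooth f) : ssmooth (q1 f) := by
  have := dir_contDiff hf (1, 0)
  unfold ssmooth
  simpa only [q1_eq hf] using this
lemma ss_q2 {f : SField} (hf : ssmooth f) : ssmooth (q2 f) := by
  have := dir_contDiff hf (0, 1)
  unfold ssmooth
  simpa only [q2_eq hf] using this
lemma ss_cont {f : SField} (hf : ssmooth f) : Continuous (fun q : ℝ × ℝ => f q.1 q.2) :=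
  hf.continuous
lemma ss_comm {f : SField} (hf : ssmooth f) (x1 x2 : ℝ) : q1 (q2 f) x1 x2 = q2 (q1 f) x1 x2 := by
  rw [q1_eq (ss_q2 hf), q2_eq (ss_q1 hf)]
  simp only [q1_eq hf, q2_eq hf]
  exact dir_comm hf _ _ _

/-- chain rule for static fields -/
lemma ss_chain {f : SField} (hf : ssmooth f) {a b : ℝ → ℝ} {a' b' s : ℝ}
    (ha : HasDerivAt a a' s) (hb : HasDerivAt b b' s) :
    HasDerivAt (fun y => f (a y) (b y)) (a' * q1 f (a s) (b s) + b' * q2 f (a s) (b s)) s := by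
  have h := line_hasDerivAt hf (ha.prodMk hb)
  refine h.congr_deriv ?_
  rw [q1_eq hf, q2_eq hf]
  have : ((a', b') : ℝ × ℝ) = a' • (1, 0) + b' • (0, 1) := by simp
  rw [this, map_add, map_smul, map_smul]; simp

lemma per_q1 {Γ : ℝ} {f : SField} (h : speriodic Γ f) : speriodic Γ (q1 f) := by
  intro x1 x2
  unfold q1
  rw [← deriv_comp_add_const]
  simp only [h _ x2]
lemma per_q2 {Γ : ℝ} {f : SField} (h : speriodic Γ f) : speriodic Γ (q2 f) := by
  intro x1 x2
  unfold q2
  simp only [h x1 _]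

/-! time dependent -/
lemma tcurve0 (t x1 x2 : ℝ) : HasDerivAt (fun y : ℝ => (y, x1, x2)) ((1:ℝ), (0:ℝ), (0:ℝ)) t :=
  (hasDerivAt_id t).prodMk (hasDerivAt_const t _)
lemma tcurve1 (t x1 x2 : ℝ) : HasDerivAt (fun y : ℝ => (t, y, x2)) ((0:ℝ), (1:ℝ), (0:ℝ)) x1 :=
  (hasDerivAt_const x1 t).prodMk (curve1 x1 x2)
lemma tcurve2 (t x1 x2 : ℝ) : HasDerivAt (fun y : ℝ => (t, x1, y)) ((0:ℝ), (0:ℝ), (1:ℝ)) x2 :=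
  (hasDerivAt_const x2 t).prodMk (curve2 x1 x2)

lemma dt_eq {f : TField} (hf : tsmooth f) (t x1 x2 : ℝ) :
    dt f t x1 x2 = fderiv ℝ (fun q : ℝ × ℝ × ℝ => f q.1 q.2.1 q.2.2) (t, x1, x2) (1, 0, 0) :=
  (line_hasDerivAt hf (tcurve0 t x1 x2)).deriv
lemma d1_eq {f : TField} (hf : tsmooth f) (t x1 x2 : ℝ) :
    d1 f t x1 x2 = fderiv ℝ (fun q : ℝ × ℝ × ℝ => f q.1 q.2.1 q.2.2) (t, x1, x2) (0, 1, 0) :=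
  (line_hasDerivAt hf (tcurve1 t x1 x2)).deriv
lemma d2_eq {f : TField} (hf : tsmooth f) (t x1 x2 : ℝ) :
    d2 f t x1 x2 = fderiv ℝ (fun q : ℝ × ℝ × ℝ => f q.1 q.2.1 q.2.2) (t, x1, x2) (0, 0, 1) :=
  (line_hasDerivAt hf (tcurve2 t x1 x2)).deriv
lemma ts_hdt {f : TField} (hf : tsmooth f) (t x1 x2 : ℝ) :
    HasDerivAt (fun y => f y x1 x2) (dt f t x1 x2) t := by
  rw [dt_eq hf]; exact line_hasDerivAt hf (tcurve0 t x1 x2)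
lemma ts_hd1 {f : TField} (hf : tsmooth f) (t x1 x2 : ℝ) :
    HasDerivAt (fun y => f t y x2) (d1 f t x1 x2) x1 := by
  rw [d1_eq hf]; exact line_hasDerivAt hf (tcurve1 t x1 x2)
lemma ts_hd2 {f : TField} (hf : tsmooth f) (t x1 x2 : ℝ) :
    HasDerivAt (fun y => f t x1 y) (d2 f t x1 x2) x2 := by
  rw [d2_eq hf]; exact line_hasDerivAt hf (tcurve2 t x1 x2)
lemma ts_dt {f : TField} (hf : tsmooth f) : tsmooth (dt f) := by
  have := dir_contDiff hf (1, 0, 0)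
  unfold tsmooth
  simpa only [dt_eq hf] using this
lemma ts_d1 {f : TField} (hf : tsmooth f) : tsmooth (d1 f) := by
  have := dir_contDiff hf (0, 1, 0)
  unfold tsmooth
  simpa only [d1_eq hf] using this
lemma ts_d2 {f : TField} (hf : tsmooth f) : tsmooth (d2 f) := by
  have := dir_contDiff hf (0, 0, 1)
  unfold tsmooth
  simpa only [d2_eq hf] using this
lemma ts_cont {f : TField} (hf : tsmooth f) :
    Continuous (fun q : ℝ × ℝ × ℝ => f q.1 q.2.1 q.2.2) := hf.continuous
lemma ts_slice {f : TField} (hf : tsmooth f) (t : ℝ) : ssmooth (f t) := by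
  have h2 : ContDiff ℝ (⊤ : ℕ∞) (fun q : ℝ × ℝ => ((t, q.1, q.2) : ℝ × ℝ × ℝ)) := by fun_prop
  exact hf.comp h2
lemma comm_dt_d1 {f : TField} (hf : tsmooth f) : dt (d1 f) = d1 (dt f) := by
  funext t x1 x2
  rw [dt_eq (ts_d1 hf), d1_eq (ts_dt hf)]
  simp only [d1_eq hf, dt_eq hf]
  exact dir_comm hf _ _ _
lemma comm_dt_d2 {f : TField} (hf : tsmooth f) : dt (d2 f) = d2 (dt f) := by
  funext t x1 x2
  rw [dt_eq (ts_d2 hf), d2_eq (ts_dt hf)]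
  simp only [d2_eq hf, dt_eq hf]
  exact dir_comm hf _ _ _
lemma comm_d1_d2 {f : TField} (hf : tsmooth f) : d1 (d2 f) = d2 (d1 f) := by
  funext t x1 x2
  exact ss_comm (ts_slice hf t) x1 x2

lemma tper_slice {Γ : ℝ} {f : TField} (h : tperiodic Γ f) (t : ℝ) : speriodic Γ (f t) := h t
lemma tper_dt {Γ : ℝ} {f : TField} (h : tperiodic Γ f) : tperiodic Γ (dt f) := by
  intro t x1 x2
  unfold dt
  simp only [h _ x1 x2]
lemma tper_d1 {Γ : ℝ} {f : TField} (h : tperiodic Γ f) : tperiodic Γ (d1 f) :=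
  fun t => per_q1 (h t)
lemma tper_d2 {Γ : ℝ} {f : TField} (h : tperiodic Γ f) : tperiodic Γ (d2 f) :=
  fun t => per_q2 (h t)

/-- A function vanishing on `[0,1]` has vanishing derivative there. -/
lemma deriv_zero_Icc {f : ℝ → ℝ} {f' x : ℝ} (h : HasDerivAt f f' x)
    (hz : ∀ y ∈ Icc (0:ℝ) 1, f y = 0) (hx : x ∈ Icc (0:ℝ) 1) : f' = 0 := by
  have h1 : HasDerivWithinAt f f' (Icc 0 1) x := h.hasDerivWithinAt
  have h2 : HasDerivWithinAt f 0 (Icc 0 1) x :=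
    (hasDerivWithinAt_const x _ (0:ℝ)).congr (fun y hy => hz y hy) (hz x hx)
  exact (uniqueDiffOn_Icc one_pos x hx).eq_deriv _ h1 h2
lemma deriv_zero_Ici {f : ℝ → ℝ} {f' x : ℝ} (h : HasDerivAt f f' x)
    (hz : ∀ y, 0 ≤ y → f y = 0) (hx : 0 ≤ x) : f' = 0 := by
  have h1 : HasDerivWithinAt f f' (Ici 0) x := h.hasDerivWithinAt
  have h2 : HasDerivWithinAt f 0 (Ici 0) x :=
    (hasDerivWithinAt_const x _ (0:ℝ)).congr (fun y hy => hz y hy) (hz x hx)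
  exact (uniqueDiffOn_Ici 0 x hx).eq_deriv _ h1 h2

/-! Integration over Ω -/

lemma intOn_box {Γ : ℝ} {g : ℝ × ℝ → ℝ} (hg : Continuous g) :
    IntegrableOn g (Ioc (0:ℝ) Γ ×ˢ Ioc (0:ℝ) 1) := by
  have h : IntegrableOn g (Icc (0:ℝ) Γ ×ˢ Icc (0:ℝ) 1) :=
    hg.continuousOn.integrableOn_compact (isCompact_Icc.prod isCompact_Icc)
  exact h.mono_set (Set.prod_mono Ioc_subset_Icc_self Ioc_subset_Icc_self)

lemma intOn_box' {Γ : ℝ} {g : ℝ × ℝ → ℝ} (hg : Continuous g) :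
    IntegrableOn g (Ioo (0:ℝ) Γ ×ˢ Ioo (0:ℝ) 1) :=
  (intOn_box hg).mono_set (Set.prod_mono Ioo_subset_Ioc_self Ioo_subset_Ioc_self)

lemma intΩ_eq {Γ : ℝ} {g : SField} (hg : Continuous (fun q : ℝ × ℝ => g q.1 q.2)) :
    intΩ Γ g = ∫ q in Ioo (0:ℝ) Γ ×ˢ Ioo (0:ℝ) 1, g q.1 q.2 := by
  have h2 := setIntegral_prod (μ := (volume : Measure ℝ)) (ν := (volume : Measure ℝ))
    (fun q : ℝ × ℝ => g q.1 q.2) (intOn_box' (Γ := Γ) hg)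
  unfold intΩ
  rw [show (volume : Measure (ℝ × ℝ)) = (volume : Measure ℝ).prod volume from rfl, h2]
  simp only [integral_Ioc_eq_integral_Ioo]


lemma intΩ_add (f g : SField) (hf : Continuous (fun q : ℝ × ℝ => f q.1 q.2))
    (hg : Continuous (fun q : ℝ × ℝ => g q.1 q.2)) :
    intΩ Γ (fun x1 x2 => f x1 x2 + g x1 x2) = intΩ Γ f + intΩ Γ g := by
  rw [intΩ_eq hf, intΩ_eq hg, intΩ_eq (by fun_prop)]
  exact integral_add (intOn_box' hf) (intOn_box' hg)

lemma intΩ_sub (f g : SField) (hf : Continuous (fun q : ℝ × ℝ => f q.1 q.2))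
    (hg : Continuous (fun q : ℝ × ℝ => g q.1 q.2)) :
    intΩ Γ (fun x1 x2 => f x1 x2 - g x1 x2) = intΩ Γ f - intΩ Γ g := by
  rw [intΩ_eq hf, intΩ_eq hg, intΩ_eq (by fun_prop)]
  exact integral_sub (intOn_box' hf) (intOn_box' hg)

lemma intΩ_cmul (c : ℝ) (f : SField) :
    intΩ Γ (fun x1 x2 => c * f x1 x2) = c * intΩ Γ f := by
  unfold intΩ
  simp only [integral_const_mul]

lemma intΩ_neg (f : SField) :
    intΩ Γ (fun x1 x2 => - f x1 x2) = - intΩ Γ f := by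
  unfold intΩ
  simp only [integral_neg]

lemma intΩ_const (hΓ : 0 < Γ) (c : ℝ) : intΩ Γ (fun _ _ => c) = Γ * c := by
  unfold intΩ
  simp [hΓ.le]

lemma intΩ_mono {f g : SField} (hf : Continuous (fun q : ℝ × ℝ => f q.1 q.2))
    (hg : Continuous (fun q : ℝ × ℝ => g q.1 q.2))
    (h : ∀ x1 ∈ Ioo (0:ℝ) Γ, ∀ x2 ∈ Ioo (0:ℝ) 1, f x1 x2 ≤ g x1 x2) :
    intΩ Γ f ≤ intΩ Γ g := by
  rw [intΩ_eq hf, intΩ_eq hg]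
  exact setIntegral_mono_on (intOn_box' hf) (intOn_box' hg)
    (measurableSet_Ioo.prod measurableSet_Ioo) (fun q hq => h _ hq.1 _ hq.2)

lemma intΩ_congr {f g : SField}
    (h : ∀ x1, ∀ x2 ∈ Icc (0:ℝ) 1, f x1 x2 = g x1 x2) :
    intΩ Γ f = intΩ Γ g := by
  unfold intΩ
  refine setIntegral_congr_fun measurableSet_Ioc (fun x1 _ => ?_)
  exact setIntegral_congr_fun measurableSet_Ioc (fun x2 h2 => h x1 x2 (Ioc_subset_Icc_self h2))

lemma intΩ_nonneg {f : SField}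
    (h : ∀ x1 ∈ Ioc (0:ℝ) Γ, ∀ x2 ∈ Ioc (0:ℝ) 1, 0 ≤ f x1 x2) : 0 ≤ intΩ Γ f :=
  setIntegral_nonneg measurableSet_Ioc fun x1 h1 =>
    setIntegral_nonneg measurableSet_Ioc fun x2 h2 => h x1 h1 x2 h2

lemma intΩ_eq_iter (hΓ : 0 < Γ) (g : SField) :
    intΩ Γ g = ∫ x1 in (0:ℝ)..Γ, ∫ x2 in (0:ℝ)..1, g x1 x2 := by
  unfold intΩ
  simp only [intervalIntegral.integral_of_le hΓ.le, intervalIntegral.integral_of_le zero_le_one]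

lemma intΩ_swap (hΓ : 0 < Γ) {g : SField} (hg : Continuous (fun q : ℝ × ℝ => g q.1 q.2)) :
    intΩ Γ g = ∫ x2 in (0:ℝ)..1, ∫ x1 in (0:ℝ)..Γ, g x1 x2 := by
  simp only [intervalIntegral.integral_of_le hΓ.le, intervalIntegral.integral_of_le zero_le_one]
  unfold intΩ
  refine integral_integral_swap ?_
  have h := intOn_box (Γ := Γ) hg
  unfold IntegrableOn at h
  rw [show (volume : Measure (ℝ × ℝ)) = (volume : Measure ℝ).prod volume from rfl,
    ← Measure.prod_restrict] at h
  exact h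

lemma intΩ_d1 (hΓ : 0 < Γ) {F F' : SField}
    (hd : ∀ x1, ∀ x2 ∈ Icc (0:ℝ) 1, HasDerivAt (fun y => F y x2) (F' x1 x2) x1)
    (hp : ∀ x1 x2, F (x1 + Γ) x2 = F x1 x2)
    (hc : Continuous (fun q : ℝ × ℝ => F' q.1 q.2)) : intΩ Γ F' = 0 := by
  rw [intΩ_swap hΓ hc]
  have : ∀ x2 ∈ uIcc (0:ℝ) 1, (∫ x1 in (0:ℝ)..Γ, F' x1 x2) = 0 := by
    intro x2 h2
    rw [uIcc_of_le zero_le_one] at h2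
    rw [intervalIntegral.integral_eq_sub_of_hasDerivAt (f := fun y => F y x2)
      (fun x _ => hd x x2 h2) (Continuous.intervalIntegrable (by fun_prop) _ _)]
    have := hp 0 x2
    rw [zero_add] at this
    simp [this]
  rw [intervalIntegral.integral_congr this]
  simp

lemma intΩ_d2 (hΓ : 0 < Γ) {F F' : SField}
    (hd : ∀ x1, ∀ x2 ∈ Icc (0:ℝ) 1, HasDerivAt (fun y => F x1 y) (F' x1 x2) x2)
    (hc : Continuous (fun q : ℝ × ℝ => F' q.1 q.2)) :
    intΩ Γ F' = ∫ x1 in (0:ℝ)..Γ, (F x1 1 - F x1 0) := by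
  rw [intΩ_eq_iter hΓ]
  refine intervalIntegral.integral_congr (fun x1 _ => ?_)
  exact intervalIntegral.integral_eq_sub_of_hasDerivAt (f := fun y => F x1 y)
      (fun x hx => hd x1 x (by rwa [uIcc_of_le zero_le_one] at hx))
      (Continuous.intervalIntegrable (by fun_prop) _ _)

lemma intΩ_d2_zero (hΓ : 0 < Γ) {F F' : SField}
    (hd : ∀ x1, ∀ x2 ∈ Icc (0:ℝ) 1, HasDerivAt (fun y => F x1 y) (F' x1 x2) x2)
    (hc : Continuous (fun q : ℝ × ℝ => F' q.1 q.2))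
    (hz : ∀ x1, F x1 1 = F x1 0) :
    intΩ Γ F' = 0 := by
  rw [intΩ_d2 hΓ hd hc]; simp [hz]

lemma intΩ_CS {f g : SField} (hf : Continuous (fun q : ℝ × ℝ => f q.1 q.2))
    (hg : Continuous (fun q : ℝ × ℝ => g q.1 q.2)) :
    (intΩ Γ (fun x1 x2 => f x1 x2 * g x1 x2)) ^ 2 ≤
      intΩ Γ (fun x1 x2 => f x1 x2 ^ 2) * intΩ Γ (fun x1 x2 => g x1 x2 ^ 2) := by
  have h : ∀ s : ℝ, 0 ≤ intΩ Γ (fun x1 x2 => g x1 x2 ^ 2) * (s * s)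
      + (2 * intΩ Γ (fun x1 x2 => f x1 x2 * g x1 x2)) * s + intΩ Γ (fun x1 x2 => f x1 x2 ^ 2) := by
    intro s
    have h0 : 0 ≤ intΩ Γ (fun x1 x2 => (f x1 x2 + s * g x1 x2) ^ 2) :=
      intΩ_nonneg (fun _ _ _ _ => sq_nonneg _)
    have h1 : (fun x1 x2 => (f x1 x2 + s * g x1 x2) ^ 2) = (fun x1 x2 =>
      (s * s) * (g x1 x2 ^ 2) + (2 * s) * (f x1 x2 * g x1 x2) + f x1 x2 ^ 2) := by
      funext x1 x2; ring
    rw [h1, intΩ_add _ _ (by fun_prop) (by fun_prop), intΩ_add _ _ (by fun_prop) (by fun_prop),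
      intΩ_cmul, intΩ_cmul] at h0
    linarith
  have := discrim_le_zero h
  unfold discrim at this
  nlinarith

lemma intΩ_eq_zero {g : SField} (hg : Continuous (fun q : ℝ × ℝ => g q.1 q.2))
    (h0 : ∀ x1 x2, 0 ≤ g x1 x2) (hi : intΩ Γ g ≤ 0) :
    ∀ x1 ∈ Ioo (0:ℝ) Γ, ∀ x2 ∈ Ioo (0:ℝ) 1, g x1 x2 = 0 := by
  have hz : intΩ Γ g = 0 := le_antisymm hi (intΩ_nonneg (fun _ _ _ _ => h0 _ _))
  rw [intΩ_eq hg] at hz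
  have h2 := (setIntegral_eq_zero_iff_of_nonneg_ae
    (f := fun q : ℝ × ℝ => g q.1 q.2) (Eventually.of_forall (fun q => h0 _ _)) (intOn_box' hg)).1 hz
  have h3 := Measure.eqOn_open_of_ae_eq (μ := (volume : Measure (ℝ × ℝ))) h2 (isOpen_Ioo.prod isOpen_Ioo)
    hg.continuousOn continuousOn_const
  intro x1 h1 x2 h2
  exact h3 (x := (x1, x2)) ⟨h1, h2⟩

lemma intΩ_hasDerivAt {F F' : TField}
    (hF : Continuous (fun q : ℝ × ℝ × ℝ => F q.1 q.2.1 q.2.2))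
    (hF' : Continuous (fun q : ℝ × ℝ × ℝ => F' q.1 q.2.1 q.2.2))
    (hd : ∀ t x1 x2, HasDerivAt (fun s => F s x1 x2) (F' t x1 x2) t) (t : ℝ) :
    HasDerivAt (fun s => intΩ Γ (F s)) (intΩ Γ (F' t)) t := by
  have e1 : (fun s => intΩ Γ (F s)) =
      fun s => ∫ q in Ioo (0:ℝ) Γ ×ˢ Ioo (0:ℝ) 1, F s q.1 q.2 := by
    funext s; exact intΩ_eq (by fun_prop)
  rw [e1, intΩ_eq (by fun_prop)]
  have hK : IsCompact (Icc (t-1) (t+1) ×ˢ (Icc (0:ℝ) Γ ×ˢ Icc (0:ℝ) 1)) :=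
    isCompact_Icc.prod (isCompact_Icc.prod isCompact_Icc)
  obtain ⟨C, hC⟩ := hK.exists_bound_of_continuousOn hF'.continuousOn
  refine (hasDerivAt_integral_of_dominated_loc_of_deriv_le (bound := fun _ => C)
    (F := fun s (q : ℝ × ℝ) => F s q.1 q.2) (F' := fun s (q : ℝ × ℝ) => F' s q.1 q.2)
    (s := Icc (t-1) (t+1)) (Icc_mem_nhds (by linarith) (by linarith)) ?_ ?_ ?_ ?_ ?_ ?_).2
  · exact Eventually.of_forall fun s => Continuous.aestronglyMeasurable (by fun_prop)
  · exact intOn_box' (by fun_prop)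
  · exact Continuous.aestronglyMeasurable (by fun_prop)
  · refine (ae_restrict_iff' (measurableSet_Ioo.prod measurableSet_Ioo)).2 (Eventually.of_forall ?_)
    intro q hq s hs
    exact hC (s, q.1, q.2) ⟨hs, Ioo_subset_Icc_self hq.1, Ioo_subset_Icc_self hq.2⟩
  · exact intOn_box' (g := fun _ => C) continuous_const
  · exact Eventually.of_forall fun q s _ => hd s q.1 q.2

lemma ts_intΩ_hasDerivAt {F : TField} (hF : tsmooth F) (t : ℝ) :
    HasDerivAt (fun s => intΩ Γ (F s)) (intΩ Γ (dt F t)) t :=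
  intΩ_hasDerivAt (ts_cont hF) (ts_cont (ts_dt hF)) (ts_hdt hF) t

lemma ts_intΩ_cont {F : TField} (hF : tsmooth F) : Continuous (fun s => intΩ Γ (F s)) :=
  continuous_iff_continuousAt.2 fun t => (ts_intΩ_hasDerivAt hF t).continuousAt

/-- linear differential inequality -/
lemma ode_bound {y y' : ℝ → ℝ} {a b t : ℝ} (ha : 0 < a) (ht : 0 ≤ t)
    (hd : ∀ s, HasDerivAt y (y' s) s) (h : ∀ s ∈ Icc 0 t, y' s ≤ -a * y s + b) :
    y t ≤ max (y 0) (b / a) := by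
  set K := max (y 0) (b / a)
  have hK : b ≤ a * K := by
    have : b / a ≤ K := le_max_right _ _
    rw [div_le_iff₀ ha] at this; linarith
  have hz : ∀ s, HasDerivAt (fun s => (y s - K) * Real.exp (a * s))
      (y' s * Real.exp (a * s) + (y s - K) * (Real.exp (a * s) * a)) s := by
    intro s
    have h1 : HasDerivAt (fun s => a * s) a s := by simpa using (hasDerivAt_id s).const_mul a
    exact ((hd s).sub_const K).mul h1.exp
  have hanti : AntitoneOn (fun s => (y s - K) * Real.exp (a * s)) (Icc 0 t) := by
    refine antitoneOn_of_deriv_nonpos (convex_Icc 0 t)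
      (fun s _ => (hz s).continuousAt.continuousWithinAt)
      (fun s _ => (hz s).differentiableAt.differentiableWithinAt) ?_
    intro s hs
    rw [interior_Icc] at hs
    rw [(hz s).deriv]
    have h2 := h s (Ioo_subset_Icc_self hs)
    have h3 := Real.exp_pos (a * s)
    have : y' s + (y s - K) * a ≤ 0 := by nlinarith
    nlinarith
  have h1 := hanti (left_mem_Icc.2 ht) (right_mem_Icc.2 ht) ht
  simp only [mul_zero, Real.exp_zero, mul_one] at h1
  have h2 : y 0 ≤ K := le_max_left _ _
  have h3 := Real.exp_pos (a * t)
  by_contra hcon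
  push Not at hcon
  have : 0 < (y t - K) * Real.exp (a * t) := mul_pos (by linarith) h3
  linarith

/-! Poincaré inequality and the truncated `L⁴` estimate -/

lemma poincare_bot (hΓ : 0 < Γ) {F F' : SField} (hF : Continuous (fun q : ℝ × ℝ => F q.1 q.2))
    (hF' : Continuous (fun q : ℝ × ℝ => F' q.1 q.2))
    (hd : ∀ x1, ∀ x2 ∈ Icc (0:ℝ) 1, HasDerivAt (fun y => F x1 y) (F' x1 x2) x2) :
    intΩ Γ (fun x1 x2 => F x1 x2 ^ 2) ≤
      2 * (∫ x1 in (0:ℝ)..Γ, F x1 0 ^ 2) + 4 * intΩ Γ (fun x1 x2 => F' x1 x2 ^ 2) := by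
  have h1 : intΩ Γ (fun x1 x2 => (-1) * F x1 x2 ^ 2 + (1 - x2) * (2 * F x1 x2 * F' x1 x2))
      = ∫ x1 in (0:ℝ)..Γ, ((1 - 1) * F x1 1 ^ 2 - (1 - 0) * F x1 0 ^ 2) := by
    refine intΩ_d2 hΓ (F := fun x1 x2 => (1 - x2) * F x1 x2 ^ 2) ?_ (by fun_prop)
    intro x1 x2 h2
    have := (((hasDerivAt_id x2).const_sub 1).mul ((hd x1 x2 h2).pow 2))
    refine this.congr_deriv ?_
    simp
  have h2 : (∫ x1 in (0:ℝ)..Γ, ((1 - 1) * F x1 1 ^ 2 - (1 - 0) * F x1 0 ^ 2))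
      = - ∫ x1 in (0:ℝ)..Γ, F x1 0 ^ 2 := by
    rw [← intervalIntegral.integral_neg]
    congr 1; funext x; ring
  rw [intΩ_add _ _ (by fun_prop) (by fun_prop), intΩ_cmul, h2] at h1
  have h3 : intΩ Γ (fun x1 x2 => (1 - x2) * (2 * F x1 x2 * F' x1 x2)) ≤
      intΩ Γ (fun x1 x2 => (1/2) * F x1 x2 ^ 2 + 2 * F' x1 x2 ^ 2) := by
    refine intΩ_mono (by fun_prop) (by fun_prop) ?_
    intro x1 _ x2 hx
    have e1 : (1 - x2) ^ 2 ≤ 1 := by nlinarith [hx.1, hx.2]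
    nlinarith [sq_nonneg (F x1 x2 - 2 * (1 - x2) * F' x1 x2), sq_nonneg (F' x1 x2)]
  rw [intΩ_add _ _ (by fun_prop) (by fun_prop), intΩ_cmul, intΩ_cmul] at h3
  linarith

lemma poincare_zero (hΓ : 0 < Γ) {F F' : SField} (hF : Continuous (fun q : ℝ × ℝ => F q.1 q.2))
    (hF' : Continuous (fun q : ℝ × ℝ => F' q.1 q.2))
    (hd : ∀ x1, ∀ x2 ∈ Icc (0:ℝ) 1, HasDerivAt (fun y => F x1 y) (F' x1 x2) x2)
    (h0 : ∀ x1, F x1 0 = 0) :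
    intΩ Γ (fun x1 x2 => F x1 x2 ^ 2) ≤ 4 * intΩ Γ (fun x1 x2 => F' x1 x2 ^ 2) := by
  have := poincare_bot hΓ hF hF' hd
  simpa [h0] using this

lemma hasDerivAt_pospow (n : ℕ) (s : ℝ) :
    HasDerivAt (fun s : ℝ => (max s 0) ^ (n + 2)) ((n + 2 : ℕ) * (max s 0) ^ (n + 1)) s := by
  rcases lt_trichotomy s 0 with h | h | h
  · have : (fun s : ℝ => (max s 0) ^ (n + 2)) =ᶠ[nhds s] fun _ => 0 := by
      filter_upwards [Iio_mem_nhds h] with y hy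
      rw [max_eq_right (le_of_lt hy)]; simp
    rw [max_eq_right h.le]
    simpa using (hasDerivAt_const s (0:ℝ)).congr_of_eventuallyEq this
  · subst h
    have h1 : HasDerivWithinAt (fun s : ℝ => (max s 0) ^ (n + 2)) 0 (Iic 0) 0 := by
      refine (hasDerivWithinAt_const (0:ℝ) (Iic 0) (0:ℝ)).congr ?_ (by simp)
      intro y hy
      rw [max_eq_right hy]; simp
    have h2 : HasDerivWithinAt (fun s : ℝ => (max s 0) ^ (n + 2)) 0 (Ici 0) 0 := by
      have := (hasDerivAt_pow (n + 2) (0:ℝ)).hasDerivWithinAt (s := Ici 0)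
      have h3 : ((n + 2 : ℕ) : ℝ) * (0:ℝ) ^ (n + 2 - 1) = 0 := by simp
      rw [h3] at this
      refine this.congr ?_ (by simp)
      intro y hy
      rw [max_eq_left hy]
    have := h1.union h2
    rw [Iic_union_Ici, hasDerivWithinAt_univ] at this
    simpa using this
  · have : (fun s : ℝ => (max s 0) ^ (n + 2)) =ᶠ[nhds s] fun s => s ^ (n + 2) := by
      filter_upwards [Ioi_mem_nhds h] with y hy
      rw [max_eq_left (le_of_lt hy)]
    rw [max_eq_left h.le]
    simpa using (hasDerivAt_pow (n + 2) s).congr_of_eventuallyEq this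

/-- truncations -/
def tr4 (Λ s : ℝ) : ℝ := max (s - Λ) 0 ^ 4 + max (-s - Λ) 0 ^ 4
def tr3 (Λ s : ℝ) : ℝ := 4 * (max (s - Λ) 0 ^ 3 - max (-s - Λ) 0 ^ 3)
def tr2 (Λ s : ℝ) : ℝ := max (s - Λ) 0 ^ 2 + max (-s - Λ) 0 ^ 2
def tr1 (Λ s : ℝ) : ℝ := 2 * (max (s - Λ) 0 - max (-s - Λ) 0)

lemma pospow_comp1 (n : ℕ) (Λ s : ℝ) :
    HasDerivAt (fun s : ℝ => (max (s - Λ) 0) ^ (n + 2)) ((n + 2 : ℕ) * (max (s - Λ) 0) ^ (n + 1)) s := by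
  have := (hasDerivAt_pospow n (s - Λ)).comp s ((hasDerivAt_id s).sub_const Λ)
  refine this.congr_deriv ?_
  simp
lemma pospow_comp2 (n : ℕ) (Λ s : ℝ) :
    HasDerivAt (fun s : ℝ => (max (-s - Λ) 0) ^ (n + 2)) (-((n + 2 : ℕ) * (max (-s - Λ) 0) ^ (n + 1))) s := by
  have := (hasDerivAt_pospow n (-s - Λ)).comp s ((hasDerivAt_id s).neg.sub_const Λ)
  refine this.congr_deriv ?_
  simp

lemma tr4_hd (Λ s : ℝ) : HasDerivAt (tr4 Λ) (tr3 Λ s) s := by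
  refine ((pospow_comp1 2 Λ s).add (pospow_comp2 2 Λ s)).congr_deriv ?_
  unfold tr3; push_cast; ring
lemma tr3_hd (Λ s : ℝ) : HasDerivAt (tr3 Λ) (12 * tr2 Λ s) s := by
  refine (((pospow_comp1 1 Λ s).sub (pospow_comp2 1 Λ s)).const_mul 4).congr_deriv ?_
  unfold tr2; push_cast; ring
lemma tr2_hd (Λ s : ℝ) : HasDerivAt (tr2 Λ) (tr1 Λ s) s := by
  refine ((pospow_comp1 0 Λ s).add (pospow_comp2 0 Λ s)).congr_deriv ?_
  unfold tr1; push_cast; ring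
@[fun_prop] lemma tr4_cont (Λ : ℝ) : Continuous (tr4 Λ) := by unfold tr4; fun_prop
@[fun_prop] lemma tr3_cont (Λ : ℝ) : Continuous (tr3 Λ) := by unfold tr3; fun_prop
@[fun_prop] lemma tr2_cont (Λ : ℝ) : Continuous (tr2 Λ) := by unfold tr2; fun_prop
@[fun_prop] lemma tr1_cont (Λ : ℝ) : Continuous (tr1 Λ) := by unfold tr1; fun_prop
lemma tr_prod {Λ : ℝ} (hΛ : 0 ≤ Λ) (s : ℝ) : max (s - Λ) 0 * max (-s - Λ) 0 = 0 := by
  rcases le_total s Λ with h | h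
  · rw [max_eq_right (by linarith : s - Λ ≤ 0)]; simp
  · rw [max_eq_right (by linarith : -s - Λ ≤ 0)]; simp
lemma tr1_sq {Λ : ℝ} (hΛ : 0 ≤ Λ) (s : ℝ) : tr1 Λ s ^ 2 = 4 * tr2 Λ s := by
  have := tr_prod hΛ s
  unfold tr1 tr2
  linear_combination (-8) * this
lemma tr2_sq {Λ : ℝ} (hΛ : 0 ≤ Λ) (s : ℝ) : tr2 Λ s ^ 2 = tr4 Λ s := by
  have := tr_prod hΛ s
  unfold tr2 tr4
  linear_combination (2 * (max (s - Λ) 0 * max (-s - Λ) 0)) * this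
lemma tr2_nonneg (Λ s : ℝ) : 0 ≤ tr2 Λ s := by unfold tr2; positivity
lemma tr4_nonneg (Λ s : ℝ) : 0 ≤ tr4 Λ s := by unfold tr4; positivity
lemma tr_zero {Λ s : ℝ} (h : |s| ≤ Λ) : tr4 Λ s = 0 ∧ tr3 Λ s = 0 ∧ tr2 Λ s = 0 := by
  have h1 := abs_le.1 h
  unfold tr4 tr3 tr2
  rw [max_eq_right (by linarith [h1.2]), max_eq_right (by linarith [h1.1])]
  norm_num
lemma abs_le_of_tr4 {Λ s : ℝ} (h : tr4 Λ s = 0) : |s| ≤ Λ := by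
  unfold tr4 at h
  have a1 : 0 ≤ max (s - Λ) 0 ^ 4 := by positivity
  have a2 : 0 ≤ max (-s - Λ) 0 ^ 4 := by positivity
  have b1 : max (s - Λ) 0 = 0 := pow_eq_zero_iff (n := 4) (by norm_num) |>.1 (by linarith)
  have b2 : max (-s - Λ) 0 = 0 := pow_eq_zero_iff (n := 4) (by norm_num) |>.1 (by linarith)
  rw [abs_le]
  constructor
  · have := le_max_left (-s - Λ) 0; linarith
  · have := le_max_left (s - Λ) 0; linarith
lemma tr4_le {Λ : ℝ} (hΛ : 0 ≤ Λ) (s : ℝ) : tr4 Λ s ≤ s ^ 4 := by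
  rw [← tr2_sq hΛ]
  have : tr2 Λ s ≤ s ^ 2 := by
    unfold tr2
    rcases le_total s Λ with h | h
    · rw [max_eq_right (by linarith : s - Λ ≤ 0)]
      rcases le_total (-s - Λ) 0 with h' | h'
      · rw [max_eq_right h']; nlinarith [sq_nonneg s]
      · rw [max_eq_left h']; nlinarith
    · rw [max_eq_right (by linarith : -s - Λ ≤ 0), max_eq_left (by linarith)]; nlinarith
  nlinarith [tr2_nonneg Λ s]
lemma pow4_le_tr4 {Λ : ℝ} (hΛ : 0 ≤ Λ) (s : ℝ) : s ^ 4 ≤ 8 * tr4 Λ s + 8 * Λ ^ 4 := by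
  rw [← tr2_sq hΛ]
  have h2 : s ^ 2 ≤ 2 * tr2 Λ s + 2 * Λ ^ 2 := by
    unfold tr2
    have e1 := sq_nonneg (max (s - Λ) 0)
    have e2 := sq_nonneg (max (-s - Λ) 0)
    rcases le_total s Λ with h | h
    · rcases le_total (-s - Λ) 0 with h' | h'
      · nlinarith
      · rw [max_eq_left h'] at *
        nlinarith [sq_nonneg (-s - Λ - Λ)]
    · rw [max_eq_left (by linarith : 0 ≤ s - Λ)] at *
      nlinarith [sq_nonneg (s - Λ - Λ)]
  nlinarith [sq_nonneg (tr2 Λ s - Λ ^ 2), sq_nonneg s, tr2_nonneg Λ s]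

/-- static version of the truncated estimate -/
lemma trunc_static (hΓ : 0 < Γ) {κ R Λ : ℝ} (hκ : 0 < κ) (hΛ : 0 ≤ Λ)
    {θ θt u1 u2 T : SField} (hθ : ssmooth θ) (hθt : ssmooth θt) (hu1 : ssmooth u1) (hu2 : ssmooth u2)
    (hT : ssmooth T) (pθ : speriodic Γ θ) (pu1 : speriodic Γ u1) (pT : speriodic Γ T)
    (heq : ∀ x1, ∀ x2 ∈ Icc (0:ℝ) 1, θt x1 x2 + u1 x1 x2 * q1 θ x1 x2 + u2 x1 x2 * q2 θ x1 x2
      = κ * (q1 (q1 θ) x1 x2 + q2 (q2 θ) x1 x2) + κ * R * q1 T x1 x2)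
    (hdiv : ∀ x1, ∀ x2 ∈ Icc (0:ℝ) 1, q1 u1 x1 x2 + q2 u2 x1 x2 = 0)
    (hb0 : ∀ x1, u2 x1 0 = 0) (hb1 : ∀ x1, u2 x1 1 = 0)
    (hw0 : ∀ x1, |θ x1 0| ≤ Λ) (hw1 : ∀ x1, |θ x1 1| ≤ Λ)
    (hTb : ∀ x1 ∈ Ioo (0:ℝ) Γ, ∀ x2 ∈ Ioo (0:ℝ) 1, T x1 x2 ^ 2 ≤ 1) :
    intΩ Γ (fun x1 x2 => tr3 Λ (θ x1 x2) * θt x1 x2) ≤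
      -(κ / 4) * intΩ Γ (fun x1 x2 => tr4 Λ (θ x1 x2)) + 72 * κ * Γ * R ^ 4 := by
  have c0 := ss_cont hθ
  have c1 := ss_cont hθt
  have c2 := ss_cont hu1
  have c3 := ss_cont hu2
  have c4 := ss_cont hT
  have c5 := ss_cont (ss_q1 hθ)
  have c6 := ss_cont (ss_q2 hθ)
  have c7 := ss_cont (ss_q1 (ss_q1 hθ))
  have c8 := ss_cont (ss_q2 (ss_q2 hθ))
  have c9 := ss_cont (ss_q1 hu1)
  have c10 := ss_cont (ss_q2 hu2)
  have c11 := ss_cont (ss_q1 hT)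
  have p1 := per_q1 pθ
  have A : intΩ Γ (fun x1 x2 =>
      κ * (12 * tr2 Λ (θ x1 x2) * q1 θ x1 x2 * q1 θ x1 x2 + tr3 Λ (θ x1 x2) * q1 (q1 θ) x1 x2)
      - (q1 u1 x1 x2 * tr4 Λ (θ x1 x2) + u1 x1 x2 * (tr3 Λ (θ x1 x2) * q1 θ x1 x2))
      + κ * R * (12 * tr2 Λ (θ x1 x2) * q1 θ x1 x2 * T x1 x2 + tr3 Λ (θ x1 x2) * q1 T x1 x2)) = 0 := by
    refine intΩ_d1 hΓ (F := fun x1 x2 => κ * (tr3 Λ (θ x1 x2) * q1 θ x1 x2)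
      - u1 x1 x2 * tr4 Λ (θ x1 x2) + κ * R * (tr3 Λ (θ x1 x2) * T x1 x2)) ?_ ?_ (by fun_prop)
    · intro x1 x2 _
      have e3 := (tr3_hd Λ (θ x1 x2)).comp x1 (ss_hd1 hθ x1 x2)
      have e4 := (tr4_hd Λ (θ x1 x2)).comp x1 (ss_hd1 hθ x1 x2)
      exact (((e3.mul (ss_hd1 (ss_q1 hθ) x1 x2)).const_mul κ).sub ((ss_hd1 hu1 x1 x2).mul e4)).add
        ((e3.mul (ss_hd1 hT x1 x2)).const_mul (κ * R))
    · intro x1 x2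
      simp only [pθ x1 x2, pu1 x1 x2, pT x1 x2, p1 x1 x2]
  have B : intΩ Γ (fun x1 x2 =>
      κ * (12 * tr2 Λ (θ x1 x2) * q2 θ x1 x2 * q2 θ x1 x2 + tr3 Λ (θ x1 x2) * q2 (q2 θ) x1 x2)
      - (q2 u2 x1 x2 * tr4 Λ (θ x1 x2) + u2 x1 x2 * (tr3 Λ (θ x1 x2) * q2 θ x1 x2))) = 0 := by
    refine intΩ_d2_zero hΓ (F := fun x1 x2 => κ * (tr3 Λ (θ x1 x2) * q2 θ x1 x2)
      - u2 x1 x2 * tr4 Λ (θ x1 x2)) ?_ (by fun_prop) ?_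
    · intro x1 x2 _
      have e3 := (tr3_hd Λ (θ x1 x2)).comp x2 (ss_hd2 hθ x1 x2)
      have e4 := (tr4_hd Λ (θ x1 x2)).comp x2 (ss_hd2 hθ x1 x2)
      exact ((e3.mul (ss_hd2 (ss_q2 hθ) x1 x2)).const_mul κ).sub ((ss_hd2 hu2 x1 x2).mul e4)
    · intro x1
      simp only [hb0, hb1, (tr_zero (hw0 x1)).2.1, (tr_zero (hw1 x1)).2.1]
      ring
  have P : intΩ Γ (fun x1 x2 => tr2 Λ (θ x1 x2) ^ 2) ≤
      4 * intΩ Γ (fun x1 x2 => (tr1 Λ (θ x1 x2) * q2 θ x1 x2) ^ 2) := by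
    refine poincare_zero hΓ (F := fun x1 x2 => tr2 Λ (θ x1 x2)) (by fun_prop) (by fun_prop) ?_ ?_
    · intro x1 x2 _
      exact (tr2_hd Λ (θ x1 x2)).comp x2 (ss_hd2 hθ x1 x2)
    · intro x1
      exact (tr_zero (hw0 x1)).2.2
  simp only [tr2_sq hΛ] at P
  have Q : intΩ Γ (fun x1 x2 => tr3 Λ (θ x1 x2) * θt x1 x2) ≤ intΩ Γ (fun x1 x2 =>
      ((κ * (12 * tr2 Λ (θ x1 x2) * q1 θ x1 x2 * q1 θ x1 x2 + tr3 Λ (θ x1 x2) * q1 (q1 θ) x1 x2)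
      - (q1 u1 x1 x2 * tr4 Λ (θ x1 x2) + u1 x1 x2 * (tr3 Λ (θ x1 x2) * q1 θ x1 x2))
      + κ * R * (12 * tr2 Λ (θ x1 x2) * q1 θ x1 x2 * T x1 x2 + tr3 Λ (θ x1 x2) * q1 T x1 x2)) +
      (κ * (12 * tr2 Λ (θ x1 x2) * q2 θ x1 x2 * q2 θ x1 x2 + tr3 Λ (θ x1 x2) * q2 (q2 θ) x1 x2)
      - (q2 u2 x1 x2 * tr4 Λ (θ x1 x2) + u2 x1 x2 * (tr3 Λ (θ x1 x2) * q2 θ x1 x2)))) +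
      (-(3/2) * κ) * (tr1 Λ (θ x1 x2) * q2 θ x1 x2) ^ 2 + κ / 8 * tr4 Λ (θ x1 x2) + 72 * κ * R ^ 4) := by
    refine intΩ_mono (by fun_prop) (by fun_prop) ?_
    intro x1 h1 x2 h2
    have E := heq x1 x2 (Ioo_subset_Icc_self h2)
    have D := hdiv x1 x2 (Ioo_subset_Icc_self h2)
    have hTT := hTb x1 h1 x2 h2
    have s1 := tr1_sq hΛ (θ x1 x2)
    have s2 := tr2_sq hΛ (θ x1 x2)
    have s3 := tr2_nonneg Λ (θ x1 x2)
    rw [mul_pow, s1]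
    generalize tr1 Λ (θ x1 x2) = w1 at *
    generalize tr2 Λ (θ x1 x2) = w2 at *
    generalize tr3 Λ (θ x1 x2) = w3 at *
    generalize tr4 Λ (θ x1 x2) = w4 at *
    have hθt' : θt x1 x2 = κ * (q1 (q1 θ) x1 x2 + q2 (q2 θ) x1 x2) + κ * R * q1 T x1 x2
      - u1 x1 x2 * q1 θ x1 x2 - u2 x1 x2 * q2 θ x1 x2 := by linarith
    rw [hθt', ← s2]
    have hdd : q2 u2 x1 x2 = - q1 u1 x1 x2 := by linarith
    rw [hdd]
    generalize q1 θ x1 x2 = a at *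
    generalize q2 θ x1 x2 = b at *
    generalize T x1 x2 = τ at *
    have k1 : 0 ≤ 12 * w2 * a ^ 2 + 12 * w2 * R * a * τ + 6 * w2 * b ^ 2 + w2 ^ 2 / 8 + 72 * R ^ 4 := by
      have m1 : 0 ≤ w2 * (6 * (a + R * τ) ^ 2) := by positivity
      have m2 : 0 ≤ w2 * (6 * R ^ 2 * (1 - τ ^ 2)) :=
        mul_nonneg s3 (mul_nonneg (by positivity) (by linarith))
      have m3 : 0 ≤ w2 * (6 * a ^ 2) := by positivity
      have m4 : 0 ≤ 6 * w2 * b ^ 2 := by positivity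
      nlinarith [sq_nonneg (w2 / 4 - 12 * R ^ 2)]
    have k2 := mul_nonneg hκ.le k1
    nlinarith
  rw [intΩ_add _ _ (by fun_prop) (by fun_prop), intΩ_add _ _ (by fun_prop) (by fun_prop),
    intΩ_add _ _ (by fun_prop) (by fun_prop), intΩ_add _ _ (by fun_prop) (by fun_prop), A, B,
    intΩ_cmul, intΩ_cmul, intΩ_const hΓ] at Q
  have P2 := mul_le_mul_of_nonneg_left P hκ.le
  nlinarith

/-- truncated `L⁴` estimate for advection-diffusion equations -/
lemma trunc_bound (hΓ : 0 < Γ) {κ R Λ t : ℝ} (hκ : 0 < κ) (hΛ : 0 ≤ Λ) (ht : 0 ≤ t)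
    {θ u1 u2 T : TField} (hθ : tsmooth θ) (hu1 : tsmooth u1) (hu2 : tsmooth u2)
    (hT : tsmooth T) (pθ : tperiodic Γ θ) (pu1 : tperiodic Γ u1) (pT : tperiodic Γ T)
    (heq : ∀ s x1 x2, 0 ≤ s → x2 ∈ Icc (0:ℝ) 1 →
      dt θ s x1 x2 + u1 s x1 x2 * d1 θ s x1 x2 + u2 s x1 x2 * d2 θ s x1 x2
      = κ * (d1 (d1 θ) s x1 x2 + d2 (d2 θ) s x1 x2) + κ * R * d1 T s x1 x2)
    (hdiv : ∀ s x1 x2, 0 ≤ s → x2 ∈ Icc (0:ℝ) 1 → d1 u1 s x1 x2 + d2 u2 s x1 x2 = 0)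
    (hb0 : ∀ s x1, 0 ≤ s → u2 s x1 0 = 0) (hb1 : ∀ s x1, 0 ≤ s → u2 s x1 1 = 0)
    (hw0 : ∀ s ∈ Icc 0 t, ∀ x1, |θ s x1 0| ≤ Λ) (hw1 : ∀ s ∈ Icc 0 t, ∀ x1, |θ s x1 1| ≤ Λ)
    (hTb : ∀ s, 0 ≤ s → ∀ x1 ∈ Ioo (0:ℝ) Γ, ∀ x2 ∈ Ioo (0:ℝ) 1, T s x1 x2 ^ 2 ≤ 1) :
    intΩ Γ (fun x1 x2 => tr4 Λ (θ t x1 x2)) ≤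
      max (intΩ Γ (fun x1 x2 => tr4 Λ (θ 0 x1 x2))) (288 * Γ * R ^ 4) := by
  have c0 := ts_cont hθ
  have c1 := ts_cont (ts_dt hθ)
  have hd : ∀ s, HasDerivAt (fun s => intΩ Γ (fun x1 x2 => tr4 Λ (θ s x1 x2)))
      (intΩ Γ (fun x1 x2 => tr3 Λ (θ s x1 x2) * dt θ s x1 x2)) s := by
    intro s
    exact intΩ_hasDerivAt (F := fun s x1 x2 => tr4 Λ (θ s x1 x2))
      (F' := fun s x1 x2 => tr3 Λ (θ s x1 x2) * dt θ s x1 x2) (by fun_prop) (by fun_prop)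
      (fun s x1 x2 => by
        have h := (tr4_hd Λ (θ s x1 x2)).comp s (ts_hdt hθ s x1 x2)
        exact h) s
  have := ode_bound (a := κ / 4) (b := 72 * κ * Γ * R ^ 4) (by positivity) ht hd ?_
  · refine this.trans (le_of_eq ?_)
    congr 1
    field_simp; ring
  · intro s hs
    exact trunc_static hΓ hκ hΛ (ts_slice hθ s) (ts_slice (ts_dt hθ) s) (ts_slice hu1 s)
      (ts_slice hu2 s) (ts_slice hT s) (pθ s) (pu1 s) (pT s) (fun x1 x2 h2 => heq s x1 x2 hs.1 h2)
      (fun x1 x2 h2 => hdiv s x1 x2 hs.1 h2) (fun x1 => hb0 s x1 hs.1) (fun x1 => hb1 s x1 hs.1)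
      (hw0 s hs) (hw1 s hs) (hTb s hs.1)

/-! Wall estimate -/

lemma ii_integrableOn {a b c d : ℝ} {g : ℝ × ℝ → ℝ} (hg : Continuous g) :
    IntegrableOn g (Ioc a b ×ˢ Ioc c d) := by
  have h : IntegrableOn g (Icc a b ×ˢ Icc c d) :=
    hg.continuousOn.integrableOn_compact (isCompact_Icc.prod isCompact_Icc)
  exact h.mono_set (Set.prod_mono Ioc_subset_Icc_self Ioc_subset_Icc_self)

lemma ii_box {a b c d : ℝ} (hab : a ≤ b) (hcd : c ≤ d) {g : ℝ → ℝ → ℝ}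
    (hg : Continuous (fun q : ℝ × ℝ => g q.1 q.2)) :
    ∫ q in Ioo a b ×ˢ Ioo c d, g q.1 q.2 = ∫ x in a..b, ∫ y in c..d, g x y := by
  have h2 := setIntegral_prod (μ := (volume : Measure ℝ)) (ν := (volume : Measure ℝ))
    (fun q : ℝ × ℝ => g q.1 q.2) ((ii_integrableOn (a := a) (b := b) (c := c) (d := d) hg).mono_set
      (Set.prod_mono Ioo_subset_Ioc_self Ioo_subset_Ioc_self))
  rw [show (volume : Measure (ℝ × ℝ)) = (volume : Measure ℝ).prod volume from rfl, h2]
  simp only [intervalIntegral.integral_of_le hab, intervalIntegral.integral_of_le hcd,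
    integral_Ioc_eq_integral_Ioo]

lemma ii_swap {a b c d : ℝ} (hab : a ≤ b) (hcd : c ≤ d) {g : ℝ → ℝ → ℝ}
    (hg : Continuous (fun q : ℝ × ℝ => g q.1 q.2)) :
    ∫ x in a..b, ∫ y in c..d, g x y = ∫ y in c..d, ∫ x in a..b, g x y := by
  simp only [intervalIntegral.integral_of_le hab, intervalIntegral.integral_of_le hcd]
  refine integral_integral_swap ?_
  have h := ii_integrableOn (a := a) (b := b) (c := c) (d := d) hg
  unfold IntegrableOn at h
  rw [show (volume : Measure (ℝ × ℝ)) = (volume : Measure ℝ).prod volume from rfl,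
    ← Measure.prod_restrict] at h
  exact h

lemma polar_ineq {r a : ℝ} (hr0 : 0 < r) (hr1 : r ≤ 1) (hrΓ : r ≤ Γ / 2) {g : SField}
    (hg : Continuous (fun q : ℝ × ℝ => g q.1 q.2)) (hp : speriodic Γ g) (h0 : ∀ x1 x2, 0 ≤ g x1 x2) :
    ∫ ρ in (0:ℝ)..r, ∫ θ in (0:ℝ)..Real.pi, ρ * g (a + ρ * Real.cos θ) (ρ * Real.sin θ)
      ≤ intΩ Γ g := by
  have hΓ : 0 < Γ := by linarith
  rw [← ii_box hr0.le Real.pi_pos.le (g := fun ρ θ => ρ * g (a + ρ * Real.cos θ) (ρ * Real.sin θ))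
    (by fun_prop)]
  set S : Set (ℝ × ℝ) := Ioo 0 r ×ˢ Ioo 0 Real.pi
  have hS : S ⊆ polarCoord.target := by
    rintro ⟨x, y⟩ ⟨h1, h2⟩
    exact ⟨h1.1, by have := Real.pi_pos; linarith [h2.1], h2.2⟩
  have h1 := integral_image_eq_integral_abs_det_fderiv_smul (volume : Measure (ℝ × ℝ))
    (s := S) (measurableSet_Ioo.prod measurableSet_Ioo)
    (fun p _ => (hasFDerivAt_polarCoord_symm p).hasFDerivWithinAt)
    (polarCoord.symm.injOn.mono hS) (fun q : ℝ × ℝ => g (a + q.1) q.2)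
  have h2 : ∫ q in S, (fun q : ℝ × ℝ => q.1 * g (a + q.1 * Real.cos q.2) (q.1 * Real.sin q.2)) q
      = ∫ x in S, |(fderivPolarCoordSymm x).det| • g (a + (polarCoord.symm x).1) (polarCoord.symm x).2 := by
    refine setIntegral_congr_fun (measurableSet_Ioo.prod measurableSet_Ioo) ?_
    rintro ⟨x, y⟩ ⟨hx, hy⟩
    simp only [det_fderivPolarCoordSymm, smul_eq_mul, polarCoord_symm_apply]
    rw [abs_of_pos hx.1]
  have hcg : Continuous (fun q : ℝ × ℝ => g (a + q.1) q.2) := by fun_prop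
  have h3 : (∫ x in polarCoord.symm '' S, g (a + x.1) x.2)
      ≤ ∫ x in Ioo (-(Γ/2)) (Γ/2) ×ˢ Ioo (0:ℝ) 1, g (a + x.1) x.2 := by
    refine setIntegral_mono_set ((ii_integrableOn hcg).mono_set
      (Set.prod_mono Ioo_subset_Ioc_self Ioo_subset_Ioc_self))
      (Eventually.of_forall (fun q => h0 _ _)) (LE.le.eventuallyLE ?_)
    rintro _ ⟨⟨x, y⟩, ⟨hx, hy⟩, rfl⟩
    simp only [polarCoord_symm_apply]
    have hx1 : 0 < x := hx.1
    have hx2 : x < r := hx.2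
    have c1 := Real.cos_le_one y
    have c2 := Real.neg_one_le_cos y
    have s1 := Real.sin_pos_of_mem_Ioo hy
    have s2 := Real.sin_le_one y
    refine ⟨⟨?_, ?_⟩, ?_, ?_⟩ <;> simp only <;> nlinarith
  have h4 := ii_box (a := -(Γ/2)) (b := Γ/2) (by linarith) zero_le_one (g := fun x y => g (a + x) y) hcg
  rw [h4] at h3
  have h5 : (∫ x in (-(Γ/2))..(Γ/2), ∫ y in (0:ℝ)..1, g (a + x) y) = intΩ Γ g := by
    rw [intΩ_eq_iter hΓ]
    rw [intervalIntegral.integral_comp_add_left (fun x => ∫ y in (0:ℝ)..1, g x y) a]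
    have hper : Function.Periodic (fun x => ∫ y in (0:ℝ)..1, g x y) Γ := by
      intro x; simp only [hp x]
    have := hper.intervalIntegral_add_eq (a + -(Γ/2)) 0
    rw [zero_add] at this
    rw [← this]; congr 1; ring
  have h6 : (∫ q in S, (fun ρ θ => ρ * g (a + ρ * Real.cos θ) (ρ * Real.sin θ)) q.1 q.2) = _ := h2
  rw [h6, ← h1, ← h5]
  exact h3

lemma wall_id {v1 v2 : SField} (h1 : ssmooth v1) (h2 : ssmooth v2) (a : ℝ)
    (hdiv : ∀ x1, ∀ x2 ∈ Icc (0:ℝ) 1, q1 v1 x1 x2 + q2 v2 x1 x2 = 0)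
    (hb : ∀ x1, v2 x1 0 = 0) {ρ : ℝ} (hρ0 : 0 < ρ) (hρ1 : ρ ≤ 1) :
    Real.pi * v1 a 0 = (∫ θ in (0:ℝ)..Real.pi, v1 (a + ρ * Real.cos θ) (ρ * Real.sin θ))
      + ∫ s in (0:ℝ)..ρ, ∫ θ in (0:ℝ)..Real.pi, Real.sin θ *
        (q1 v2 (a + s * Real.cos θ) (s * Real.sin θ) - q2 v1 (a + s * Real.cos θ) (s * Real.sin θ)) := by
  have c11 := ss_cont (ss_q1 h1)
  have c12 := ss_cont (ss_q2 h1)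
  have c21 := ss_cont (ss_q1 h2)
  have c22 := ss_cont (ss_q2 h2)
  have c1 := ss_cont h1
  have c2 := ss_cont h2
  -- radial derivative
  have e1 : ∀ θ : ℝ, v1 (a + ρ * Real.cos θ) (ρ * Real.sin θ) = v1 a 0 +
      ∫ s in (0:ℝ)..ρ, (Real.cos θ * q1 v1 (a + s * Real.cos θ) (s * Real.sin θ)
        + Real.sin θ * q2 v1 (a + s * Real.cos θ) (s * Real.sin θ)) := by
    intro θ
    rw [intervalIntegral.integral_eq_sub_of_hasDerivAt
      (f := fun s => v1 (a + s * Real.cos θ) (s * Real.sin θ)) ?_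
      (Continuous.intervalIntegrable (by fun_prop) _ _)]
    · simp
    · intro s _
      have ha : HasDerivAt (fun s => a + s * Real.cos θ) (Real.cos θ) s := by
        simpa using ((hasDerivAt_id s).mul_const (Real.cos θ)).const_add a
      have hb : HasDerivAt (fun s => s * Real.sin θ) (Real.sin θ) s := by
        simpa using ((hasDerivAt_id s).mul_const (Real.sin θ))
      exact ss_chain h1 ha hb
  have e2 : (∫ θ in (0:ℝ)..Real.pi, v1 (a + ρ * Real.cos θ) (ρ * Real.sin θ)) = Real.pi * v1 a 0 +
      ∫ s in (0:ℝ)..ρ, ∫ θ in (0:ℝ)..Real.pi,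
        (Real.cos θ * q1 v1 (a + s * Real.cos θ) (s * Real.sin θ)
        + Real.sin θ * q2 v1 (a + s * Real.cos θ) (s * Real.sin θ)) := by
    rw [ii_swap hρ0.le Real.pi_pos.le (by fun_prop)]
    rw [show (fun θ => v1 (a + ρ * Real.cos θ) (ρ * Real.sin θ)) = _ from funext e1]
    rw [intervalIntegral.integral_add (by simp)]
    · simp
    · refine Continuous.intervalIntegrable ?_ _ _
      exact intervalIntegral.continuous_parametric_intervalIntegral_of_continuous' (by fun_prop) _ _
  rw [e2]
  have e3 : ∀ s ∈ Ioo 0 ρ, (∫ θ in (0:ℝ)..Real.pi,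
        (Real.cos θ * q1 v1 (a + s * Real.cos θ) (s * Real.sin θ)
        + Real.sin θ * q2 v1 (a + s * Real.cos θ) (s * Real.sin θ))) =
      - ∫ θ in (0:ℝ)..Real.pi, Real.sin θ *
        (q1 v2 (a + s * Real.cos θ) (s * Real.sin θ) - q2 v1 (a + s * Real.cos θ) (s * Real.sin θ)) := by
    intro s hs
    have hd : ∀ θ ∈ uIcc (0:ℝ) Real.pi, HasDerivAt (fun θ => v2 (a + s * Real.cos θ) (s * Real.sin θ))
        (s * (-Real.sin θ) * q1 v2 (a + s * Real.cos θ) (s * Real.sin θ)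
        + s * Real.cos θ * q2 v2 (a + s * Real.cos θ) (s * Real.sin θ)) θ := by
      intro θ _
      have ha : HasDerivAt (fun θ => a + s * Real.cos θ) (s * (-Real.sin θ)) θ :=
        ((Real.hasDerivAt_cos θ).const_mul s).const_add a
      have hb : HasDerivAt (fun θ => s * Real.sin θ) (s * Real.cos θ) θ :=
        ((Real.hasDerivAt_sin θ).const_mul s)
      exact ss_chain h2 ha hb
    have h3 := intervalIntegral.integral_eq_sub_of_hasDerivAt hd
      (Continuous.intervalIntegrable (by fun_prop) _ _)
    simp only [Real.sin_pi, Real.sin_zero, mul_zero, hb, sub_zero] at h3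
    have h4 : (∫ θ in (0:ℝ)..Real.pi,
        (Real.cos θ * q1 v1 (a + s * Real.cos θ) (s * Real.sin θ)
        + Real.sin θ * q2 v1 (a + s * Real.cos θ) (s * Real.sin θ))) =
      ∫ θ in (0:ℝ)..Real.pi, ((-1) * (Real.sin θ *
        (q1 v2 (a + s * Real.cos θ) (s * Real.sin θ) - q2 v1 (a + s * Real.cos θ) (s * Real.sin θ)))
        + (-(1/s)) * (s * (-Real.sin θ) * q1 v2 (a + s * Real.cos θ) (s * Real.sin θ)
        + s * Real.cos θ * q2 v2 (a + s * Real.cos θ) (s * Real.sin θ))) := by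
      refine intervalIntegral.integral_congr (fun θ hθ => ?_)
      rw [uIcc_of_le Real.pi_pos.le] at hθ
      have hs0 : s ≠ 0 := hs.1.ne'
      have hx : s * Real.sin θ ∈ Icc (0:ℝ) 1 := by
        have := Real.sin_nonneg_of_mem_Icc hθ
        have := Real.sin_le_one θ
        constructor <;> nlinarith [hs.1, hs.2]
      have h5 := hdiv (a + s * Real.cos θ) _ hx
      have h6 : q1 v1 (a + s * Real.cos θ) (s * Real.sin θ) = - q2 v2 (a + s * Real.cos θ) (s * Real.sin θ) := by
        linarith
      simp only [h6]
      field_simp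
      ring
    rw [h4, intervalIntegral.integral_add (Continuous.intervalIntegrable (by fun_prop) _ _)
      (Continuous.intervalIntegrable (by fun_prop) _ _), intervalIntegral.integral_const_mul,
      intervalIntegral.integral_const_mul, h3]
    ring
  have e4 : (∫ s in (0:ℝ)..ρ, ∫ θ in (0:ℝ)..Real.pi,
        (Real.cos θ * q1 v1 (a + s * Real.cos θ) (s * Real.sin θ)
        + Real.sin θ * q2 v1 (a + s * Real.cos θ) (s * Real.sin θ))) = 
      ∫ s in (0:ℝ)..ρ, - ∫ θ in (0:ℝ)..Real.pi, Real.sin θ *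
        (q1 v2 (a + s * Real.cos θ) (s * Real.sin θ) - q2 v1 (a + s * Real.cos θ) (s * Real.sin θ)) := by
    rw [intervalIntegral.integral_of_le hρ0.le, intervalIntegral.integral_of_le hρ0.le,
      integral_Ioc_eq_integral_Ioo, integral_Ioc_eq_integral_Ioo]
    exact setIntegral_congr_fun measurableSet_Ioo e3
  rw [e4, intervalIntegral.integral_neg]
  ring

lemma wall_l1 {r a m : ℝ} (hr0 : 0 < r) (hr1 : r ≤ 1) (hrΓ : r ≤ Γ / 2) (hm : 0 < m) {w : SField}
    (hw : Continuous (fun q : ℝ × ℝ => w q.1 q.2)) (hp : speriodic Γ w)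
    (hI : intΩ Γ (fun x1 x2 => w x1 x2 ^ 4) ≤ m ^ 4) :
    ∫ s in (0:ℝ)..r, ∫ θ in (0:ℝ)..Real.pi, |w (a + s * Real.cos θ) (s * Real.sin θ)|
      ≤ 5 * (Real.sqrt r * m) := by
  have hP := polar_ineq (a := a) hr0 hr1 hrΓ (g := fun x1 x2 => w x1 x2 ^ 4) (by fun_prop)
    (fun x1 x2 => by simp only [hp x1 x2]) (fun x1 x2 => by positivity)
  set q := Real.sqrt r with hq
  have hq0 : 0 < q := Real.sqrt_pos.2 hr0
  have hqq : q * q = r := Real.mul_self_sqrt hr0.le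
  have hpi := Real.pi_pos
  have hpi4 := Real.pi_lt_d2
  have cw : Continuous (fun p : ℝ × ℝ => w (a + p.1 * Real.cos p.2) (p.1 * Real.sin p.2)) := by
    fun_prop
  have ci : ∀ {F : ℝ → ℝ → ℝ}, Continuous (fun p : ℝ × ℝ => F p.1 p.2) →
      Continuous (fun s => ∫ θ in (0:ℝ)..Real.pi, F s θ) := fun h =>
    intervalIntegral.continuous_parametric_intervalIntegral_of_continuous' h _ _
  have h1 : ∀ s ∈ Ioo 0 r, (∫ θ in (0:ℝ)..Real.pi, |w (a + s * Real.cos θ) (s * Real.sin θ)|)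
      ≤ (q / (4 * m ^ 3)) * (∫ θ in (0:ℝ)..Real.pi, s * w (a + s * Real.cos θ) (s * Real.sin θ) ^ 4)
        + (Real.pi * m / (4 * q) + Real.pi * m / 2 * s ^ (-(1/2) : ℝ)) := by
    intro s hs
    have hs0 : 0 < s := hs.1
    set k := Real.sqrt s
    have hk : 0 < k := Real.sqrt_pos.2 hs0
    have hkk : k * k = s := Real.mul_self_sqrt hs0.le
    have e : s ^ (-(1/2) : ℝ) = 1 / k := by
      rw [Real.rpow_neg hs0.le, ← Real.sqrt_eq_rpow, one_div]
    rw [e]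
    have h2 : (∫ θ in (0:ℝ)..Real.pi, |w (a + s * Real.cos θ) (s * Real.sin θ)|) ≤
        ∫ θ in (0:ℝ)..Real.pi, ((q / (4 * m ^ 3)) * (s * w (a + s * Real.cos θ) (s * Real.sin θ) ^ 4)
          + (m / (4 * q) + m / 2 * (1 / k))) := by
      refine intervalIntegral.integral_mono_on hpi.le
        (Continuous.intervalIntegrable (by fun_prop) _ _)
        (Continuous.intervalIntegrable (by fun_prop) _ _) (fun θ _ => ?_)
      set y := w (a + s * Real.cos θ) (s * Real.sin θ)
      have a1 : |y| ≤ k / (2 * m) * y ^ 2 + m / 2 * (1 / k) := by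
        have : 0 ≤ (k / (2 * m)) * (|y| - m / k) ^ 2 := by positivity
        have e3 : (k / (2 * m)) * (|y| - m / k) ^ 2 = k / (2 * m) * y ^ 2 - |y| + m / 2 * (1 / k) := by
          rw [sub_sq, sq_abs]; field_simp
        linarith
      have a2 : k / (2 * m) * y ^ 2 ≤ q / (4 * m ^ 3) * (s * y ^ 4) + m / (4 * q) := by
        have : 0 ≤ (q / (4 * m ^ 3)) * (k * y ^ 2 - m ^ 2 / q) ^ 2 := by positivity
        have e3 : (q / (4 * m ^ 3)) * (k * y ^ 2 - m ^ 2 / q) ^ 2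
            = q / (4 * m ^ 3) * ((k * k) * y ^ 4) - k / (2 * m) * y ^ 2 + m / (4 * q) := by
          field_simp; ring
        rw [hkk] at e3
        linarith
      linarith
    rw [intervalIntegral.integral_add (Continuous.intervalIntegrable (by fun_prop) _ _)
      (by simp), intervalIntegral.integral_const_mul] at h2
    simp only [intervalIntegral.integral_const, smul_eq_mul, sub_zero] at h2
    refine h2.trans (le_of_eq ?_)
    ring
  have hrp : IntervalIntegrable (fun s : ℝ => s ^ (-(1/2) : ℝ)) volume 0 r :=
    intervalIntegral.intervalIntegrable_rpow' (by norm_num)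
  have hi1 : IntervalIntegrable (fun s : ℝ => (q / (4 * m ^ 3)) * (∫ θ in (0:ℝ)..Real.pi, s * w (a + s * Real.cos θ) (s * Real.sin θ) ^ 4)) volume 0 r :=
    ((ci (by fun_prop)).const_mul _).intervalIntegrable _ _
  have hi2 : IntervalIntegrable (fun s : ℝ => Real.pi * m / (4 * q) + Real.pi * m / 2 * s ^ (-(1/2) : ℝ)) volume 0 r :=
    (by simp : IntervalIntegrable (fun _ => Real.pi * m / (4 * q)) volume 0 r).add (hrp.const_mul _)
  have h3 := intervalIntegral.integral_mono_on_of_le_Ioo hr0.le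
    ((ci (F := fun s θ => |w (a + s * Real.cos θ) (s * Real.sin θ)|) (by fun_prop)).intervalIntegrable _ _)
    (hi1.add hi2) h1
  rw [intervalIntegral.integral_add hi1 hi2, intervalIntegral.integral_const_mul,
    intervalIntegral.integral_add (by simp) (hrp.const_mul _), intervalIntegral.integral_const_mul,
    integral_rpow (Or.inl (by norm_num))] at h3
  have e5 : (r ^ (-(1/2) + 1 : ℝ) - 0 ^ (-(1/2) + 1 : ℝ)) / (-(1/2) + 1) = 2 * q := by
    rw [show (-(1/2) + 1 : ℝ) = 1/2 by norm_num, ← Real.sqrt_eq_rpow, Real.zero_rpow (by norm_num)]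
    rw [← hq]; ring
  rw [e5] at h3
  simp only [intervalIntegral.integral_const, smul_eq_mul, sub_zero] at h3
  refine h3.trans ?_
  have h4 : q / (4 * m ^ 3) * (∫ s in (0:ℝ)..r, ∫ θ in (0:ℝ)..Real.pi, s * w (a + s * Real.cos θ) (s * Real.sin θ) ^ 4)
      ≤ q / (4 * m ^ 3) * m ^ 4 := by
    refine mul_le_mul_of_nonneg_left (hP.trans hI) (by positivity)
  have h5 : q / (4 * m ^ 3) * m ^ 4 = q * m / 4 := by field_simp
  have h6 : r * (Real.pi * m / (4 * q)) = Real.pi / 4 * (q * m) := by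
    rw [← hqq]; field_simp
  have h7 : 0 < q * m := by positivity
  nlinarith

lemma wall_bound {r a m U : ℝ} (hr0 : 0 < r) (hr1 : r ≤ 1) (hrΓ : r ≤ Γ / 2) (hm : 0 < m)
    (hU : 0 < U) {v1 v2 : SField} (h1 : ssmooth v1) (h2 : ssmooth v2)
    (p1 : speriodic Γ v1) (p2 : speriodic Γ v2)
    (hdiv : ∀ x1, ∀ x2 ∈ Icc (0:ℝ) 1, q1 v1 x1 x2 + q2 v2 x1 x2 = 0)
    (hb : ∀ x1, v2 x1 0 = 0) (hIU : intΩ Γ (fun x1 x2 => v1 x1 x2 ^ 2) ≤ U ^ 2)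
    (hI : intΩ Γ (fun x1 x2 => (q1 v2 x1 x2 - q2 v1 x1 x2) ^ 4) ≤ m ^ 4) :
    |v1 a 0| ≤ 2 * (U / r + Real.sqrt r * m) := by
  have c12 := ss_cont (ss_q2 h1)
  have c21 := ss_cont (ss_q1 h2)
  have c1 := ss_cont h1
  have hpi := Real.pi_pos
  have hpi3 := Real.pi_gt_three
  have hpi4 := Real.pi_lt_d2
  have hN := wall_l1 (a := a) hr0 hr1 hrΓ hm (w := fun x1 x2 => q1 v2 x1 x2 - q2 v1 x1 x2)
    (by fun_prop) (fun x1 x2 => by simp only [per_q1 p2 x1 x2, per_q2 p1 x1 x2]) hI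
  set N := ∫ s in (0:ℝ)..r, ∫ θ in (0:ℝ)..Real.pi,
    |q1 v2 (a + s * Real.cos θ) (s * Real.sin θ) - q2 v1 (a + s * Real.cos θ) (s * Real.sin θ)| with hNdef
  have ci : ∀ {F : ℝ → ℝ → ℝ}, Continuous (fun p : ℝ × ℝ => F p.1 p.2) →
      Continuous (fun s => ∫ θ in (0:ℝ)..Real.pi, F s θ) := fun h =>
    intervalIntegral.continuous_parametric_intervalIntegral_of_continuous' h _ _
  have hP := polar_ineq (a := a) hr0 hr1 hrΓ (g := fun x1 x2 => v1 x1 x2 ^ 2) (by fun_prop)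
    (fun x1 x2 => by simp only [p1 x1 x2]) (fun x1 x2 => by positivity)
  have key : ∀ ρ ∈ Icc 0 r, Real.pi * |v1 a 0| * ρ ≤
      (r / (2 * U)) * (∫ θ in (0:ℝ)..Real.pi, ρ * v1 (a + ρ * Real.cos θ) (ρ * Real.sin θ) ^ 2)
      + (Real.pi * (U / (2 * r)) + N) * ρ := by
    intro ρ hρ
    rcases hρ.1.eq_or_lt with h0 | h0
    · rw [← h0]; simp
    have hid := wall_id h1 h2 a hdiv hb h0 (hρ.2.trans hr1)
    have b1 : |∫ θ in (0:ℝ)..Real.pi, v1 (a + ρ * Real.cos θ) (ρ * Real.sin θ)| ≤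
        (r / (2 * U)) * (∫ θ in (0:ℝ)..Real.pi, v1 (a + ρ * Real.cos θ) (ρ * Real.sin θ) ^ 2)
        + Real.pi * (U / (2 * r)) := by
      refine (intervalIntegral.abs_integral_le_integral_abs hpi.le).trans ?_
      have h3 : (∫ θ in (0:ℝ)..Real.pi, |v1 (a + ρ * Real.cos θ) (ρ * Real.sin θ)|) ≤
          ∫ θ in (0:ℝ)..Real.pi, ((r / (2 * U)) * v1 (a + ρ * Real.cos θ) (ρ * Real.sin θ) ^ 2
            + U / (2 * r)) := by
        refine intervalIntegral.integral_mono_on hpi.le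
          (Continuous.intervalIntegrable (by fun_prop) _ _)
          (Continuous.intervalIntegrable (by fun_prop) _ _) (fun θ _ => ?_)
        set y := v1 (a + ρ * Real.cos θ) (ρ * Real.sin θ)
        have : 0 ≤ (r / (2 * U)) * (|y| - U / r) ^ 2 := by positivity
        have e3 : (r / (2 * U)) * (|y| - U / r) ^ 2 = r / (2 * U) * y ^ 2 - |y| + U / (2 * r) := by
          rw [sub_sq, sq_abs]; field_simp
        linarith
      rw [intervalIntegral.integral_add (Continuous.intervalIntegrable (by fun_prop) _ _)
        (by simp), intervalIntegral.integral_const_mul] at h3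
      simpa only [intervalIntegral.integral_const, smul_eq_mul, sub_zero] using h3
    have b2 : |∫ s in (0:ℝ)..ρ, ∫ θ in (0:ℝ)..Real.pi, Real.sin θ *
        (q1 v2 (a + s * Real.cos θ) (s * Real.sin θ) - q2 v1 (a + s * Real.cos θ) (s * Real.sin θ))| ≤ N := by
      refine (intervalIntegral.abs_integral_le_integral_abs h0.le).trans ?_
      have h4 : (∫ s in (0:ℝ)..ρ, |∫ θ in (0:ℝ)..Real.pi, Real.sin θ *
        (q1 v2 (a + s * Real.cos θ) (s * Real.sin θ) - q2 v1 (a + s * Real.cos θ) (s * Real.sin θ))|) ≤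
          ∫ s in (0:ℝ)..ρ, ∫ θ in (0:ℝ)..Real.pi,
        |q1 v2 (a + s * Real.cos θ) (s * Real.sin θ) - q2 v1 (a + s * Real.cos θ) (s * Real.sin θ)| := by
        refine intervalIntegral.integral_mono_on h0.le
          ((ci (F := fun s θ => Real.sin θ *
        (q1 v2 (a + s * Real.cos θ) (s * Real.sin θ) - q2 v1 (a + s * Real.cos θ) (s * Real.sin θ)))
            (by fun_prop)).abs.intervalIntegrable _ _)
          ((ci (by fun_prop)).intervalIntegrable _ _) (fun s _ => ?_)
        refine (intervalIntegral.abs_integral_le_integral_abs hpi.le).trans ?_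
        refine intervalIntegral.integral_mono_on hpi.le
          (Continuous.intervalIntegrable (by fun_prop) _ _)
          (Continuous.intervalIntegrable (by fun_prop) _ _) (fun θ _ => ?_)
        rw [abs_mul]
        exact mul_le_of_le_one_left (abs_nonneg _) (Real.abs_sin_le_one θ)
      refine h4.trans ?_
      rw [hNdef]
      refine intervalIntegral.integral_mono_interval le_rfl h0.le hρ.2 ?_
        ((ci (by fun_prop)).intervalIntegrable _ _)
      exact Eventually.of_forall fun s => intervalIntegral.integral_nonneg hpi.le
        (fun θ _ => abs_nonneg _)
    have b3 : Real.pi * |v1 a 0| ≤ 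
        (r / (2 * U)) * (∫ θ in (0:ℝ)..Real.pi, v1 (a + ρ * Real.cos θ) (ρ * Real.sin θ) ^ 2)
        + Real.pi * (U / (2 * r)) + N := by
      have : Real.pi * |v1 a 0| = |Real.pi * v1 a 0| := by rw [abs_mul, abs_of_pos hpi]
      rw [this, hid]
      refine (abs_add_le _ _).trans (add_le_add b1 b2)
    have b4 := mul_le_mul_of_nonneg_right b3 h0.le
    rw [intervalIntegral.integral_const_mul]
    refine b4.trans (le_of_eq ?_)
    ring
  have cc : Continuous (fun ρ : ℝ => ∫ θ in (0:ℝ)..Real.pi, ρ * v1 (a + ρ * Real.cos θ) (ρ * Real.sin θ) ^ 2) :=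
    ci (F := fun ρ θ => ρ * v1 (a + ρ * Real.cos θ) (ρ * Real.sin θ) ^ 2) (by fun_prop)
  have h5 : (∫ ρ in (0:ℝ)..r, Real.pi * |v1 a 0| * ρ) ≤ ∫ ρ in (0:ℝ)..r, 
      ((r / (2 * U)) * (∫ θ in (0:ℝ)..Real.pi, ρ * v1 (a + ρ * Real.cos θ) (ρ * Real.sin θ) ^ 2)
      + (Real.pi * (U / (2 * r)) + N) * ρ) := by
    refine intervalIntegral.integral_mono_on hr0.le
      (Continuous.intervalIntegrable (by fun_prop) _ _)
      (Continuous.intervalIntegrable (by fun_prop) _ _) key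
  rw [intervalIntegral.integral_add (Continuous.intervalIntegrable (by fun_prop) _ _)
    (Continuous.intervalIntegrable (by fun_prop) _ _)] at h5
  simp only [intervalIntegral.integral_const_mul (_ : ℝ)] at h5
  simp only [integral_id] at h5
  have h6 : r / (2 * U) * (∫ ρ in (0:ℝ)..r, ∫ θ in (0:ℝ)..Real.pi, ρ * v1 (a + ρ * Real.cos θ) (ρ * Real.sin θ) ^ 2)
      ≤ r / (2 * U) * U ^ 2 := mul_le_mul_of_nonneg_left (hP.trans hIU) (by positivity)
  have h7 : r / (2 * U) * U ^ 2 = (U / r) * (r ^ 2 / 2) := by field_simp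
  simp only [intervalIntegral.integral_const_mul (_ : ℝ)] at h6
  have h8 : Real.pi * |v1 a 0| * (r ^ 2 / 2) ≤ ((U / r) + (Real.pi * (U / (2 * r)) + N)) * (r ^ 2 / 2) := by
    have : (r ^ 2 - 0 ^ 2) / 2 = r ^ 2 / 2 := by ring
    rw [this] at h5
    rw [add_mul, ← h7]
    linarith
  have h9 := le_of_mul_le_mul_right h8 (by positivity)
  have h10 : U / (2 * r) = (U / r) / 2 := by field_simp
  rw [h10] at h9
  have h11 : 0 < U / r := by positivity
  have h12 : 0 < Real.sqrt r * m := by positivity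
  by_contra hcon
  push Not at hcon
  nlinarith

lemma intΩ_refl (hΓ : 0 < Γ) (g : SField) :
    intΩ Γ (fun x1 x2 => g x1 (1 - x2)) = intΩ Γ g := by
  rw [intΩ_eq_iter hΓ, intΩ_eq_iter hΓ]
  congr 1; funext x1
  rw [intervalIntegral.integral_comp_sub_left (fun y => g x1 y) 1]
  simp

lemma wall_bound_top {r a m U : ℝ} (hr0 : 0 < r) (hr1 : r ≤ 1) (hrΓ : r ≤ Γ / 2) (hm : 0 < m)
    (hU : 0 < U) {v1 v2 : SField} (h1 : ssmooth v1) (h2 : ssmooth v2)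
    (p1 : speriodic Γ v1) (p2 : speriodic Γ v2)
    (hdiv : ∀ x1, ∀ x2 ∈ Icc (0:ℝ) 1, q1 v1 x1 x2 + q2 v2 x1 x2 = 0)
    (hb : ∀ x1, v2 x1 1 = 0) (hIU : intΩ Γ (fun x1 x2 => v1 x1 x2 ^ 2) ≤ U ^ 2)
    (hI : intΩ Γ (fun x1 x2 => (q1 v2 x1 x2 - q2 v1 x1 x2) ^ 4) ≤ m ^ 4) :
    |v1 a 1| ≤ 2 * (U / r + Real.sqrt r * m) := by
  have hΓ : 0 < Γ := by linarith
  have hr : ContDiff ℝ (⊤ : ℕ∞) (fun q : ℝ × ℝ => ((q.1, 1 - q.2) : ℝ × ℝ)) := by fun_prop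
  have s1 : ssmooth (fun x1 x2 => v1 x1 (1 - x2)) := ContDiff.comp h1 hr
  have s2 : ssmooth (fun x1 x2 => - v2 x1 (1 - x2)) := (ContDiff.comp h2 hr).neg
  have hsub : ∀ x2 : ℝ, HasDerivAt (fun y : ℝ => 1 - y) (-1) x2 := fun x2 => by
    simpa using (hasDerivAt_id x2).const_sub 1
  have e12 : ∀ x1 x2, q2 (fun x1 x2 => v1 x1 (1 - x2)) x1 x2 = - q2 v1 x1 (1 - x2) := by
    intro x1 x2
    have h := (ss_hd2 h1 x1 (1 - x2)).comp x2 (hsub x2)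
    have h' : HasDerivAt (fun y => v1 x1 (1 - y)) (q2 v1 x1 (1 - x2) * -1) x2 := h
    rw [show q2 (fun x1 x2 => v1 x1 (1 - x2)) x1 x2 = deriv (fun y => v1 x1 (1 - y)) x2 from rfl,
      h'.deriv]; ring
  have e22 : ∀ x1 x2, q2 (fun x1 x2 => - v2 x1 (1 - x2)) x1 x2 = q2 v2 x1 (1 - x2) := by
    intro x1 x2
    have h := ((ss_hd2 h2 x1 (1 - x2)).comp x2 (hsub x2)).neg
    have h' : HasDerivAt (fun y => - v2 x1 (1 - y)) (-(q2 v2 x1 (1 - x2) * -1)) x2 := h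
    rw [show q2 (fun x1 x2 => - v2 x1 (1 - x2)) x1 x2 = deriv (fun y => - v2 x1 (1 - y)) x2 from rfl,
      h'.deriv]; ring
  have e11 : ∀ x1 x2, q1 (fun x1 x2 => v1 x1 (1 - x2)) x1 x2 = q1 v1 x1 (1 - x2) :=
    fun x1 x2 => rfl
  have e21 : ∀ x1 x2, q1 (fun x1 x2 => - v2 x1 (1 - x2)) x1 x2 = - q1 v2 x1 (1 - x2) := by
    intro x1 x2
    exact (ss_hd1 h2 x1 (1 - x2)).neg.deriv
  have := wall_bound (a := a) hr0 hr1 hrΓ hm hU s1 s2 (fun x1 x2 => p1 _ _)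
    (fun x1 x2 => by simp only [p2 x1 (1 - x2)]) ?_ ?_ ?_ ?_
  · simpa using this
  · intro x1 x2 hx
    rw [e11, e22]
    exact hdiv x1 (1 - x2) ⟨by linarith [hx.2], by linarith [hx.1]⟩
  · intro x1; simp [hb]
  · rw [intΩ_refl hΓ (fun x1 x2 => v1 x1 x2 ^ 2)]; exact hIU
  · simp only [e21, e12]
    have : (fun x1 x2 => (- q1 v2 x1 (1 - x2) - - q2 v1 x1 (1 - x2)) ^ 4) =
      (fun x1 x2 => (fun x1 x2 => (q1 v2 x1 x2 - q2 v1 x1 x2) ^ 4) x1 (1 - x2)) := by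
      funext x1 x2; ring
    rw [this]; exact (intΩ_refl hΓ (fun x1 x2 => (q1 v2 x1 x2 - q2 v1 x1 x2) ^ 4)).le.trans hI

/-! Sobolev–Poincaré -/

lemma int_CS {a b : ℝ} (hab : a ≤ b) {f : ℝ → ℝ} (hf : Continuous f) :
    (∫ x in a..b, f x) ^ 2 ≤ (b - a) * ∫ x in a..b, f x ^ 2 := by
  have h : ∀ s : ℝ, 0 ≤ (b - a) * (s * s) + (2 * ∫ x in a..b, f x) * s + ∫ x in a..b, f x ^ 2 := by
    intro s
    have h0 : 0 ≤ ∫ x in a..b, (f x + s) ^ 2 :=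
      intervalIntegral.integral_nonneg hab (fun _ _ => sq_nonneg _)
    have e : (fun x => (f x + s) ^ 2) = fun x => f x ^ 2 + ((2 * s) * f x + s * s) := by
      funext x; ring
    rw [e, intervalIntegral.integral_add (Continuous.intervalIntegrable (by fun_prop) _ _)
      (Continuous.intervalIntegrable (by fun_prop) _ _), intervalIntegral.integral_add
      (Continuous.intervalIntegrable (by fun_prop) _ _)
      (Continuous.intervalIntegrable (by fun_prop) _ _), intervalIntegral.integral_const_mul,
      intervalIntegral.integral_const, smul_eq_mul] at h0
    linarith
  have := discrim_le_zero h
  unfold discrim at this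
  nlinarith

lemma abs_sub_le_int {a b : ℝ} (_hab : a ≤ b) {f f' : ℝ → ℝ} (hd : ∀ x, HasDerivAt f (f' x) x)
    (hc : Continuous f') {x y : ℝ} (hx : x ∈ Icc a b) (hy : y ∈ Icc a b) :
    |f x - f y| ≤ ∫ s in a..b, |f' s| := by
  wlog h : y ≤ x generalizing x y
  · rw [abs_sub_comm]; exact this hy hx (le_of_not_ge h)
  rw [← intervalIntegral.integral_eq_sub_of_hasDerivAt (fun z _ => hd z) (hc.intervalIntegrable _ _)]
  refine (intervalIntegral.abs_integral_le_integral_abs h).trans ?_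
  exact intervalIntegral.integral_mono_interval hy.1 h hx.2
    (Eventually.of_forall fun s => abs_nonneg _) (hc.abs.intervalIntegrable _ _)

/-- mean value over Ω -/
def mean (Γ : ℝ) (g : SField) : ℝ := (1 / Γ) * intΩ Γ g

lemma mean_dev (hΓ : 0 < Γ) {g : SField} (hg : Continuous (fun q : ℝ × ℝ => g q.1 q.2)) (z K : ℝ)
    {B : SField} (hB : Continuous (fun q : ℝ × ℝ => B q.1 q.2))
    (h : ∀ y1 ∈ Ioo 0 Γ, ∀ y2 ∈ Ioo (0:ℝ) 1, |z - g y1 y2| ≤ B y1 y2) (hK : intΩ Γ B ≤ Γ * K) :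
    |z - mean Γ g| ≤ K := by
  have h1 : intΩ Γ (fun y1 y2 => z - g y1 y2) = Γ * z - intΩ Γ g := by
    rw [intΩ_sub _ _ (by fun_prop) hg, intΩ_const hΓ]
  have h2 : intΩ Γ (fun y1 y2 => z - g y1 y2) ≤ intΩ Γ B :=
    intΩ_mono (by fun_prop) hB (fun x1 h1 x2 h2 => (le_abs_self _).trans (h x1 h1 x2 h2))
  have h3 : intΩ Γ (fun y1 y2 => -(z - g y1 y2)) ≤ intΩ Γ B :=
    intΩ_mono (by fun_prop) hB (fun x1 h1 x2 h2 => (neg_le_abs _).trans (h x1 h1 x2 h2))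
  rw [intΩ_neg] at h3
  have h4 : Γ * (z - mean Γ g) = Γ * z - intΩ Γ g := by unfold mean; field_simp
  rw [abs_le]
  constructor
  · have : Γ * (-(z - mean Γ g)) ≤ Γ * K := by linarith
    linarith [le_of_mul_le_mul_left this hΓ]
  · exact le_of_mul_le_mul_left (by linarith) hΓ

lemma intΩ_prod (hΓ : 0 < Γ) (A B : ℝ → ℝ) :
    intΩ Γ (fun x1 x2 => A x2 * B x1) = (∫ x2 in (0:ℝ)..1, A x2) * ∫ x1 in (0:ℝ)..Γ, B x1 := by
  rw [intΩ_eq_iter hΓ]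
  simp only [intervalIntegral.integral_mul_const (_ : ℝ), intervalIntegral.integral_const_mul (_ : ℝ)]

/-- Sobolev constant -/
def cS (Γ : ℝ) : ℝ := 4 * (Γ + 1 / Γ) * (1 + Γ ^ 2)

/-- `W^{1,1} ⊂ L²` in two dimensions gives an `L⁴` bound and an `L²` bound. -/
lemma sobolev (hΓ : 0 < Γ) {g : SField} (hg : ssmooth g) :
    intΩ Γ (fun x1 x2 => (g x1 x2 - mean Γ g) ^ 4) ≤
      cS Γ * (intΩ Γ (fun x1 x2 => q1 g x1 x2 ^ 2 + q2 g x1 x2 ^ 2)) ^ 2 := by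
  have c := ss_cont hg
  have c1 := ss_cont (ss_q1 hg)
  have c2 := ss_cont (ss_q2 hg)
  set D1 := intΩ Γ (fun x1 x2 => q1 g x1 x2 ^ 2) with hD1
  set D2 := intΩ Γ (fun x1 x2 => q2 g x1 x2 ^ 2) with hD2
  set N1 := intΩ Γ (fun x1 x2 => |q1 g x1 x2|) with hN1
  set N2 := intΩ Γ (fun x1 x2 => |q2 g x1 x2|) with hN2
  have hD : intΩ Γ (fun x1 x2 => q1 g x1 x2 ^ 2 + q2 g x1 x2 ^ 2) = D1 + D2 :=
    intΩ_add _ _ (by fun_prop) (by fun_prop)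
  have n1 : 0 ≤ N1 := intΩ_nonneg (fun _ _ _ _ => abs_nonneg _)
  have n2 : 0 ≤ N2 := intΩ_nonneg (fun _ _ _ _ => abs_nonneg _)
  have d1 : 0 ≤ D1 := intΩ_nonneg (fun _ _ _ _ => sq_nonneg _)
  have d2 : 0 ≤ D2 := intΩ_nonneg (fun _ _ _ _ => sq_nonneg _)
  have N1s : N1 ^ 2 ≤ Γ * D1 := by
    have := intΩ_CS (Γ := Γ) (f := fun x1 x2 => |q1 g x1 x2|) (g := fun _ _ => 1) (by fun_prop) (by fun_prop)
    simp only [mul_one, sq_abs, one_pow, intΩ_const hΓ] at this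
    linarith
  have N2s : N2 ^ 2 ≤ Γ * D2 := by
    have := intΩ_CS (Γ := Γ) (f := fun x1 x2 => |q2 g x1 x2|) (g := fun _ _ => 1) (by fun_prop) (by fun_prop)
    simp only [mul_one, sq_abs, one_pow, intΩ_const hΓ] at this
    linarith
  set A : ℝ → ℝ := fun y => ∫ s in (0:ℝ)..Γ, |q1 g s y| with hA
  set B : ℝ → ℝ := fun x => ∫ s in (0:ℝ)..1, |q2 g x s| with hB
  have cA : Continuous A :=
    intervalIntegral.continuous_parametric_intervalIntegral_of_continuous' (by fun_prop) _ _
  have cB : Continuous B :=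
    intervalIntegral.continuous_parametric_intervalIntegral_of_continuous' (by fun_prop) _ _
  have iA : (∫ y in (0:ℝ)..1, A y) = N1 := by rw [hN1, intΩ_swap hΓ (by fun_prop)]
  have iB : (∫ x in (0:ℝ)..Γ, B x) = N2 := by rw [hN2, intΩ_eq_iter hΓ]
  have iA2 : (∫ y in (0:ℝ)..1, A y ^ 2) ≤ Γ * D1 := by
    rw [hD1, intΩ_swap hΓ (by fun_prop), ← intervalIntegral.integral_const_mul]
    refine intervalIntegral.integral_mono_on zero_le_one (Continuous.intervalIntegrable (by fun_prop) _ _)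
      (Continuous.intervalIntegrable (continuous_const.mul
        (intervalIntegral.continuous_parametric_intervalIntegral_of_continuous' (by fun_prop) _ _)) _ _) ?_
    intro y _
    have := int_CS hΓ.le (f := fun s => |q1 g s y|) (by fun_prop)
    simpa only [sq_abs, sub_zero] using this
  have iB2 : (∫ x in (0:ℝ)..Γ, B x ^ 2) ≤ D2 := by
    rw [hD2, intΩ_eq_iter hΓ]
    refine intervalIntegral.integral_mono_on hΓ.le (Continuous.intervalIntegrable (by fun_prop) _ _)
      (Continuous.intervalIntegrable
        (intervalIntegral.continuous_parametric_intervalIntegral_of_continuous' (by fun_prop) _ _) _ _) ?_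
    intro x _
    have := int_CS zero_le_one (f := fun s => |q2 g x s|) (by fun_prop)
    simpa only [sq_abs, sub_zero, one_mul] using this
  have hp1 : ∀ x1 ∈ Ioo 0 Γ, ∀ x2 ∈ Ioo (0:ℝ) 1, |g x1 x2 - mean Γ g| ≤ A x2 + N2 / Γ := by
    intro x1 h1 x2 h2
    refine mean_dev hΓ c (g x1 x2) _ (B := fun y1 y2 => A x2 + B y1) (by fun_prop) ?_ ?_
    · intro y1 k1 y2 k2
      have e1 := abs_sub_le_int hΓ.le (f := fun s => g s x2) (fun s => ss_hd1 hg s x2) (by fun_prop)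
        (Ioo_subset_Icc_self h1) (Ioo_subset_Icc_self k1)
      have e2 := abs_sub_le_int zero_le_one (f := fun s => g y1 s) (fun s => ss_hd2 hg y1 s) (by fun_prop)
        (Ioo_subset_Icc_self h2) (Ioo_subset_Icc_self k2)
      calc |g x1 x2 - g y1 y2| = |(g x1 x2 - g y1 x2) + (g y1 x2 - g y1 y2)| := by congr 1; ring
        _ ≤ _ := (abs_add_le _ _).trans (add_le_add e1 e2)
    · rw [intΩ_add _ _ (by fun_prop) (by fun_prop), intΩ_const hΓ]
      have := intΩ_prod hΓ (fun _ => 1) B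
      simp only [one_mul, intervalIntegral.integral_const, smul_eq_mul, sub_zero, mul_one, iB] at this
      rw [this]; field_simp; rfl
  have hp2 : ∀ x1 ∈ Ioo 0 Γ, ∀ x2 ∈ Ioo (0:ℝ) 1, |g x1 x2 - mean Γ g| ≤ B x1 + N1 := by
    intro x1 h1 x2 h2
    refine mean_dev hΓ c (g x1 x2) _ (B := fun y1 y2 => B x1 + A y2) (by fun_prop) ?_ ?_
    · intro y1 k1 y2 k2
      have e1 := abs_sub_le_int hΓ.le (f := fun s => g s y2) (fun s => ss_hd1 hg s y2) (by fun_prop)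
        (Ioo_subset_Icc_self h1) (Ioo_subset_Icc_self k1)
      have e2 := abs_sub_le_int zero_le_one (f := fun s => g x1 s) (fun s => ss_hd2 hg x1 s) (by fun_prop)
        (Ioo_subset_Icc_self h2) (Ioo_subset_Icc_self k2)
      calc |g x1 x2 - g y1 y2| = |(g x1 x2 - g x1 y2) + (g x1 y2 - g y1 y2)| := by congr 1; ring
        _ ≤ _ := (abs_add_le _ _).trans (add_le_add e2 e1)
    · rw [intΩ_add _ _ (by fun_prop) (by fun_prop), intΩ_const hΓ]
      have := intΩ_prod hΓ A (fun _ => 1)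
      simp only [mul_one, intervalIntegral.integral_const, smul_eq_mul, sub_zero, mul_one, iA] at this
      rw [this]; linarith
  have h4 : intΩ Γ (fun x1 x2 => (g x1 x2 - mean Γ g) ^ 4) ≤
      intΩ Γ (fun x1 x2 => (A x2 + N2 / Γ) ^ 2 * (B x1 + N1) ^ 2) := by
    refine intΩ_mono (by fun_prop) (by fun_prop) ?_
    intro x1 h1 x2 h2
    have a1 := hp1 x1 h1 x2 h2
    have a2 := hp2 x1 h1 x2 h2
    have b1 := pow_le_pow_left₀ (abs_nonneg _) a1 2
    have b2 := pow_le_pow_left₀ (abs_nonneg _) a2 2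
    rw [sq_abs] at b1 b2
    calc (g x1 x2 - mean Γ g) ^ 4 = (g x1 x2 - mean Γ g) ^ 2 * (g x1 x2 - mean Γ g) ^ 2 := by ring
      _ ≤ _ := mul_le_mul b1 b2 (sq_nonneg _) (sq_nonneg _)
  rw [intΩ_prod hΓ (fun x2 => (A x2 + N2 / Γ) ^ 2) (fun x1 => (B x1 + N1) ^ 2)] at h4
  have hA2 : (∫ x2 in (0:ℝ)..1, (A x2 + N2 / Γ) ^ 2) ≤ 2 * (Γ + 1 / Γ) * (D1 + D2) := by
    have : (∫ x2 in (0:ℝ)..1, (A x2 + N2 / Γ) ^ 2) ≤ ∫ x2 in (0:ℝ)..1, (2 * A x2 ^ 2 + 2 * (N2 / Γ) ^ 2) := by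
      refine intervalIntegral.integral_mono_on zero_le_one (Continuous.intervalIntegrable (by fun_prop) _ _)
        (Continuous.intervalIntegrable (by fun_prop) _ _) (fun x _ => ?_)
      nlinarith [sq_nonneg (A x - N2 / Γ)]
    rw [intervalIntegral.integral_add (Continuous.intervalIntegrable (by fun_prop) _ _)
      (by simp), intervalIntegral.integral_const_mul] at this
    simp only [intervalIntegral.integral_const, smul_eq_mul, sub_zero, one_mul] at this
    have e : (N2 / Γ) ^ 2 ≤ (1 / Γ) * D2 := by
      rw [div_pow, div_le_iff₀ (by positivity)]
      have : 1 / Γ * D2 * Γ ^ 2 = Γ * D2 := by field_simp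
      linarith
    have e2 : 0 ≤ (1 / Γ) * D1 := by positivity
    nlinarith
  have hB2 : (∫ x1 in (0:ℝ)..Γ, (B x1 + N1) ^ 2) ≤ 2 * (1 + Γ ^ 2) * (D1 + D2) := by
    have : (∫ x1 in (0:ℝ)..Γ, (B x1 + N1) ^ 2) ≤ ∫ x1 in (0:ℝ)..Γ, (2 * B x1 ^ 2 + 2 * N1 ^ 2) := by
      refine intervalIntegral.integral_mono_on hΓ.le (Continuous.intervalIntegrable (by fun_prop) _ _)
        (Continuous.intervalIntegrable (by fun_prop) _ _) (fun x _ => ?_)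
      nlinarith [sq_nonneg (B x - N1)]
    rw [intervalIntegral.integral_add (Continuous.intervalIntegrable (by fun_prop) _ _)
      (by simp), intervalIntegral.integral_const_mul] at this
    simp only [intervalIntegral.integral_const, smul_eq_mul, sub_zero] at this
    have : (∫ x1 in (0:ℝ)..Γ, (B x1 + N1) ^ 2) ≤ 2 * D2 + Γ * (2 * (Γ * D1)) := by nlinarith
    nlinarith [mul_nonneg (sq_nonneg Γ) d2]
  rw [hD]
  refine h4.trans ?_
  have hD12 : 0 ≤ D1 + D2 := by linarith
  calc _ ≤ (2 * (Γ + 1 / Γ) * (D1 + D2)) * (2 * (1 + Γ ^ 2) * (D1 + D2)) :=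
        mul_le_mul hA2 hB2 (intervalIntegral.integral_nonneg hΓ.le fun _ _ => sq_nonneg _) (by positivity)
    _ = _ := by unfold cS; ring

lemma cS_pos (hΓ : 0 < Γ) : 0 < cS Γ := by unfold cS; positivity

lemma sobolev2 (hΓ : 0 < Γ) {g : SField} (hg : ssmooth g) :
    intΩ Γ (fun x1 x2 => (g x1 x2 - mean Γ g) ^ 2) ≤
      Real.sqrt (Γ * cS Γ) * intΩ Γ (fun x1 x2 => q1 g x1 x2 ^ 2 + q2 g x1 x2 ^ 2) := by
  have c := ss_cont hg
  have h1 := intΩ_CS (Γ := Γ) (f := fun x1 x2 => (g x1 x2 - mean Γ g) ^ 2) (g := fun _ _ => 1)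
    (by fun_prop) (by fun_prop)
  simp only [mul_one, one_pow, intΩ_const hΓ, ← pow_mul] at h1
  have h2 := sobolev hΓ hg
  have h3 : 0 ≤ intΩ Γ (fun x1 x2 => q1 g x1 x2 ^ 2 + q2 g x1 x2 ^ 2) :=
    intΩ_nonneg (fun _ _ _ _ => by positivity)
  have hc := cS_pos hΓ
  refine abs_le_of_sq_le_sq' ?_ (by positivity) |>.2
  rw [mul_pow, Real.sq_sqrt (by positivity)]
  norm_num at h1
  nlinarith

/-! Static balances at a fixed time -/

lemma div_thm (hΓ : 0 < Γ) {F G F' G' H : SField}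
    (hF : ∀ x1, ∀ x2 ∈ Icc (0:ℝ) 1, HasDerivAt (fun y => F y x2) (F' x1 x2) x1)
    (hp : speriodic Γ F)
    (hG : ∀ x1, ∀ x2 ∈ Icc (0:ℝ) 1, HasDerivAt (fun y => G x1 y) (G' x1 x2) x2)
    (cF : Continuous (fun q : ℝ × ℝ => F' q.1 q.2)) (cG : Continuous (fun q : ℝ × ℝ => G' q.1 q.2))
    (hH : ∀ x1, ∀ x2 ∈ Icc (0:ℝ) 1, H x1 x2 = F' x1 x2 + G' x1 x2) :
    intΩ Γ H = ∫ x1 in (0:ℝ)..Γ, (G x1 1 - G x1 0) := by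
  rw [intΩ_congr hH, intΩ_add _ _ cF cG, intΩ_d1 hΓ hF hp cF, intΩ_d2 hΓ hG cG, zero_add]

/-- vorticity of a static field -/
def om (u v : SField) : SField := fun x1 x2 => q1 v x1 x2 - q2 u x1 x2

/-- the static information available at a fixed time -/
structure Stat (Γ Ra Pr b c : ℝ) (u v T P ut vt : SField) : Prop where
  su : ssmooth u
  sv : ssmooth v
  sT : ssmooth T
  sP : ssmooth P
  sut : ssmooth ut
  svt : ssmooth vt
  pu : speriodic Γ u
  pv : speriodic Γ v
  pT : speriodic Γ T
  pP : speriodic Γ P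
  put : speriodic Γ ut
  pvt : speriodic Γ vt
  m1 : ∀ x1, ∀ x2 ∈ Icc (0:ℝ) 1, Pr⁻¹ * (ut x1 x2 + c * q1 u x1 x2 - v x1 x2 * om u v x1 x2)
    + q2 (om u v) x1 x2 + q1 P x1 x2 = 0
  m2 : ∀ x1, ∀ x2 ∈ Icc (0:ℝ) 1, Pr⁻¹ * (vt x1 x2 + c * q1 v x1 x2 + (u x1 x2 - c) * om u v x1 x2)
    - q1 (om u v) x1 x2 + q2 P x1 x2 = Ra * T x1 x2
  hdiv : ∀ x1, ∀ x2 ∈ Icc (0:ℝ) 1, q1 u x1 x2 + q2 v x1 x2 = 0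
  hdivt : ∀ x1, ∀ x2 ∈ Icc (0:ℝ) 1, q1 ut x1 x2 + q2 vt x1 x2 = 0
  v0 : ∀ x1, v x1 0 = 0
  v1 : ∀ x1, v x1 1 = 0
  vt0 : ∀ x1, vt x1 0 = 0
  vt1 : ∀ x1, vt x1 1 = 0
  sl0 : ∀ x1, q2 u x1 0 = b * u x1 0
  sl1 : ∀ x1, q2 u x1 1 = -b * u x1 1
  T0 : ∀ x1, T x1 0 = 1
  T1 : ∀ x1, T x1 1 = 0
  Tb : ∀ x1 ∈ Ioo 0 Γ, ∀ x2 ∈ Ioo (0:ℝ) 1, T x1 x2 ^ 2 ≤ 1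

lemma ss_om {u v : SField} (hu : ssmooth u) (hv : ssmooth v) : ssmooth (om u v) :=
  ContDiff.sub (ss_q1 hv) (ss_q2 hu)
lemma per_om {u v : SField} (hu : speriodic Γ u) (hv : speriodic Γ v) : speriodic Γ (om u v) := by
  intro x1 x2; unfold om; rw [per_q1 hv, per_q2 hu]

namespace Stat
variable {b c : ℝ} {u v T P ut vt : SField}

lemma q1v0 (h : Stat Γ Ra Pr b c u v T P ut vt) (x1 : ℝ) : q1 v x1 0 = 0 := by
  have : (fun y => v y 0) = fun _ => 0 := funext h.v0
  simp [q1, this]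
lemma q1v1 (h : Stat Γ Ra Pr b c u v T P ut vt) (x1 : ℝ) : q1 v x1 1 = 0 := by
  have : (fun y => v y 1) = fun _ => 0 := funext h.v1
  simp [q1, this]
lemma om0 (h : Stat Γ Ra Pr b c u v T P ut vt) (x1 : ℝ) : om u v x1 0 = -b * u x1 0 := by
  unfold om; rw [h.q1v0, h.sl0]; ring
lemma om1 (h : Stat Γ Ra Pr b c u v T P ut vt) (x1 : ℝ) : om u v x1 1 = b * u x1 1 := by
  unfold om; rw [h.q1v1, h.sl1]; ring

/-- `∂₁(∂₁u+∂₂v)=0` -/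
lemma ddiv1 (h : Stat Γ Ra Pr b c u v T P ut vt) (x1 : ℝ) {x2 : ℝ} (hx : x2 ∈ Icc (0:ℝ) 1) :
    q1 (q1 u) x1 x2 + q2 (q1 v) x1 x2 = 0 := by
  rw [← ss_comm h.sv]
  have := (ss_hd1 (ss_q1 h.su) x1 x2).add (ss_hd1 (ss_q2 h.sv) x1 x2)
  have e : ((fun y => q1 u y x2) + fun y => q2 v y x2) = fun _ => 0 := by
    funext y; exact h.hdiv y x2 hx
  rw [e] at this
  exact (this.unique (hasDerivAt_const x1 0))
lemma ddiv2 (h : Stat Γ Ra Pr b c u v T P ut vt) (x1 : ℝ) {x2 : ℝ} (hx : x2 ∈ Icc (0:ℝ) 1) :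
    q2 (q1 u) x1 x2 + q2 (q2 v) x1 x2 = 0 := by
  have := (ss_hd2 (ss_q1 h.su) x1 x2).add (ss_hd2 (ss_q2 h.sv) x1 x2)
  exact deriv_zero_Icc this (fun y hy => h.hdiv x1 y hy) hx

/-- `∫|∇u|² = ∫ω²` -/
lemma grad_eq (hΓ : 0 < Γ) (h : Stat Γ Ra Pr b c u v T P ut vt) :
    intΩ Γ (fun x1 x2 => q1 u x1 x2 ^ 2 + q2 u x1 x2 ^ 2 + q1 v x1 x2 ^ 2 + q2 v x1 x2 ^ 2)
      = intΩ Γ (fun x1 x2 => om u v x1 x2 ^ 2) := by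
  have c0 := ss_cont h.sv
  have c1 := ss_cont (ss_q1 h.su)
  have c2 := ss_cont (ss_q2 h.su)
  have c3 := ss_cont (ss_q1 h.sv)
  have c4 := ss_cont (ss_q2 h.sv)
  have c5 := ss_cont (ss_q1 (ss_q2 h.su))
  have c6 := ss_cont (ss_q2 (ss_q1 h.su))
  have c7 := ss_cont (ss_om h.su h.sv)
  have := div_thm hΓ (F := fun x1 x2 => v x1 x2 * q2 u x1 x2)
    (G := fun x1 x2 => - (v x1 x2 * q1 u x1 x2))
    (F' := fun x1 x2 => q1 v x1 x2 * q2 u x1 x2 + v x1 x2 * q1 (q2 u) x1 x2)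
    (G' := fun x1 x2 => - (q2 v x1 x2 * q1 u x1 x2 + v x1 x2 * q2 (q1 u) x1 x2))
    (H := fun x1 x2 => (1/2) * ((q1 u x1 x2 ^ 2 + q2 u x1 x2 ^ 2 + q1 v x1 x2 ^ 2 + q2 v x1 x2 ^ 2)
       - om u v x1 x2 ^ 2))
    (fun x1 x2 _ => (ss_hd1 h.sv x1 x2).mul (ss_hd1 (ss_q2 h.su) x1 x2))
    (fun x1 x2 => by simp only [h.pv x1 x2, per_q2 h.pu x1 x2])
    (fun x1 x2 _ => ((ss_hd2 h.sv x1 x2).mul (ss_hd2 (ss_q1 h.su) x1 x2)).neg)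
    (by fun_prop) (by fun_prop) ?_
  · simp only [h.v0, h.v1] at this
    rw [intΩ_cmul, intΩ_sub _ _ (by fun_prop) (by fun_prop)] at this
    simp at this
    linarith
  · intro x1 x2 hx
    have e := h.hdiv x1 x2 hx
    rw [ss_comm h.su]
    unfold om
    linear_combination (1/2) * (q1 u x1 x2 + q2 v x1 x2) * e

/-- energy balance -/
lemma energy (hΓ : 0 < Γ) (h : Stat Γ Ra Pr b c u v T P ut vt) :
    Pr⁻¹ * intΩ Γ (fun x1 x2 => u x1 x2 * ut x1 x2 + v x1 x2 * vt x1 x2)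
      + intΩ Γ (fun x1 x2 => om u v x1 x2 ^ 2)
      + b * (∫ x1 in (0:ℝ)..Γ, (u x1 1 ^ 2 + u x1 0 ^ 2))
      = Ra * intΩ Γ (fun x1 x2 => v x1 x2 * T x1 x2) := by
  have sω := ss_om h.su h.sv
  have c0 := ss_cont h.sv
  have c0' := ss_cont h.su
  have c1 := ss_cont (ss_q1 h.su)
  have c2 := ss_cont (ss_q2 h.su)
  have c3 := ss_cont (ss_q1 h.sv)
  have c4 := ss_cont (ss_q2 h.sv)
  have c5 := ss_cont (ss_q1 sω)
  have c6 := ss_cont (ss_q2 sω)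
  have c7 := ss_cont sω
  have c8 := ss_cont h.sP
  have c9 := ss_cont (ss_q1 h.sP)
  have c10 := ss_cont (ss_q2 h.sP)
  have c11 := ss_cont h.sut
  have c12 := ss_cont h.svt
  have c13 := ss_cont h.sT
  have := div_thm hΓ
    (F := fun x1 x2 => Pr⁻¹ * c * (u x1 x2 * u x1 x2) - v x1 x2 * om u v x1 x2 + u x1 x2 * P x1 x2)
    (G := fun x1 x2 => Pr⁻¹ * c * (u x1 x2 * v x1 x2) + u x1 x2 * om u v x1 x2 + v x1 x2 * P x1 x2)
    (F' := fun x1 x2 => Pr⁻¹ * c * (q1 u x1 x2 * u x1 x2 + u x1 x2 * q1 u x1 x2)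
      - (q1 v x1 x2 * om u v x1 x2 + v x1 x2 * q1 (om u v) x1 x2)
      + (q1 u x1 x2 * P x1 x2 + u x1 x2 * q1 P x1 x2))
    (G' := fun x1 x2 => Pr⁻¹ * c * (q2 u x1 x2 * v x1 x2 + u x1 x2 * q2 v x1 x2)
      + (q2 u x1 x2 * om u v x1 x2 + u x1 x2 * q2 (om u v) x1 x2)
      + (q2 v x1 x2 * P x1 x2 + v x1 x2 * q2 P x1 x2))
    (H := fun x1 x2 => Ra * (v x1 x2 * T x1 x2) -
      (Pr⁻¹ * (u x1 x2 * ut x1 x2 + v x1 x2 * vt x1 x2) + om u v x1 x2 ^ 2))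
    (fun x1 x2 _ => ((((ss_hd1 h.su x1 x2).mul (ss_hd1 h.su x1 x2)).const_mul (Pr⁻¹ * c)).sub
      ((ss_hd1 h.sv x1 x2).mul (ss_hd1 sω x1 x2))).add ((ss_hd1 h.su x1 x2).mul (ss_hd1 h.sP x1 x2)))
    (fun x1 x2 => by simp only [h.pu x1 x2, h.pv x1 x2, h.pP x1 x2, per_om h.pu h.pv x1 x2])
    (fun x1 x2 _ => ((((ss_hd2 h.su x1 x2).mul (ss_hd2 h.sv x1 x2)).const_mul (Pr⁻¹ * c)).add
      ((ss_hd2 h.su x1 x2).mul (ss_hd2 sω x1 x2))).add ((ss_hd2 h.sv x1 x2).mul (ss_hd2 h.sP x1 x2)))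
    (by fun_prop) (by fun_prop) ?_
  · simp only [h.v0, h.v1, h.om0, h.om1] at this
    rw [intΩ_sub _ _ (by fun_prop) (by fun_prop), intΩ_cmul, intΩ_add _ _ (by fun_prop) (by fun_prop),
      intΩ_cmul] at this
    have e : (∫ x1 in (0:ℝ)..Γ, ((Pr⁻¹ * c * (u x1 1 * 0) + u x1 1 * (b * u x1 1) + 0 * P x1 1)
        - (Pr⁻¹ * c * (u x1 0 * 0) + u x1 0 * (-b * u x1 0) + 0 * P x1 0)))
        = b * (∫ x1 in (0:ℝ)..Γ, (u x1 1 ^ 2 + u x1 0 ^ 2)) := by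
      rw [← intervalIntegral.integral_const_mul]
      congr 1; funext x; ring
    rw [e] at this
    linarith
  · intro x1 x2 hx
    have e := h.hdiv x1 x2 hx
    have e1 := h.m1 x1 x2 hx
    have e2 := h.m2 x1 x2 hx
    have eo : om u v x1 x2 = q1 v x1 x2 - q2 u x1 x2 := rfl
    linear_combination (-(P x1 x2) - Pr⁻¹ * c * u x1 x2) * e - u x1 x2 * e1 - v x1 x2 * e2
      + (- om u v x1 x2 - Pr⁻¹ * c * v x1 x2) * eo

/-- boundary pressure term -/
def Bd (Γ : ℝ) (u P : SField) : ℝ := ∫ x1 in (0:ℝ)..Γ, (u x1 1 * q1 P x1 1 + u x1 0 * q1 P x1 0)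

/-- enstrophy balance -/
lemma enstrophy (hΓ : 0 < Γ) (h : Stat Γ Ra Pr b c u v T P ut vt) :
    intΩ Γ (fun x1 x2 => q1 (om u v) x1 x2 ^ 2 + q2 (om u v) x1 x2 ^ 2)
      + Pr⁻¹ * (intΩ Γ (fun x1 x2 => om u v x1 x2 * om ut vt x1 x2)
        + b * ∫ x1 in (0:ℝ)..Γ, (u x1 1 * ut x1 1 + u x1 0 * ut x1 0))
      + b * Bd Γ u P = Ra * intΩ Γ (fun x1 x2 => om u v x1 x2 * q1 T x1 x2) := by
  have sω := ss_om h.su h.sv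
  have c0 := ss_cont h.sv
  have c0' := ss_cont h.su
  have c1 := ss_cont (ss_q1 h.su)
  have c2 := ss_cont (ss_q2 h.su)
  have c3 := ss_cont (ss_q1 h.sv)
  have c4 := ss_cont (ss_q2 h.sv)
  have c5 := ss_cont (ss_q1 sω)
  have c6 := ss_cont (ss_q2 sω)
  have c7 := ss_cont sω
  have c9 := ss_cont (ss_q1 h.sP)
  have c10 := ss_cont (ss_q2 h.sP)
  have c11 := ss_cont h.sut
  have c12 := ss_cont h.svt
  have c13 := ss_cont h.sT
  have c14 := ss_cont (ss_q1 h.svt)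
  have c15 := ss_cont (ss_q2 h.sut)
  have c16 := ss_cont (ss_q1 h.sT)
  have c17 := ss_cont (ss_om h.sut h.svt)
  have c18 := ss_cont (ss_q1 (ss_q2 h.sP))
  have c19 := ss_cont (ss_q2 (ss_q1 h.sP))
  have c20 := ss_cont (ss_q1 (ss_q1 h.sv))
  have c21 := ss_cont (ss_q2 (ss_q1 h.su))
  have := div_thm hΓ
    (F := fun x1 x2 => Pr⁻¹ * (om u v x1 x2 * vt x1 x2 + c * (om u v x1 x2 * q1 v x1 x2)
      + (u x1 x2 - c - c) * (om u v x1 x2 * om u v x1 x2 / 2)) + om u v x1 x2 * q2 P x1 x2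
      - Ra * (T x1 x2 * om u v x1 x2))
    (G := fun x1 x2 => - (Pr⁻¹ * (om u v x1 x2 * ut x1 x2 + c * (om u v x1 x2 * q1 u x1 x2)
      - v x1 x2 * (om u v x1 x2 * om u v x1 x2 / 2)) + om u v x1 x2 * q1 P x1 x2))
    (F' := fun x1 x2 => Pr⁻¹ * ((q1 (om u v) x1 x2 * vt x1 x2 + om u v x1 x2 * q1 vt x1 x2)
      + c * (q1 (om u v) x1 x2 * q1 v x1 x2 + om u v x1 x2 * q1 (q1 v) x1 x2)
      + (q1 u x1 x2 * (om u v x1 x2 * om u v x1 x2 / 2) + (u x1 x2 - c - c) *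
        ((q1 (om u v) x1 x2 * om u v x1 x2 + om u v x1 x2 * q1 (om u v) x1 x2) / 2)))
      + (q1 (om u v) x1 x2 * q2 P x1 x2 + om u v x1 x2 * q1 (q2 P) x1 x2)
      - Ra * (q1 T x1 x2 * om u v x1 x2 + T x1 x2 * q1 (om u v) x1 x2))
    (G' := fun x1 x2 => - (Pr⁻¹ * ((q2 (om u v) x1 x2 * ut x1 x2 + om u v x1 x2 * q2 ut x1 x2)
      + c * (q2 (om u v) x1 x2 * q1 u x1 x2 + om u v x1 x2 * q2 (q1 u) x1 x2)
      - (q2 v x1 x2 * (om u v x1 x2 * om u v x1 x2 / 2) + v x1 x2 *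
        ((q2 (om u v) x1 x2 * om u v x1 x2 + om u v x1 x2 * q2 (om u v) x1 x2) / 2)))
      + (q2 (om u v) x1 x2 * q1 P x1 x2 + om u v x1 x2 * q2 (q1 P) x1 x2)))
    (H := fun x1 x2 => ((q1 (om u v) x1 x2 ^ 2 + q2 (om u v) x1 x2 ^ 2)
      - Ra * (om u v x1 x2 * q1 T x1 x2)) + Pr⁻¹ * (om u v x1 x2 * om ut vt x1 x2))
    (fun x1 x2 _ => ((((((ss_hd1 sω x1 x2).mul (ss_hd1 h.svt x1 x2)).add
      (((ss_hd1 sω x1 x2).mul (ss_hd1 (ss_q1 h.sv) x1 x2)).const_mul c)).add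
      ((((ss_hd1 h.su x1 x2).sub_const c).sub_const c).mul
        (((ss_hd1 sω x1 x2).mul (ss_hd1 sω x1 x2)).div_const 2))).const_mul Pr⁻¹).add
      ((ss_hd1 sω x1 x2).mul (ss_hd1 (ss_q2 h.sP) x1 x2))).sub
      (((ss_hd1 h.sT x1 x2).mul (ss_hd1 sω x1 x2)).const_mul Ra))
    (fun x1 x2 => by simp only [h.pu x1 x2, h.pv x1 x2, h.pT x1 x2, per_om h.pu h.pv x1 x2,
      h.pvt x1 x2, per_q1 h.pv x1 x2, per_q2 h.pP x1 x2])
    (fun x1 x2 _ => ((((((ss_hd2 sω x1 x2).mul (ss_hd2 h.sut x1 x2)).add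
      (((ss_hd2 sω x1 x2).mul (ss_hd2 (ss_q1 h.su) x1 x2)).const_mul c)).sub
      ((ss_hd2 h.sv x1 x2).mul
        (((ss_hd2 sω x1 x2).mul (ss_hd2 sω x1 x2)).div_const 2))).const_mul Pr⁻¹).add
      ((ss_hd2 sω x1 x2).mul (ss_hd2 (ss_q1 h.sP) x1 x2))).neg)
    (by fun_prop) (by fun_prop) ?_
  · simp only [h.v0, h.v1, h.om0, h.om1] at this
    rw [intΩ_add _ _ (by fun_prop) (by fun_prop), intΩ_cmul, intΩ_sub _ _ (by fun_prop) (by fun_prop),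
      intΩ_cmul] at this
    have hz : ∀ y, (∫ x1 in (0:ℝ)..Γ, (2 * u x1 y * q1 u x1 y)) = 0 := by
      intro y
      have hh := intervalIntegral.integral_eq_sub_of_hasDerivAt (a := 0) (b := Γ)
        (f := fun x => u x y ^ 2) (f' := fun x1 => 2 * u x1 y * q1 u x1 y)
        (fun x _ => ((ss_hd1 h.su x y).fun_pow 2).congr_deriv (by simp))
        (Continuous.intervalIntegrable (by fun_prop) _ _)
      rw [hh]
      have := h.pu 0 y
      rw [zero_add] at this
      simp [this]
    have e : (∫ x1 in (0:ℝ)..Γ,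
        (- (Pr⁻¹ * (b * u x1 1 * ut x1 1 + c * (b * u x1 1 * q1 u x1 1)
      - 0 * (b * u x1 1 * (b * u x1 1) / 2)) + b * u x1 1 * q1 P x1 1)
        - - (Pr⁻¹ * (-b * u x1 0 * ut x1 0 + c * (-b * u x1 0 * q1 u x1 0)
      - 0 * (-b * u x1 0 * (-b * u x1 0) / 2)) + -b * u x1 0 * q1 P x1 0)))
        = -(Pr⁻¹ * b) * (∫ x1 in (0:ℝ)..Γ, (u x1 1 * ut x1 1 + u x1 0 * ut x1 0))
         - b * Bd Γ u P - (Pr⁻¹ * c * b / 2) * ((∫ x1 in (0:ℝ)..Γ, (2 * u x1 1 * q1 u x1 1)) + 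
           ∫ x1 in (0:ℝ)..Γ, (2 * u x1 0 * q1 u x1 0)) := by
      unfold Bd
      rw [← intervalIntegral.integral_add (Continuous.intervalIntegrable (by fun_prop) _ _)
        (Continuous.intervalIntegrable (by fun_prop) _ _), ← intervalIntegral.integral_const_mul,
        ← intervalIntegral.integral_const_mul, ← intervalIntegral.integral_const_mul,
        ← intervalIntegral.integral_sub (Continuous.intervalIntegrable (by fun_prop) _ _)
        (Continuous.intervalIntegrable (by fun_prop) _ _),
        ← intervalIntegral.integral_sub (Continuous.intervalIntegrable (by fun_prop) _ _)
        (Continuous.intervalIntegrable (by fun_prop) _ _)]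
      congr 1; funext x; ring
    rw [e, hz, hz] at this
    linarith
  · intro x1 x2 hx
    have e := h.hdiv x1 x2 hx
    have e1 := h.m1 x1 x2 hx
    have e2 := h.m2 x1 x2 hx
    have eo : om ut vt x1 x2 = q1 vt x1 x2 - q2 ut x1 x2 := rfl
    have eP := ss_comm h.sP x1 x2
    have eu := ss_comm h.su x1 x2
    have eo1 : q1 (om u v) x1 x2 = q1 (q1 v) x1 x2 - q1 (q2 u) x1 x2 :=
      ((ss_hd1 (ss_q1 h.sv) x1 x2).sub (ss_hd1 (ss_q2 h.su) x1 x2)).deriv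
    linear_combination (-(Pr⁻¹ * om u v x1 x2 ^ 2 / 2)) * e + q2 (om u v) x1 x2 * e1
      - q1 (om u v) x1 x2 * e2 + Pr⁻¹ * om u v x1 x2 * eo - om u v x1 x2 * eP
      + Pr⁻¹ * c * om u v x1 x2 * (eo1 - eu)
end Stat

namespace Stat
variable {b c : ℝ} {u v T P ut vt : SField}

/-- pressure identity -/
lemma pressure (hΓ : 0 < Γ) (h : Stat Γ Ra Pr b c u v T P ut vt) :
    intΩ Γ (fun x1 x2 => q1 P x1 x2 ^ 2 + q2 P x1 x2 ^ 2)
      = Ra * intΩ Γ (fun x1 x2 => T x1 x2 * q2 P x1 x2)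
        + Pr⁻¹ * intΩ Γ (fun x1 x2 => (om u v x1 x2 * v x1 x2) * q1 P x1 x2
            + (- (om u v x1 x2 * (u x1 x2 - c))) * q2 P x1 x2)
        - b * Bd Γ u P := by
  have sω := ss_om h.su h.sv
  have c0 := ss_cont h.sv
  have c0' := ss_cont h.su
  have c1 := ss_cont (ss_q1 h.su)
  have c2 := ss_cont (ss_q2 h.su)
  have c3 := ss_cont (ss_q1 h.sv)
  have c5 := ss_cont (ss_q1 sω)
  have c6 := ss_cont (ss_q2 sω)
  have c7 := ss_cont sω
  have c8 := ss_cont h.sP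
  have c9 := ss_cont (ss_q1 h.sP)
  have c10 := ss_cont (ss_q2 h.sP)
  have c11 := ss_cont h.sut
  have c12 := ss_cont h.svt
  have c13 := ss_cont h.sT
  have c14 := ss_cont (ss_q1 h.sut)
  have c15 := ss_cont (ss_q2 h.svt)
  have c18 := ss_cont (ss_q1 (ss_q2 h.sP))
  have c19 := ss_cont (ss_q2 (ss_q1 h.sP))
  have c20 := ss_cont (ss_q2 (ss_q1 h.sv))
  have c21 := ss_cont (ss_q1 (ss_q1 h.su))
  have := div_thm hΓ
    (F := fun x1 x2 => -Pr⁻¹ * (P x1 x2 * ut x1 x2) - c * Pr⁻¹ * (P x1 x2 * q1 u x1 x2)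
       + om u v x1 x2 * q2 P x1 x2)
    (G := fun x1 x2 => -Pr⁻¹ * (P x1 x2 * vt x1 x2) - c * Pr⁻¹ * (P x1 x2 * q1 v x1 x2)
       - om u v x1 x2 * q1 P x1 x2)
    (F' := fun x1 x2 => -Pr⁻¹ * (q1 P x1 x2 * ut x1 x2 + P x1 x2 * q1 ut x1 x2)
       - c * Pr⁻¹ * (q1 P x1 x2 * q1 u x1 x2 + P x1 x2 * q1 (q1 u) x1 x2)
       + (q1 (om u v) x1 x2 * q2 P x1 x2 + om u v x1 x2 * q1 (q2 P) x1 x2))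
    (G' := fun x1 x2 => -Pr⁻¹ * (q2 P x1 x2 * vt x1 x2 + P x1 x2 * q2 vt x1 x2)
       - c * Pr⁻¹ * (q2 P x1 x2 * q1 v x1 x2 + P x1 x2 * q2 (q1 v) x1 x2)
       - (q2 (om u v) x1 x2 * q1 P x1 x2 + om u v x1 x2 * q2 (q1 P) x1 x2))
    (H := fun x1 x2 => ((q1 P x1 x2 ^ 2 + q2 P x1 x2 ^ 2) - Ra * (T x1 x2 * q2 P x1 x2))
       - Pr⁻¹ * ((om u v x1 x2 * v x1 x2) * q1 P x1 x2
            + (- (om u v x1 x2 * (u x1 x2 - c))) * q2 P x1 x2))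
    (fun x1 x2 _ => ((((ss_hd1 h.sP x1 x2).mul (ss_hd1 h.sut x1 x2)).const_mul (-Pr⁻¹)).sub
      (((ss_hd1 h.sP x1 x2).mul (ss_hd1 (ss_q1 h.su) x1 x2)).const_mul (c * Pr⁻¹))).add
      ((ss_hd1 sω x1 x2).mul (ss_hd1 (ss_q2 h.sP) x1 x2)))
    (fun x1 x2 => by simp only [h.pP x1 x2, per_om h.pu h.pv x1 x2,
      h.put x1 x2, per_q1 h.pu x1 x2, per_q2 h.pP x1 x2])
    (fun x1 x2 _ => ((((ss_hd2 h.sP x1 x2).mul (ss_hd2 h.svt x1 x2)).const_mul (-Pr⁻¹)).sub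
      (((ss_hd2 h.sP x1 x2).mul (ss_hd2 (ss_q1 h.sv) x1 x2)).const_mul (c * Pr⁻¹))).sub
      ((ss_hd2 sω x1 x2).mul (ss_hd2 (ss_q1 h.sP) x1 x2)))
    (by fun_prop) (by fun_prop) ?_
  · simp only [h.vt0, h.vt1, h.q1v0, h.q1v1, h.om0, h.om1] at this
    rw [intΩ_sub _ _ (by fun_prop) (by fun_prop), intΩ_cmul, intΩ_sub _ _ (by fun_prop) (by fun_prop),
      intΩ_cmul] at this
    have e : (∫ x1 in (0:ℝ)..Γ,
        ((-Pr⁻¹ * (P x1 1 * 0) - c * Pr⁻¹ * (P x1 1 * 0) - b * u x1 1 * q1 P x1 1)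
        - (-Pr⁻¹ * (P x1 0 * 0) - c * Pr⁻¹ * (P x1 0 * 0) - -b * u x1 0 * q1 P x1 0)))
        = - b * Bd Γ u P := by
      unfold Bd
      rw [← intervalIntegral.integral_const_mul]
      congr 1; funext x; ring
    rw [e] at this
    linarith
  · intro x1 x2 hx
    have e := h.ddiv1 x1 hx
    have e' := h.hdivt x1 x2 hx
    have e1 := h.m1 x1 x2 hx
    have e2 := h.m2 x1 x2 hx
    have eP := ss_comm h.sP x1 x2
    linear_combination q1 P x1 x2 * e1 + q2 P x1 x2 * e2 + Pr⁻¹ * P x1 x2 * e'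
      + c * Pr⁻¹ * P x1 x2 * e - om u v x1 x2 * eP

/-- bulk representation of the boundary pressure term -/
lemma Bd_eq (hΓ : 0 < Γ) (h : Stat Γ Ra Pr b c u v T P ut vt) :
    Bd Γ u P = intΩ Γ (fun x1 x2 => (2 * (u x1 x2 - c) + (2 * x2 - 1) * q2 u x1 x2) * q1 P x1 x2
      + (- ((2 * x2 - 1) * q1 u x1 x2)) * q2 P x1 x2) := by
  have c0' := ss_cont h.su
  have c1 := ss_cont (ss_q1 h.su)
  have c2 := ss_cont (ss_q2 h.su)
  have c8 := ss_cont h.sP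
  have c9 := ss_cont (ss_q1 h.sP)
  have c10 := ss_cont (ss_q2 h.sP)
  have c18 := ss_cont (ss_q1 (ss_q2 h.sP))
  have c19 := ss_cont (ss_q2 (ss_q1 h.sP))
  have hη : ∀ x2 : ℝ, HasDerivAt (fun y : ℝ => 2 * y - 1) 2 x2 := fun x2 => by
    simpa using ((hasDerivAt_id x2).const_mul 2).sub_const 1
  rw [div_thm hΓ
    (F := fun x1 x2 => -(2 * x2 - 1) * ((u x1 x2 - c) * q2 P x1 x2))
    (G := fun x1 x2 => (2 * x2 - 1) * ((u x1 x2 - c) * q1 P x1 x2))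
    (F' := fun x1 x2 => -(2 * x2 - 1) * (q1 u x1 x2 * q2 P x1 x2 + (u x1 x2 - c) * q1 (q2 P) x1 x2))
    (G' := fun x1 x2 => 2 * ((u x1 x2 - c) * q1 P x1 x2) +
       (2 * x2 - 1) * (q2 u x1 x2 * q1 P x1 x2 + (u x1 x2 - c) * q2 (q1 P) x1 x2))
    (fun x1 x2 _ => (((ss_hd1 h.su x1 x2).sub_const c).mul (ss_hd1 (ss_q2 h.sP) x1 x2)).const_mul _)
    (fun x1 x2 => by simp only [h.pu x1 x2, per_q2 h.pP x1 x2])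
    (fun x1 x2 _ => (hη x2).mul (((ss_hd2 h.su x1 x2).sub_const c).mul (ss_hd2 (ss_q1 h.sP) x1 x2)))
    (by fun_prop) (by fun_prop) ?_]
  · have hz : ∀ y, (∫ x1 in (0:ℝ)..Γ, q1 P x1 y) = 0 := by
      intro y
      have hh := intervalIntegral.integral_eq_sub_of_hasDerivAt (a := 0) (b := Γ)
        (f := fun x => P x y) (f' := fun x1 => q1 P x1 y)
        (fun x _ => ss_hd1 h.sP x y)
        (Continuous.intervalIntegrable (by fun_prop) _ _)
      rw [hh]
      have := h.pP 0 y
      rw [zero_add] at this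
      simp [this]
    have e : Bd Γ u P = (∫ x1 in (0:ℝ)..Γ, ((2 * 1 - 1) * ((u x1 1 - c) * q1 P x1 1)
        - (2 * 0 - 1) * ((u x1 0 - c) * q1 P x1 0)))
        + c * ((∫ x1 in (0:ℝ)..Γ, q1 P x1 1) + (∫ x1 in (0:ℝ)..Γ, q1 P x1 0)) := by
      unfold Bd
      rw [← intervalIntegral.integral_add (Continuous.intervalIntegrable (by fun_prop) _ _)
        (Continuous.intervalIntegrable (by fun_prop) _ _), ← intervalIntegral.integral_const_mul,
        ← intervalIntegral.integral_add (Continuous.intervalIntegrable (by fun_prop) _ _)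
        (Continuous.intervalIntegrable (by fun_prop) _ _)]
      congr 1; funext x; ring
    rw [e, hz, hz]; ring
  · intro x1 x2 hx
    have eP := ss_comm h.sP x1 x2
    linear_combination (2 * x2 - 1) * (u x1 x2 - c) * eP

/-- the vertical velocity has zero mean -/
lemma mean_v (hΓ : 0 < Γ) (h : Stat Γ Ra Pr b c u v T P ut vt) : mean Γ v = 0 := by
  have c0 := ss_cont h.sv
  have c0' := ss_cont h.su
  have c1 := ss_cont (ss_q1 h.su)
  have c2 := ss_cont (ss_q2 h.sv)
  unfold mean
  rw [div_thm hΓ (F := fun x1 x2 => x2 * u x1 x2) (G := fun x1 x2 => x2 * v x1 x2)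
    (F' := fun x1 x2 => x2 * q1 u x1 x2) (G' := fun x1 x2 => 1 * v x1 x2 + x2 * q2 v x1 x2)
    (fun x1 x2 _ => (ss_hd1 h.su x1 x2).const_mul _)
    (fun x1 x2 => by simp only [h.pu x1 x2])
    (fun x1 x2 _ => (hasDerivAt_id x2).mul (ss_hd2 h.sv x1 x2)) (by fun_prop) (by fun_prop) ?_]
  · simp [h.v0, h.v1]
  · intro x1 x2 hx
    linear_combination - x2 * h.hdiv x1 x2 hx
end Stat

lemma CS2 {A B p r : SField} (hA : Continuous (fun q : ℝ × ℝ => A q.1 q.2))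
    (hB : Continuous (fun q : ℝ × ℝ => B q.1 q.2)) (hp : Continuous (fun q : ℝ × ℝ => p q.1 q.2))
    (hr : Continuous (fun q : ℝ × ℝ => r q.1 q.2)) :
    intΩ Γ (fun x1 x2 => A x1 x2 * p x1 x2 + B x1 x2 * r x1 x2) ^ 2 ≤
      2 * intΩ Γ (fun x1 x2 => A x1 x2 ^ 2 + B x1 x2 ^ 2) *
        intΩ Γ (fun x1 x2 => p x1 x2 ^ 2 + r x1 x2 ^ 2) := by
  rw [intΩ_add _ _ (by fun_prop) (by fun_prop), intΩ_add _ _ (by fun_prop) (by fun_prop),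
    intΩ_add _ _ (by fun_prop) (by fun_prop)]
  have h1 := intΩ_CS (Γ := Γ) hA hp
  have h2 := intΩ_CS (Γ := Γ) hB hr
  have a1 : 0 ≤ intΩ Γ (fun x1 x2 => A x1 x2 ^ 2) := intΩ_nonneg (fun _ _ _ _ => sq_nonneg _)
  have a2 : 0 ≤ intΩ Γ (fun x1 x2 => B x1 x2 ^ 2) := intΩ_nonneg (fun _ _ _ _ => sq_nonneg _)
  have a3 : 0 ≤ intΩ Γ (fun x1 x2 => p x1 x2 ^ 2) := intΩ_nonneg (fun _ _ _ _ => sq_nonneg _)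
  have a4 : 0 ≤ intΩ Γ (fun x1 x2 => r x1 x2 ^ 2) := intΩ_nonneg (fun _ _ _ _ => sq_nonneg _)
  have := mul_nonneg a1 a4
  have := mul_nonneg a2 a3
  nlinarith [sq_nonneg (intΩ Γ (fun x1 x2 => A x1 x2 * p x1 x2) - intΩ Γ (fun x1 x2 => B x1 x2 * r x1 x2))]

namespace Stat
variable {b c : ℝ} {u v T P ut vt : SField}

lemma grad_u_le (hΓ : 0 < Γ) (h : Stat Γ Ra Pr b c u v T P ut vt) :
    intΩ Γ (fun x1 x2 => q1 u x1 x2 ^ 2 + q2 u x1 x2 ^ 2) ≤ intΩ Γ (fun x1 x2 => om u v x1 x2 ^ 2) := by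
  have c1 := ss_cont (ss_q1 h.su)
  have c2 := ss_cont (ss_q2 h.su)
  have c3 := ss_cont (ss_q1 h.sv)
  have c4 := ss_cont (ss_q2 h.sv)
  rw [← h.grad_eq hΓ]
  exact intΩ_mono (by fun_prop) (by fun_prop) fun x1 _ x2 _ => by
    linarith [sq_nonneg (q1 v x1 x2), sq_nonneg (q2 v x1 x2)]
lemma grad_v_le (hΓ : 0 < Γ) (h : Stat Γ Ra Pr b c u v T P ut vt) :
    intΩ Γ (fun x1 x2 => q1 v x1 x2 ^ 2 + q2 v x1 x2 ^ 2) ≤ intΩ Γ (fun x1 x2 => om u v x1 x2 ^ 2) := by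
  have c1 := ss_cont (ss_q1 h.su)
  have c2 := ss_cont (ss_q2 h.su)
  have c3 := ss_cont (ss_q1 h.sv)
  have c4 := ss_cont (ss_q2 h.sv)
  rw [← h.grad_eq hΓ]
  exact intΩ_mono (by fun_prop) (by fun_prop) fun x1 _ x2 _ => by
    linarith [sq_nonneg (q1 u x1 x2), sq_nonneg (q2 u x1 x2)]

lemma Bd_le (hΓ : 0 < Γ) (h : Stat Γ Ra Pr b c u v T P ut vt) (hc : c = mean Γ u) :
    Bd Γ u P ^ 2 ≤ (16 * Real.sqrt (Γ * cS Γ) + 4) * intΩ Γ (fun x1 x2 => om u v x1 x2 ^ 2)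
      * intΩ Γ (fun x1 x2 => q1 P x1 x2 ^ 2 + q2 P x1 x2 ^ 2) := by
  have c0' := ss_cont h.su
  have c1 := ss_cont (ss_q1 h.su)
  have c2 := ss_cont (ss_q2 h.su)
  have c9 := ss_cont (ss_q1 h.sP)
  have c10 := ss_cont (ss_q2 h.sP)
  rw [h.Bd_eq hΓ]
  refine (CS2 (by fun_prop) (by fun_prop) (by fun_prop) (by fun_prop)).trans ?_
  have hPi : 0 ≤ intΩ Γ (fun x1 x2 => q1 P x1 x2 ^ 2 + q2 P x1 x2 ^ 2) :=
    intΩ_nonneg (fun _ _ _ _ => by positivity)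
  refine mul_le_mul_of_nonneg_right ?_ hPi
  have h1 : intΩ Γ (fun x1 x2 => (2 * (u x1 x2 - c) + (2 * x2 - 1) * q2 u x1 x2) ^ 2
      + (-((2 * x2 - 1) * q1 u x1 x2)) ^ 2) ≤ intΩ Γ (fun x1 x2 => 8 * (u x1 x2 - c) ^ 2
        + 2 * (q1 u x1 x2 ^ 2 + q2 u x1 x2 ^ 2)) := by
    refine intΩ_mono (by fun_prop) (by fun_prop) fun x1 _ x2 hx => ?_
    have hη : (2 * x2 - 1) ^ 2 ≤ 1 := by nlinarith [hx.1, hx.2]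
    have := mul_le_mul_of_nonneg_right hη (sq_nonneg (q2 u x1 x2))
    have := mul_le_mul_of_nonneg_right hη (sq_nonneg (q1 u x1 x2))
    nlinarith [sq_nonneg (2 * (u x1 x2 - c) - (2 * x2 - 1) * q2 u x1 x2), sq_nonneg (q1 u x1 x2)]
  rw [intΩ_add (fun x1 x2 => 8 * (u x1 x2 - c) ^ 2) _ (by fun_prop) (by fun_prop), intΩ_cmul,
    intΩ_cmul] at h1
  have h2 := sobolev2 hΓ h.su
  rw [← hc] at h2
  have h3 := h.grad_u_le hΓ
  have h4 := mul_le_mul_of_nonneg_left h3 (Real.sqrt_nonneg (Γ * cS Γ))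
  nlinarith

lemma N_le (hΓ : 0 < Γ) (h : Stat Γ Ra Pr b c u v T P ut vt) (hc : c = mean Γ u) {m : ℝ} (hm : 0 ≤ m)
    (hω : intΩ Γ (fun x1 x2 => om u v x1 x2 ^ 4) ≤ m ^ 4) :
    intΩ Γ (fun x1 x2 => (om u v x1 x2 * v x1 x2) * q1 P x1 x2
            + (- (om u v x1 x2 * (u x1 x2 - c))) * q2 P x1 x2) ^ 2
    ≤ (4 * Real.sqrt (cS Γ)) * m ^ 2 * intΩ Γ (fun x1 x2 => om u v x1 x2 ^ 2)
      * intΩ Γ (fun x1 x2 => q1 P x1 x2 ^ 2 + q2 P x1 x2 ^ 2) := by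
  have c0 := ss_cont h.sv
  have c0' := ss_cont h.su
  have c7 := ss_cont (ss_om h.su h.sv)
  have c9 := ss_cont (ss_q1 h.sP)
  have c10 := ss_cont (ss_q2 h.sP)
  refine (CS2 (by fun_prop) (by fun_prop) (by fun_prop) (by fun_prop)).trans ?_
  have hPi : 0 ≤ intΩ Γ (fun x1 x2 => q1 P x1 x2 ^ 2 + q2 P x1 x2 ^ 2) :=
    intΩ_nonneg (fun _ _ _ _ => by positivity)
  refine mul_le_mul_of_nonneg_right ?_ hPi
  have hG : 0 ≤ intΩ Γ (fun x1 x2 => om u v x1 x2 ^ 2) := intΩ_nonneg (fun _ _ _ _ => by positivity)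
  have key : ∀ w : SField, Continuous (fun q : ℝ × ℝ => w q.1 q.2) →
      intΩ Γ (fun x1 x2 => w x1 x2 ^ 4) ≤ cS Γ * intΩ Γ (fun x1 x2 => om u v x1 x2 ^ 2) ^ 2 →
      intΩ Γ (fun x1 x2 => om u v x1 x2 ^ 2 * w x1 x2 ^ 2) ≤
        Real.sqrt (cS Γ) * m ^ 2 * intΩ Γ (fun x1 x2 => om u v x1 x2 ^ 2) := by
    intro w hw hi
    have h1 := intΩ_CS (Γ := Γ) (f := fun x1 x2 => om u v x1 x2 ^ 2) (g := fun x1 x2 => w x1 x2 ^ 2)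
      (by fun_prop) (by fun_prop)
    simp only [← pow_mul] at h1
    norm_num at h1
    refine abs_le_of_sq_le_sq' ?_ (by positivity) |>.2
    refine h1.trans ?_
    have h5 : (0:ℝ) ≤ intΩ Γ (fun x1 x2 => w x1 x2 ^ 4) := intΩ_nonneg (fun _ _ _ _ => by positivity)
    calc _ ≤ m ^ 4 * (cS Γ * intΩ Γ (fun x1 x2 => om u v x1 x2 ^ 2) ^ 2) := by gcongr
      _ = (Real.sqrt (cS Γ)) ^ 2 * (m ^ 4 * intΩ Γ (fun x1 x2 => om u v x1 x2 ^ 2) ^ 2) := by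
          rw [Real.sq_sqrt (cS_pos hΓ).le]; ring
      _ = _ := by ring
  have k1 := key v c0 (by
    have h1 := sobolev hΓ h.sv
    rw [h.mean_v hΓ] at h1
    simp only [sub_zero] at h1
    refine h1.trans ?_
    have := h.grad_v_le hΓ
    have h0 : 0 ≤ intΩ Γ (fun x1 x2 => q1 v x1 x2 ^ 2 + q2 v x1 x2 ^ 2) :=
      intΩ_nonneg (fun _ _ _ _ => by positivity)
    have := (cS_pos hΓ).le
    gcongr)
  have k2 := key (fun x1 x2 => u x1 x2 - c) (by fun_prop) (by
    have h1 := sobolev hΓ h.su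
    rw [← hc] at h1
    refine h1.trans ?_
    have := h.grad_u_le hΓ
    have h0 : 0 ≤ intΩ Γ (fun x1 x2 => q1 u x1 x2 ^ 2 + q2 u x1 x2 ^ 2) :=
      intΩ_nonneg (fun _ _ _ _ => by positivity)
    have := (cS_pos hΓ).le
    gcongr)
  have e : intΩ Γ (fun x1 x2 => (om u v x1 x2 * v x1 x2) ^ 2 + (-(om u v x1 x2 * (u x1 x2 - c))) ^ 2)
      = intΩ Γ (fun x1 x2 => om u v x1 x2 ^ 2 * v x1 x2 ^ 2) +
        intΩ Γ (fun x1 x2 => om u v x1 x2 ^ 2 * (u x1 x2 - c) ^ 2) := by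
    rw [← intΩ_add _ _ (by fun_prop) (by fun_prop)]
    congr 1; funext x1 x2; ring
  rw [e]
  linarith
end Stat

/-- constant of the dissipation estimate -/
def c1K (Γ : ℝ) : ℝ := Real.sqrt (16 * Real.sqrt (Γ * cS Γ) + 4)
def c2K (Γ : ℝ) : ℝ := Real.sqrt (4 * Real.sqrt (cS Γ))
def c3K (Γ : ℝ) : ℝ := c1K Γ * Real.sqrt Γ + c1K Γ * c2K Γ + c1K Γ ^ 2

set_option maxHeartbeats 1000000 in
/-- purely algebraic closing of the dissipation estimate -/
lemma diss_alg {D Zd Pi N B G W τ C1 C2 b m q Ra R lam sΓ K TP : ℝ}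
    (hC1 : 0 ≤ C1) (hC2 : 0 ≤ C2) (hb : 0 ≤ b) (hm : 0 ≤ m) (hq : 0 ≤ q) (hR : 0 ≤ R) (hRa : Ra = R ^ 2)
    (hl : 0 < lam) (hsΓ : 0 ≤ sΓ) (hPi : 0 ≤ Pi) (hG : 0 ≤ G) (hτ : 0 ≤ τ)
    (hK : K = C1 * sΓ + C1 * C2 + C1 ^ 2)
    (h1 : Pi = Ra * TP + q * N - b * B) (hTP : TP ^ 2 ≤ sΓ ^ 2 * Pi)
    (hN : N ^ 2 ≤ C2 ^ 2 * m ^ 2 * G * Pi) (hB : B ^ 2 ≤ C1 ^ 2 * G * Pi)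
    (hW : W ^ 2 ≤ G * τ) (hD : D + q * Zd + b * B = Ra * W) :
    D + q * Zd ≤ K * (b * Ra * lam) + (K * (b * Ra / lam + b * m * q + b ^ 2) + R / 2) * G
      + R ^ 3 / 2 * τ := by
  set s := Real.sqrt Pi with hs
  set g := Real.sqrt G with hg
  have hs0 : 0 ≤ s := Real.sqrt_nonneg _
  have hg0 : 0 ≤ g := Real.sqrt_nonneg _
  have hs2 : s ^ 2 = Pi := Real.sq_sqrt hPi
  have hg2 : g ^ 2 = G := Real.sq_sqrt hG
  have ht2 := Real.sq_sqrt hτ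
  set tt := Real.sqrt τ with htt
  have htt0 : 0 ≤ tt := Real.sqrt_nonneg _
  rw [← hs2] at hTP hN hB
  rw [← hg2] at hN hB hW
  rw [← ht2] at hW
  have aTP : TP ≤ sΓ * s := (abs_le_of_sq_le_sq' (by rw [mul_pow]; exact hTP) (by positivity)).2
  have aN : N ≤ C2 * m * g * s :=
    (abs_le_of_sq_le_sq' (by linarith [mul_pow (C2 * m * g) s 2, mul_pow (C2 * m) g 2, mul_pow C2 m 2]) (by positivity)).2
  have aB : -(C1 * g * s) ≤ B :=
    (abs_le_of_sq_le_sq' (by linarith [mul_pow (C1 * g) s 2, mul_pow C1 g 2]) (by positivity)).1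
  have aW : W ≤ g * tt := (abs_le_of_sq_le_sq' (by rw [mul_pow]; exact hW) (by positivity)).2
  have hRa0 : 0 ≤ Ra := by rw [hRa]; positivity
  have hle : s ^ 2 ≤ s * (Ra * sΓ + q * (C2 * m * g) + b * (C1 * g)) := by
    rw [hs2, h1]
    have := mul_le_mul_of_nonneg_left aTP hRa0
    have := mul_le_mul_of_nonneg_left aN hq
    have := mul_le_mul_of_nonneg_left aB hb
    linarith
  have hsle : s ≤ Ra * sΓ + q * (C2 * m * g) + b * (C1 * g) := by
    rcases hs0.eq_or_lt with h0 | h0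
    · rw [← h0]; positivity
    · have : s * s ≤ s * (Ra * sΓ + q * (C2 * m * g) + b * (C1 * g)) := by rw [← sq]; exact hle
      exact le_of_mul_le_mul_left this h0
  have e1 : D + q * Zd ≤ b * (C1 * g) * (Ra * sΓ + q * (C2 * m * g) + b * (C1 * g)) + Ra * (g * tt) := by
    have := mul_le_mul_of_nonneg_left aB hb
    have := mul_le_mul_of_nonneg_left aW hRa0
    have := mul_le_mul_of_nonneg_left hsle (by positivity : 0 ≤ b * (C1 * g))
    linarith
  have e2 : g ≤ lam + G / lam := by
    rw [← hg2]
    have : 0 ≤ (lam - g) ^ 2 / lam + g := by positivity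
    have e : (lam - g) ^ 2 / lam + g = lam + g ^ 2 / lam - g := by field_simp; ring
    linarith
  have e3 : Ra * (g * tt) ≤ R / 2 * G + R ^ 3 / 2 * τ := by
    rw [hRa, ← hg2, ← ht2]
    have := mul_nonneg hR (sq_nonneg (g - R * tt))
    have e : R * (g - R * tt) ^ 2 = R * g ^ 2 + R ^ 3 * tt ^ 2 - 2 * (R ^ 2 * (g * tt)) := by ring
    linarith
  have k1 : C1 * sΓ ≤ K := by rw [hK]; linarith [mul_nonneg hC1 hC2, sq_nonneg C1]
  have k2 : C1 * C2 ≤ K := by rw [hK]; linarith [mul_nonneg hC1 hsΓ, sq_nonneg C1]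
  have k3 : C1 ^ 2 ≤ K := by rw [hK]; linarith [mul_nonneg hC1 hsΓ, mul_nonneg hC1 hC2]
  have f1 : b * (C1 * g) * (Ra * sΓ) ≤ K * (b * Ra * lam) + K * (b * Ra / lam) * G := by
    calc b * (C1 * g) * (Ra * sΓ) = (C1 * sΓ) * (b * Ra) * g := by ring
      _ ≤ K * (b * Ra) * (lam + G / lam) := by
        have : 0 ≤ K := (mul_nonneg hC1 hsΓ).trans k1
        gcongr
      _ = _ := by ring
  have f2 : b * (C1 * g) * (q * (C2 * m * g)) ≤ K * (b * m * q) * G := by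
    calc _ = (C1 * C2) * (b * m * q * g ^ 2) := by ring
      _ ≤ K * (b * m * q * g ^ 2) := by gcongr
      _ = _ := by rw [hg2]; ring
  have f3 : b * (C1 * g) * (b * (C1 * g)) ≤ K * b ^ 2 * G := by
    calc _ = C1 ^ 2 * (b ^ 2 * g ^ 2) := by ring
      _ ≤ K * (b ^ 2 * g ^ 2) := by gcongr
      _ = _ := by rw [hg2]; ring
  linarith

namespace Stat
variable {b c : ℝ} {u v T P ut vt : SField}

lemma T2_le (hΓ : 0 < Γ) (h : Stat Γ Ra Pr b c u v T P ut vt) :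
    intΩ Γ (fun x1 x2 => T x1 x2 ^ 2) ≤ Γ := by
  have c0 := ss_cont h.sT
  have := intΩ_mono (Γ := Γ) (f := fun x1 x2 => T x1 x2 ^ 2) (g := fun _ _ => 1) (by fun_prop)
    (by fun_prop) h.Tb
  rwa [intΩ_const hΓ, mul_one] at this

/-- dissipation estimate -/
lemma diss (hΓ : 0 < Γ) (hb : 0 ≤ b) (hPr : 0 < Pr) (h : Stat Γ Ra Pr b c u v T P ut vt)
    (hc : c = mean Γ u) {m R lam : ℝ} (hm : 0 ≤ m) (hR : 0 ≤ R) (hRa : Ra = R ^ 2) (hl : 0 < lam)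
    (hω : intΩ Γ (fun x1 x2 => om u v x1 x2 ^ 4) ≤ m ^ 4) :
    intΩ Γ (fun x1 x2 => q1 (om u v) x1 x2 ^ 2 + q2 (om u v) x1 x2 ^ 2)
      + Pr⁻¹ * (intΩ Γ (fun x1 x2 => om u v x1 x2 * om ut vt x1 x2)
        + b * ∫ x1 in (0:ℝ)..Γ, (u x1 1 * ut x1 1 + u x1 0 * ut x1 0))
    ≤ c3K Γ * (b * Ra * lam) + (c3K Γ * (b * Ra / lam + b * m * Pr⁻¹ + b ^ 2) + R / 2) *
        intΩ Γ (fun x1 x2 => om u v x1 x2 ^ 2)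
      + R ^ 3 / 2 * intΩ Γ (fun x1 x2 => q1 T x1 x2 ^ 2) := by
  have c7 := ss_cont (ss_om h.su h.sv)
  have c13 := ss_cont h.sT
  have c14 := ss_cont (ss_q1 h.sT)
  have c9 := ss_cont (ss_q1 h.sP)
  have c10 := ss_cont (ss_q2 h.sP)
  have hPi : 0 ≤ intΩ Γ (fun x1 x2 => q1 P x1 x2 ^ 2 + q2 P x1 x2 ^ 2) :=
    intΩ_nonneg (fun _ _ _ _ => by positivity)
  have hG : 0 ≤ intΩ Γ (fun x1 x2 => om u v x1 x2 ^ 2) := intΩ_nonneg (fun _ _ _ _ => by positivity)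
  refine diss_alg (C1 := c1K Γ) (C2 := c2K Γ) (sΓ := Real.sqrt Γ) (Real.sqrt_nonneg _) (Real.sqrt_nonneg _) hb hm
    (by positivity) hR hRa hl (Real.sqrt_nonneg _) hPi hG (intΩ_nonneg (fun _ _ _ _ => by positivity)) rfl
    (h.pressure hΓ) ?_ ?_ ?_ (intΩ_CS (by fun_prop) (by fun_prop)) (h.enstrophy hΓ)
  · refine (intΩ_CS (by fun_prop) (by fun_prop)).trans ?_
    rw [Real.sq_sqrt hΓ.le]
    have h1 := h.T2_le hΓ
    have h2 : intΩ Γ (fun x1 x2 => q2 P x1 x2 ^ 2) ≤ intΩ Γ (fun x1 x2 => q1 P x1 x2 ^ 2 + q2 P x1 x2 ^ 2) :=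
      intΩ_mono (by fun_prop) (by fun_prop) fun x1 _ x2 _ => by linarith [sq_nonneg (q1 P x1 x2)]
    have h3 : 0 ≤ intΩ Γ (fun x1 x2 => q2 P x1 x2 ^ 2) := intΩ_nonneg (fun _ _ _ _ => by positivity)
    gcongr
  · unfold c2K
    rw [Real.sq_sqrt (by positivity)]
    exact h.N_le hΓ hc hm hω
  · unfold c1K
    rw [Real.sq_sqrt (by positivity)]
    exact h.Bd_le hΓ hc

/-- auxiliary: second derivatives of one component -/
lemma hess_aux (hΓ : 0 < Γ) {w : SField} (sw : ssmooth w) (pw : speriodic Γ w) :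
    intΩ Γ (fun x1 x2 => (q1 (q1 w) x1 x2 + q2 (q2 w) x1 x2) ^ 2)
    = intΩ Γ (fun x1 x2 => q1 (q1 w) x1 x2 ^ 2 + q1 (q2 w) x1 x2 ^ 2
      + q2 (q1 w) x1 x2 ^ 2 + q2 (q2 w) x1 x2 ^ 2)
      - 2 * ∫ x1 in (0:ℝ)..Γ, (q1 w x1 1 * q1 (q2 w) x1 1 - q1 w x1 0 * q1 (q2 w) x1 0) := by
  have c1 := ss_cont (ss_q1 sw)
  have c2 := ss_cont (ss_q2 sw)
  have c3 := ss_cont (ss_q1 (ss_q1 sw))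
  have c4 := ss_cont (ss_q1 (ss_q2 sw))
  have c5 := ss_cont (ss_q2 (ss_q1 sw))
  have c6 := ss_cont (ss_q2 (ss_q2 sw))
  have c7 := ss_cont (ss_q1 (ss_q2 (ss_q2 sw)))
  have c8 := ss_cont (ss_q2 (ss_q1 (ss_q2 sw)))
  have := div_thm hΓ (F := fun x1 x2 => q1 w x1 x2 * q2 (q2 w) x1 x2)
    (G := fun x1 x2 => - (q1 w x1 x2 * q1 (q2 w) x1 x2))
    (F' := fun x1 x2 => q1 (q1 w) x1 x2 * q2 (q2 w) x1 x2 + q1 w x1 x2 * q1 (q2 (q2 w)) x1 x2)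
    (G' := fun x1 x2 => - (q2 (q1 w) x1 x2 * q1 (q2 w) x1 x2 + q1 w x1 x2 * q2 (q1 (q2 w)) x1 x2))
    (H := fun x1 x2 => (1/2) * ((q1 (q1 w) x1 x2 + q2 (q2 w) x1 x2) ^ 2
      - (q1 (q1 w) x1 x2 ^ 2 + q1 (q2 w) x1 x2 ^ 2
      + q2 (q1 w) x1 x2 ^ 2 + q2 (q2 w) x1 x2 ^ 2)))
    (fun x1 x2 _ => (ss_hd1 (ss_q1 sw) x1 x2).mul (ss_hd1 (ss_q2 (ss_q2 sw)) x1 x2))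
    (fun x1 x2 => by simp only [per_q1 pw x1 x2, per_q2 (per_q2 pw) x1 x2])
    (fun x1 x2 _ => ((ss_hd2 (ss_q1 sw) x1 x2).mul (ss_hd2 (ss_q1 (ss_q2 sw)) x1 x2)).neg)
    (by fun_prop) (by fun_prop) ?_
  · rw [intΩ_cmul, intΩ_sub _ _ (by fun_prop) (by fun_prop)] at this
    have e : (∫ x1 in (0:ℝ)..Γ, (-(q1 w x1 1 * q1 (q2 w) x1 1) - -(q1 w x1 0 * q1 (q2 w) x1 0)))
      = - ∫ x1 in (0:ℝ)..Γ, (q1 w x1 1 * q1 (q2 w) x1 1 - q1 w x1 0 * q1 (q2 w) x1 0) := by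
      rw [← intervalIntegral.integral_neg]
      congr 1; funext x; ring
    rw [e] at this
    linarith
  · intro x1 x2 hx
    rw [ss_comm (ss_q2 sw), ← ss_comm sw]
    ring

/-- the Hessian is controlled by the vorticity gradient -/
lemma hess_le (hΓ : 0 < Γ) (hb : 0 ≤ b) (h : Stat Γ Ra Pr b c u v T P ut vt) :
    intΩ Γ (fun x1 x2 => q1 (q1 u) x1 x2 ^ 2 + q1 (q2 u) x1 x2 ^ 2 +
      q2 (q1 u) x1 x2 ^ 2 + q2 (q2 u) x1 x2 ^ 2 + q1 (q1 v) x1 x2 ^ 2 + q1 (q2 v) x1 x2 ^ 2 +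
      q2 (q1 v) x1 x2 ^ 2 + q2 (q2 v) x1 x2 ^ 2)
    ≤ intΩ Γ (fun x1 x2 => q1 (om u v) x1 x2 ^ 2 + q2 (om u v) x1 x2 ^ 2) := by
  have c1 := ss_cont (ss_q1 (ss_q1 h.su))
  have c2 := ss_cont (ss_q1 (ss_q2 h.su))
  have c3 := ss_cont (ss_q2 (ss_q1 h.su))
  have c4 := ss_cont (ss_q2 (ss_q2 h.su))
  have c5 := ss_cont (ss_q1 (ss_q1 h.sv))
  have c6 := ss_cont (ss_q1 (ss_q2 h.sv))
  have c7 := ss_cont (ss_q2 (ss_q1 h.sv))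
  have c8 := ss_cont (ss_q2 (ss_q2 h.sv))
  have e0 : intΩ Γ (fun x1 x2 => q1 (om u v) x1 x2 ^ 2 + q2 (om u v) x1 x2 ^ 2)
      = intΩ Γ (fun x1 x2 => (q1 (q1 v) x1 x2 + q2 (q2 v) x1 x2) ^ 2
        + (q1 (q1 u) x1 x2 + q2 (q2 u) x1 x2) ^ 2) := by
    refine intΩ_congr fun x1 x2 hx => ?_
    have eo1 : q1 (om u v) x1 x2 = q1 (q1 v) x1 x2 - q1 (q2 u) x1 x2 :=
      ((ss_hd1 (ss_q1 h.sv) x1 x2).sub (ss_hd1 (ss_q2 h.su) x1 x2)).deriv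
    have eo2 : q2 (om u v) x1 x2 = q2 (q1 v) x1 x2 - q2 (q2 u) x1 x2 :=
      ((ss_hd2 (ss_q1 h.sv) x1 x2).sub (ss_hd2 (ss_q2 h.su) x1 x2)).deriv
    have eu := ss_comm h.su x1 x2
    have d1 := h.ddiv1 x1 hx
    have d2 := h.ddiv2 x1 hx
    have f1 : q1 (om u v) x1 x2 = q1 (q1 v) x1 x2 + q2 (q2 v) x1 x2 := by linarith
    have f2 : q2 (om u v) x1 x2 = - (q1 (q1 u) x1 x2 + q2 (q2 u) x1 x2) := by linarith
    rw [f1, f2]; ring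
  have hu := hess_aux hΓ h.su h.pu
  have hv := hess_aux hΓ h.sv h.pv
  have b1 : ∀ x1, q1 (q2 u) x1 1 = -b * q1 u x1 1 := by
    intro x1
    have : (fun y => q2 u y 1) = fun y => -b * u y 1 := funext h.sl1
    show deriv (fun y => q2 u y 1) x1 = _
    rw [this]
    exact ((ss_hd1 h.su x1 1).const_mul _).deriv
  have b0 : ∀ x1, q1 (q2 u) x1 0 = b * q1 u x1 0 := by
    intro x1
    have : (fun y => q2 u y 0) = fun y => b * u y 0 := funext h.sl0
    show deriv (fun y => q2 u y 0) x1 = _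
    rw [this]
    exact ((ss_hd1 h.su x1 0).const_mul _).deriv
  simp only [h.q1v0, h.q1v1, zero_mul, sub_zero, intervalIntegral.integral_zero, mul_zero] at hv
  simp only [b0, b1] at hu
  have i0 : (∫ x1 in (0:ℝ)..Γ, (q1 u x1 1 * (-b * q1 u x1 1) - q1 u x1 0 * (b * q1 u x1 0)))
      = - ∫ x1 in (0:ℝ)..Γ, b * (q1 u x1 1 ^ 2 + q1 u x1 0 ^ 2) := by
    rw [← intervalIntegral.integral_neg]
    congr 1; funext x; ring
  have i1 : 0 ≤ ∫ x1 in (0:ℝ)..Γ, b * (q1 u x1 1 ^ 2 + q1 u x1 0 ^ 2) :=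
    intervalIntegral.integral_nonneg hΓ.le (fun x _ => by positivity)
  rw [i0] at hu
  rw [e0, intΩ_add (fun x1 x2 => (q1 (q1 v) x1 x2 + q2 (q2 v) x1 x2) ^ 2) _ (by fun_prop) (by fun_prop), hu, hv, ← sub_nonneg]
  have e1 : intΩ Γ (fun x1 x2 => q1 (q1 u) x1 x2 ^ 2 + q1 (q2 u) x1 x2 ^ 2 +
      q2 (q1 u) x1 x2 ^ 2 + q2 (q2 u) x1 x2 ^ 2 + q1 (q1 v) x1 x2 ^ 2 + q1 (q2 v) x1 x2 ^ 2 +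
      q2 (q1 v) x1 x2 ^ 2 + q2 (q2 v) x1 x2 ^ 2)
      = intΩ Γ (fun x1 x2 => q1 (q1 u) x1 x2 ^ 2 + q1 (q2 u) x1 x2 ^ 2 +
      q2 (q1 u) x1 x2 ^ 2 + q2 (q2 u) x1 x2 ^ 2) + intΩ Γ (fun x1 x2 => q1 (q1 v) x1 x2 ^ 2 + q1 (q2 v) x1 x2 ^ 2 +
      q2 (q1 v) x1 x2 ^ 2 + q2 (q2 v) x1 x2 ^ 2) := by
    rw [← intΩ_add _ _ (by fun_prop) (by fun_prop)]
    congr 1; funext x1 x2; ring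
  rw [e1]
  linarith

/-- temperature fluctuation balance -/
lemma theta (hΓ : 0 < Γ) (h : Stat Γ Ra Pr b c u v T P ut vt) {Tt : SField} (sTt : ssmooth Tt)
    (heat : ∀ x1, ∀ x2 ∈ Icc (0:ℝ) 1, Tt x1 x2 + u x1 x2 * q1 T x1 x2 + v x1 x2 * q2 T x1 x2
      - (q1 (q1 T) x1 x2 + q2 (q2 T) x1 x2) = 0) :
    intΩ Γ (fun x1 x2 => (T x1 x2 - 1 + x2) * Tt x1 x2)
      + intΩ Γ (fun x1 x2 => q1 T x1 x2 ^ 2 + (q2 T x1 x2 + 1) ^ 2)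
      = intΩ Γ (fun x1 x2 => v x1 x2 * T x1 x2) := by
  have c0 := ss_cont h.sv
  have c1 := ss_cont h.su
  have c2 := ss_cont (ss_q1 h.su)
  have c3 := ss_cont (ss_q2 h.sv)
  have c4 := ss_cont h.sT
  have c5 := ss_cont (ss_q1 h.sT)
  have c6 := ss_cont (ss_q2 h.sT)
  have c7 := ss_cont (ss_q1 (ss_q1 h.sT))
  have c8 := ss_cont (ss_q2 (ss_q2 h.sT))
  have c9 := ss_cont sTt
  have t1 : ∀ x1 x2, HasDerivAt (fun y => T y x2 - 1 + x2) (q1 T x1 x2) x1 := fun x1 x2 =>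
    ((ss_hd1 h.sT x1 x2).sub_const 1).add_const x2
  have t2 : ∀ x1 x2, HasDerivAt (fun y => T x1 y - 1 + y) (q2 T x1 x2 + 1) x2 := fun x1 x2 =>
    ((ss_hd2 h.sT x1 x2).sub_const 1).add (hasDerivAt_id x2)
  have w2 : ∀ x2 : ℝ, HasDerivAt (fun y : ℝ => y - y * y / 2) (1 - x2) x2 := fun x2 =>
    ((hasDerivAt_id x2).sub (((hasDerivAt_id x2).mul (hasDerivAt_id x2)).div_const 2)).congr_deriv
      (by simp)
  have := div_thm hΓ
    (F := fun x1 x2 => (T x1 x2 - 1 + x2) * q1 T x1 x2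
      - u x1 x2 * ((T x1 x2 - 1 + x2) * (T x1 x2 - 1 + x2)) / 2 - (x2 - x2 * x2 / 2) * u x1 x2)
    (G := fun x1 x2 => (T x1 x2 - 1 + x2) * (q2 T x1 x2 + 1)
      - v x1 x2 * ((T x1 x2 - 1 + x2) * (T x1 x2 - 1 + x2)) / 2 - (x2 - x2 * x2 / 2) * v x1 x2)
    (F' := fun x1 x2 => (q1 T x1 x2 * q1 T x1 x2 + (T x1 x2 - 1 + x2) * q1 (q1 T) x1 x2)
      - (q1 u x1 x2 * ((T x1 x2 - 1 + x2) * (T x1 x2 - 1 + x2)) + u x1 x2 *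
        (q1 T x1 x2 * (T x1 x2 - 1 + x2) + (T x1 x2 - 1 + x2) * q1 T x1 x2)) / 2
      - (x2 - x2 * x2 / 2) * q1 u x1 x2)
    (G' := fun x1 x2 => ((q2 T x1 x2 + 1) * (q2 T x1 x2 + 1) + (T x1 x2 - 1 + x2) * q2 (q2 T) x1 x2)
      - (q2 v x1 x2 * ((T x1 x2 - 1 + x2) * (T x1 x2 - 1 + x2)) + v x1 x2 *
        ((q2 T x1 x2 + 1) * (T x1 x2 - 1 + x2) + (T x1 x2 - 1 + x2) * (q2 T x1 x2 + 1))) / 2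
      - ((1 - x2) * v x1 x2 + (x2 - x2 * x2 / 2) * q2 v x1 x2))
    (H := fun x1 x2 => (T x1 x2 - 1 + x2) * Tt x1 x2 + ((q1 T x1 x2 ^ 2 + (q2 T x1 x2 + 1) ^ 2)
      - v x1 x2 * T x1 x2))
    (fun x1 x2 _ => (((t1 x1 x2).mul (ss_hd1 (ss_q1 h.sT) x1 x2)).sub
      (((ss_hd1 h.su x1 x2).mul ((t1 x1 x2).mul (t1 x1 x2))).div_const 2)).sub
      ((ss_hd1 h.su x1 x2).const_mul _))
    (fun x1 x2 => by simp only [h.pu x1 x2, h.pT x1 x2, per_q1 h.pT x1 x2])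
    (fun x1 x2 _ => (((t2 x1 x2).mul ((ss_hd2 (ss_q2 h.sT) x1 x2).add_const 1)).sub
      (((ss_hd2 h.sv x1 x2).mul ((t2 x1 x2).mul (t2 x1 x2))).div_const 2)).sub
      ((w2 x2).mul (ss_hd2 h.sv x1 x2)))
    (by fun_prop) (by fun_prop) ?_
  · simp only [h.v0, h.v1, h.T0, h.T1] at this
    rw [intΩ_add _ _ (by fun_prop) (by fun_prop), intΩ_sub _ _ (by fun_prop) (by fun_prop)] at this
    norm_num at this
    linarith
  · intro x1 x2 hx
    have e := h.hdiv x1 x2 hx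
    have e1 := heat x1 x2 hx
    linear_combination (T x1 x2 - 1 + x2) * e1 + ((T x1 x2 - 1 + x2) * (T x1 x2 - 1 + x2) / 2
      + (x2 - x2 * x2 / 2)) * e

/-- energy inequality with coercivity -/
lemma energy_le (hΓ : 0 < Γ) (hb : 0 < b) (hPr : 0 < Pr) (h : Stat Γ Ra Pr b c u v T P ut vt) :
    2 * intΩ Γ (fun x1 x2 => u x1 x2 * ut x1 x2 + v x1 x2 * vt x1 x2)
      ≤ - (Pr * min 1 b / 4) * intΩ Γ (fun x1 x2 => u x1 x2 ^ 2 + v x1 x2 ^ 2)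
        + 4 * Γ * Ra ^ 2 * Pr / min 1 b := by
  have c0 := ss_cont h.sv
  have c0' := ss_cont h.su
  have c1 := ss_cont (ss_q1 h.su)
  have c2 := ss_cont (ss_q2 h.su)
  have c3 := ss_cont (ss_q1 h.sv)
  have c4 := ss_cont (ss_q2 h.sv)
  have c13 := ss_cont h.sT
  have hE := h.energy hΓ
  have p1 := poincare_bot hΓ c0' c2 (fun x1 x2 _ => ss_hd2 h.su x1 x2)
  have p2 := poincare_zero hΓ c0 c4 (fun x1 x2 _ => ss_hd2 h.sv x1 x2) h.v0
  have hk : 0 < min 1 b := lt_min one_pos hb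
  have hk1 : min 1 b ≤ 1 := min_le_left _ _
  have hk2 : min 1 b ≤ b := min_le_right _ _
  set k := min 1 b
  have hs : intΩ Γ (fun x1 x2 => q2 u x1 x2 ^ 2) + intΩ Γ (fun x1 x2 => q2 v x1 x2 ^ 2)
      ≤ intΩ Γ (fun x1 x2 => om u v x1 x2 ^ 2) := by
    rw [← h.grad_eq hΓ, ← intΩ_add _ _ (by fun_prop) (by fun_prop)]
    exact intΩ_mono (by fun_prop) (by fun_prop) fun x1 _ x2 _ => by
      linarith [sq_nonneg (q1 u x1 x2), sq_nonneg (q1 v x1 x2)]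
  have hbd : (∫ x1 in (0:ℝ)..Γ, u x1 0 ^ 2) ≤ ∫ x1 in (0:ℝ)..Γ, (u x1 1 ^ 2 + u x1 0 ^ 2) :=
    intervalIntegral.integral_mono_on hΓ.le (Continuous.intervalIntegrable (by fun_prop) _ _)
      (Continuous.intervalIntegrable (by fun_prop) _ _) (fun x _ => by linarith [sq_nonneg (u x 1)])
  have hbd0 : 0 ≤ ∫ x1 in (0:ℝ)..Γ, u x1 0 ^ 2 :=
    intervalIntegral.integral_nonneg hΓ.le (fun x _ => by positivity)
  have hT := h.T2_le hΓ
  have hvT : intΩ Γ (fun x1 x2 => (8 * Ra / k) * (v x1 x2 * T x1 x2)) ≤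
      intΩ Γ (fun x1 x2 => v x1 x2 ^ 2 + (4 * Ra / k) ^ 2 * T x1 x2 ^ 2) :=
    intΩ_mono (by fun_prop) (by fun_prop) fun x1 _ x2 _ => by
      have e : 8 * Ra / k = 2 * (4 * Ra / k) := by ring
      rw [e]
      nlinarith [sq_nonneg (v x1 x2 - (4 * Ra / k) * T x1 x2)]
  rw [intΩ_cmul, intΩ_add _ _ (by fun_prop) (by fun_prop), intΩ_cmul] at hvT
  rw [intΩ_add (fun x1 x2 => u x1 x2 ^ 2) (fun x1 x2 => v x1 x2 ^ 2) (by fun_prop) (by fun_prop)]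
  set Iu := intΩ Γ (fun x1 x2 => u x1 x2 ^ 2)
  set Iv := intΩ Γ (fun x1 x2 => v x1 x2 ^ 2)
  set G := intΩ Γ (fun x1 x2 => om u v x1 x2 ^ 2)
  set Q := intΩ Γ (fun x1 x2 => v x1 x2 * T x1 x2)
  set IT := intΩ Γ (fun x1 x2 => T x1 x2 ^ 2)
  set B := ∫ x1 in (0:ℝ)..Γ, (u x1 1 ^ 2 + u x1 0 ^ 2)
  set B0 := ∫ x1 in (0:ℝ)..Γ, u x1 0 ^ 2
  set I2u := intΩ Γ (fun x1 x2 => q2 u x1 x2 ^ 2)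
  set I2v := intΩ Γ (fun x1 x2 => q2 v x1 x2 ^ 2)
  set X := intΩ Γ (fun x1 x2 => u x1 x2 * ut x1 x2 + v x1 x2 * vt x1 x2)
  have hIu : 0 ≤ Iu := intΩ_nonneg (fun _ _ _ _ => by positivity)
  have hIv : 0 ≤ Iv := intΩ_nonneg (fun _ _ _ _ => by positivity)
  have hG : 0 ≤ G := intΩ_nonneg (fun _ _ _ _ => by positivity)
  have hB : 0 ≤ B := hbd0.trans hbd
  have coer : k * (Iu + Iv) ≤ 4 * (G + b * B) := by
    have a1 : Iu + Iv ≤ 2 * B + 4 * G := by linarith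
    have a2 := mul_le_mul_of_nonneg_left a1 hk.le
    have a3 := mul_le_mul_of_nonneg_right hk1 hG
    have a4 := mul_le_mul_of_nonneg_right hk2 hB
    nlinarith
  have hRQ : Ra * Q ≤ k / 8 * Iv + 2 * Γ * Ra ^ 2 / k := by
    have a1 : (4 * Ra / k) ^ 2 * IT ≤ (4 * Ra / k) ^ 2 * Γ := by gcongr
    have a2 := mul_le_mul_of_nonneg_left (hvT.trans (add_le_add_right a1 Iv)) (by positivity : 0 ≤ k / 8)
    have e1 : k / 8 * (8 * Ra / k * Q) = Ra * Q := by field_simp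
    have e2 : k / 8 * (Iv + (4 * Ra / k) ^ 2 * Γ) = k / 8 * Iv + 2 * Γ * Ra ^ 2 / k := by
      field_simp; ring
    linarith
  have hX : X = Pr * (Ra * Q - G - b * B) := by
    have : Pr⁻¹ * X = Ra * Q - G - b * B := by linarith
    rw [← this]; field_simp
  have f : Ra * Q - G - b * B ≤ - (k / 8) * (Iu + Iv) + 2 * Γ * Ra ^ 2 / k := by nlinarith
  have f2 := mul_le_mul_of_nonneg_left f hPr.le
  rw [← hX] at f2
  have e3 : 2 * (Pr * (- (k / 8) * (Iu + Iv) + 2 * Γ * Ra ^ 2 / k))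
    = - (Pr * k / 4) * (Iu + Iv) + 4 * Γ * Ra ^ 2 * Pr / k := by ring
  linarith
end Stat

namespace Stat
variable {b c : ℝ} {u v T P ut vt : SField}
/-- vorticity equation -/
lemma vort_eq (hPr : 0 < Pr) (h : Stat Γ Ra Pr b c u v T P ut vt) (x1 : ℝ) {x2 : ℝ} (hx : x2 ∈ Icc (0:ℝ) 1) :
    om ut vt x1 x2 + u x1 x2 * q1 (om u v) x1 x2 + v x1 x2 * q2 (om u v) x1 x2
      = Pr * (q1 (q1 (om u v)) x1 x2 + q2 (q2 (om u v)) x1 x2) + Pr * Ra * q1 T x1 x2 := by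
  have sω := ss_om h.su h.sv
  have e2 : Pr⁻¹ * (q1 vt x1 x2 + c * q1 (q1 v) x1 x2 + (q1 u x1 x2 * om u v x1 x2
      + (u x1 x2 - c) * q1 (om u v) x1 x2)) - q1 (q1 (om u v)) x1 x2 + q1 (q2 P) x1 x2
      - Ra * q1 T x1 x2 = 0 := by
    have hd := (((((ss_hd1 h.svt x1 x2).add ((ss_hd1 (ss_q1 h.sv) x1 x2).const_mul c)).add
      (((ss_hd1 h.su x1 x2).sub_const c).mul (ss_hd1 sω x1 x2))).const_mul Pr⁻¹).sub
      (ss_hd1 (ss_q1 sω) x1 x2)).add (ss_hd1 (ss_q2 h.sP) x1 x2) |>.sub ((ss_hd1 h.sT x1 x2).const_mul Ra)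
    refine hd.unique ((hasDerivAt_const x1 (0:ℝ)).congr_of_eventuallyEq (Eventually.of_forall fun y => ?_))
    have := h.m2 y x2 hx
    simp only [Pi.add_apply, Pi.sub_apply, Pi.mul_apply]
    linarith
  have e1 : Pr⁻¹ * (q2 ut x1 x2 + c * q2 (q1 u) x1 x2 - (q2 v x1 x2 * om u v x1 x2
      + v x1 x2 * q2 (om u v) x1 x2)) + q2 (q2 (om u v)) x1 x2 + q2 (q1 P) x1 x2 = 0 := by
    have hd := (((((ss_hd2 h.sut x1 x2).add ((ss_hd2 (ss_q1 h.su) x1 x2).const_mul c)).sub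
      ((ss_hd2 h.sv x1 x2).mul (ss_hd2 sω x1 x2))).const_mul Pr⁻¹).add
      (ss_hd2 (ss_q2 sω) x1 x2)).add (ss_hd2 (ss_q1 h.sP) x1 x2)
    exact deriv_zero_Icc hd (fun y hy => h.m1 x1 y hy) hx
  have e := h.hdiv x1 x2 hx
  have eP := ss_comm h.sP x1 x2
  have eu := ss_comm h.su x1 x2
  have eo1 : q1 (om u v) x1 x2 = q1 (q1 v) x1 x2 - q1 (q2 u) x1 x2 :=
    ((ss_hd1 (ss_q1 h.sv) x1 x2).sub (ss_hd1 (ss_q2 h.su) x1 x2)).deriv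
  have eo : om ut vt x1 x2 = q1 vt x1 x2 - q2 ut x1 x2 := rfl
  have key : Pr⁻¹ * (om ut vt x1 x2 + u x1 x2 * q1 (om u v) x1 x2 + v x1 x2 * q2 (om u v) x1 x2)
      = (q1 (q1 (om u v)) x1 x2 + q2 (q2 (om u v)) x1 x2) + Ra * q1 T x1 x2 := by
    linear_combination e2 - e1 + Pr⁻¹ * eo - eP + Pr⁻¹ * c * (eo1 - eu) - Pr⁻¹ * om u v x1 x2 * e
  have : Pr * (Pr⁻¹ * (om ut vt x1 x2 + u x1 x2 * q1 (om u v) x1 x2 + v x1 x2 * q2 (om u v) x1 x2))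
    = om ut vt x1 x2 + u x1 x2 * q1 (om u v) x1 x2 + v x1 x2 * q2 (om u v) x1 x2 := by
    field_simp
  rw [← this, key]; ring
end Stat


lemma T_dev (hΓ : 0 < Γ) (S : Sol Γ Ra Pr Ls) (hT0 : T0cond S) {t : ℝ} (ht : 0 ≤ t) :
    ∀ x1 ∈ Ioo (0:ℝ) Γ, ∀ x2 ∈ Ioo (0:ℝ) 1, |S.T t x1 x2 - 1/2| ≤ 1/2 := by
  have sθ : tsmooth (fun t x1 x2 => S.T t x1 x2 - 1/2) := ContDiff.sub S.smooth_T contDiff_const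
  have e0 : dt (fun t x1 x2 => S.T t x1 x2 - 1/2) = dt S.T := by funext t x1 x2; simp [dt]
  have e1 : d1 (fun t x1 x2 => S.T t x1 x2 - 1/2) = d1 S.T := by funext t x1 x2; simp [d1]
  have e2 : d2 (fun t x1 x2 => S.T t x1 x2 - 1/2) = d2 S.T := by funext t x1 x2; simp [d2]
  have := trunc_bound (κ := 1) (R := 0) (Λ := 1/2) (t := t) (θ := fun t x1 x2 => S.T t x1 x2 - 1/2)
    (T := fun _ _ _ => 0) hΓ one_pos (by norm_num) ht sθ S.smooth_u1 S.smooth_u2 contDiff_const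
    (fun t x1 x2 => by simp only [S.periodic_T t x1 x2]) S.periodic_u1 (fun _ _ _ => rfl)
    (fun s x1 x2 hs hx => by
      rw [e0, e1, e2]
      have := S.heat s x1 x2 hs hx
      linarith)
    S.incomp S.u2_bot S.u2_top
    (fun s hs x1 => by
      rw [S.T_bot s x1 hs.1]; norm_num)
    (fun s hs x1 => by
      rw [S.T_top s x1 hs.1]; norm_num)
    (fun _ _ _ _ _ _ => by norm_num)
  have h0 : intΩ Γ (fun x1 x2 => tr4 (1/2) (S.T 0 x1 x2 - 1/2)) = intΩ Γ (fun _ _ => 0) :=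
    intΩ_congr fun x1 x2 hx => by
      have h := hT0 x1 x2 hx
      refine (tr_zero ?_).1
      rw [abs_le]; constructor <;> linarith [h.1, h.2]
  rw [h0, intΩ_const hΓ] at this
  norm_num at this
  have c := ts_cont sθ
  have cc : Continuous (fun q : ℝ × ℝ => S.T t q.1 q.2) := ss_cont (ts_slice S.smooth_T t)
  have hz := intΩ_eq_zero (Γ := Γ) (g := fun x1 x2 => tr4 (1/2) (S.T t x1 x2 - 1/2))
    (by unfold tr4; fun_prop) (fun _ _ => tr4_nonneg _ _) (by simpa using this)
  intro x1 h1 x2 h2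
  exact abs_le_of_tr4 (hz x1 h1 x2 h2)

lemma T_sq (hΓ : 0 < Γ) (S : Sol Γ Ra Pr Ls) (hT0 : T0cond S) {t : ℝ} (ht : 0 ≤ t) :
    ∀ x1 ∈ Ioo (0:ℝ) Γ, ∀ x2 ∈ Ioo (0:ℝ) 1, S.T t x1 x2 ^ 2 ≤ 1 := by
  intro x1 h1 x2 h2
  have := abs_le.1 (T_dev hΓ S hT0 ht x1 h1 x2 h2)
  nlinarith [this.1, this.2]

/-- modified pressure -/
def Pm (S : Sol Γ Ra Pr Ls) (t : ℝ) : SField := fun x1 x2 => S.p t x1 x2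
  + Pr⁻¹ * (((S.u1 t x1 x2 - mean Γ (S.u1 t)) ^ 2 + S.u2 t x1 x2 ^ 2) / 2)

lemma stat (hΓ : 0 < Γ) (S : Sol Γ Ra Pr Ls) (hT0 : T0cond S) {t : ℝ} (ht : 0 ≤ t) :
    Stat Γ Ra Pr (Ls⁻¹).toReal (mean Γ (S.u1 t)) (S.u1 t) (S.u2 t) (S.T t) (Pm S t)
      (dt S.u1 t) (dt S.u2 t) := by
  have su := ts_slice S.smooth_u1 t
  have sv := ts_slice S.smooth_u2 t
  have sp := ts_slice S.smooth_p t
  set c := mean Γ (S.u1 t) with hc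
  have sP : ssmooth (Pm S t) := by
    unfold Pm ssmooth
    unfold ssmooth at su sv sp
    fun_prop
  have P1 : ∀ x1 x2, q1 (Pm S t) x1 x2 = d1 S.p t x1 x2
      + Pr⁻¹ * ((S.u1 t x1 x2 - c) * d1 S.u1 t x1 x2 + S.u2 t x1 x2 * d1 S.u2 t x1 x2) := fun x1 x2 =>
    ((ss_hd1 sp x1 x2).add ((((((ss_hd1 su x1 x2).sub_const c).pow 2).add ((ss_hd1 sv x1 x2).pow 2)).div_const
      2).const_mul Pr⁻¹)).deriv.trans (by
        show d1 S.p t x1 x2 + Pr⁻¹ * ((_ * _ * d1 S.u1 t x1 x2 + _ * _ * d1 S.u2 t x1 x2) / 2) = _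
        push_cast; ring)
  have P2 : ∀ x1 x2, q2 (Pm S t) x1 x2 = d2 S.p t x1 x2
      + Pr⁻¹ * ((S.u1 t x1 x2 - c) * d2 S.u1 t x1 x2 + S.u2 t x1 x2 * d2 S.u2 t x1 x2) := fun x1 x2 =>
    ((ss_hd2 sp x1 x2).add ((((((ss_hd2 su x1 x2).sub_const c).pow 2).add ((ss_hd2 sv x1 x2).pow 2)).div_const
      2).const_mul Pr⁻¹)).deriv.trans (by
        show d2 S.p t x1 x2 + Pr⁻¹ * ((_ * _ * d2 S.u1 t x1 x2 + _ * _ * d2 S.u2 t x1 x2) / 2) = _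
        push_cast; ring)
  have eo1 : ∀ x1 x2, q1 (om (S.u1 t) (S.u2 t)) x1 x2 = d1 (d1 S.u2) t x1 x2 - d1 (d2 S.u1) t x1 x2 := fun x1 x2 =>
    ((ss_hd1 (ss_q1 sv) x1 x2).sub (ss_hd1 (ss_q2 su) x1 x2)).deriv
  have eo2 : ∀ x1 x2, q2 (om (S.u1 t) (S.u2 t)) x1 x2 = d2 (d1 S.u2) t x1 x2 - d2 (d2 S.u1) t x1 x2 := fun x1 x2 =>
    ((ss_hd2 (ss_q1 sv) x1 x2).sub (ss_hd2 (ss_q2 su) x1 x2)).deriv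
  have hdiv : ∀ x1, ∀ x2 ∈ Icc (0:ℝ) 1, d1 S.u1 t x1 x2 + d2 S.u2 t x1 x2 = 0 := fun x1 x2 hx =>
    S.incomp t x1 x2 ht hx
  have dd1 : ∀ x1, ∀ x2 ∈ Icc (0:ℝ) 1, d1 (d1 S.u1) t x1 x2 + d2 (d1 S.u2) t x1 x2 = 0 := by
    intro x1 x2 hx
    rw [← comm_d1_d2 S.smooth_u2]
    have := (ss_hd1 (ss_q1 su) x1 x2).add (ss_hd1 (ss_q2 sv) x1 x2)
    have e : ((fun y => q1 (S.u1 t) y x2) + fun y => q2 (S.u2 t) y x2) = fun _ => 0 := by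
      funext y; exact hdiv y x2 hx
    rw [e] at this
    exact (this.unique (hasDerivAt_const x1 0))
  have dd2 : ∀ x1, ∀ x2 ∈ Icc (0:ℝ) 1, d2 (d1 S.u1) t x1 x2 + d2 (d2 S.u2) t x1 x2 = 0 := by
    intro x1 x2 hx
    have := (ss_hd2 (ss_q1 su) x1 x2).add (ss_hd2 (ss_q2 sv) x1 x2)
    exact deriv_zero_Icc this (fun y hy => hdiv x1 y hy) hx
  have eom : ∀ x1 x2, om (S.u1 t) (S.u2 t) x1 x2 = d1 S.u2 t x1 x2 - d2 S.u1 t x1 x2 := fun _ _ => rfl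
  have vz : ∀ y, (∀ s x1, 0 ≤ s → S.u2 s x1 y = 0) → ∀ x1, dt S.u2 t x1 y = 0 := by
    intro y hy x1
    exact deriv_zero_Ici (ts_hdt S.smooth_u2 t x1 y) (fun s hs => hy s x1 hs) ht
  refine ⟨su, sv, ts_slice S.smooth_T t, sP, ts_slice (ts_dt S.smooth_u1) t, ts_slice (ts_dt S.smooth_u2) t,
    S.periodic_u1 t, S.periodic_u2 t, S.periodic_T t, ?_, tper_dt S.periodic_u1 t, tper_dt S.periodic_u2 t,
    ?_, ?_, hdiv, ?_, fun x1 => S.u2_bot t x1 ht, fun x1 => S.u2_top t x1 ht, vz 0 S.u2_bot, vz 1 S.u2_top,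
    fun x1 => S.slip_bot t x1 ht, fun x1 => S.slip_top t x1 ht, fun x1 => S.T_bot t x1 ht,
    fun x1 => S.T_top t x1 ht, T_sq hΓ S hT0 ht⟩
  · intro x1 x2
    unfold Pm
    rw [S.periodic_p, S.periodic_u1, S.periodic_u2]
  · intro x1 x2 hx
    have m := S.momentum1 t x1 x2 ht hx
    rw [P1, eo2, eom]
    show Pr⁻¹ * (dt S.u1 t x1 x2 + c * d1 S.u1 t x1 x2 - _) + _ + _ = 0
    linear_combination m + dd1 x1 x2 hx
  · intro x1 x2 hx
    have m := S.momentum2 t x1 x2 ht hx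
    rw [P2, eo1, eom]
    show Pr⁻¹ * (dt S.u2 t x1 x2 + c * d1 S.u2 t x1 x2 + _) - _ + _ = _
    have := congrFun (congrFun (congrFun (comm_d1_d2 S.smooth_u1) t) x1) x2
    linear_combination m + this + dd2 x1 x2 hx
  · intro x1 x2 hx
    show d1 (dt S.u1) t x1 x2 + d2 (dt S.u2) t x1 x2 = 0
    rw [← comm_dt_d1 S.smooth_u1, ← comm_dt_d2 S.smooth_u2]
    exact deriv_zero_Ici ((ts_hdt (ts_d1 S.smooth_u1) t x1 x2).add (ts_hdt (ts_d2 S.smooth_u2) t x1 x2))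
      (fun s hs => S.incomp s x1 x2 hs hx) ht

lemma ts_vort (S : Sol Γ Ra Pr Ls) : tsmooth (vort S) :=
  ContDiff.sub (ts_d1 S.smooth_u2) (ts_d2 S.smooth_u1)
lemma per_vort (S : Sol Γ Ra Pr Ls) : tperiodic Γ (vort S) := fun t =>
  per_om (S.periodic_u1 t) (S.periodic_u2 t)
lemma dt_vort (S : Sol Γ Ra Pr Ls) (t x1 x2 : ℝ) :
    dt (vort S) t x1 x2 = om (dt S.u1 t) (dt S.u2 t) x1 x2 := by
  have := ((ts_hdt (ts_d1 S.smooth_u2) t x1 x2).sub (ts_hdt (ts_d2 S.smooth_u1) t x1 x2)).deriv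
  rw [comm_dt_d1 S.smooth_u2, comm_dt_d2 S.smooth_u1] at this
  exact this

/-- truncated vorticity bound -/
lemma vort_trunc (hΓ : 0 < Γ) (hPr : 0 < Pr) (S : Sol Γ Ra Pr Ls) (hT0 : T0cond S) {t Λ : ℝ} (ht : 0 ≤ t)
    (hΛ : 0 ≤ Λ)
    (hw0 : ∀ s ∈ Icc 0 t, ∀ x1, |vort S s x1 0| ≤ Λ) (hw1 : ∀ s ∈ Icc 0 t, ∀ x1, |vort S s x1 1| ≤ Λ) :
    intΩ Γ (fun x1 x2 => vort S t x1 x2 ^ 4) ≤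
      8 * (intΩ Γ (fun x1 x2 => vort S 0 x1 x2 ^ 4) + 288 * Γ * Ra ^ 4) + 8 * Γ * Λ ^ 4 := by
  have := trunc_bound (R := Ra) hΓ hPr hΛ ht (ts_vort S) S.smooth_u1 S.smooth_u2 S.smooth_T (per_vort S)
    S.periodic_u1 S.periodic_T (fun s x1 x2 hs hx => by
      rw [dt_vort]
      exact (stat hΓ S hT0 hs).vort_eq hPr x1 hx) S.incomp S.u2_bot S.u2_top hw0 hw1
      (fun s hs => T_sq hΓ S hT0 hs)
  have c : Continuous (fun q : ℝ × ℝ => vort S t q.1 q.2) := ss_cont (ts_slice (ts_vort S) t)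
  have c0 : Continuous (fun q : ℝ × ℝ => vort S 0 q.1 q.2) := ss_cont (ts_slice (ts_vort S) 0)
  have ct : Continuous (fun q : ℝ × ℝ => tr4 Λ (vort S t q.1 q.2)) := by unfold tr4; fun_prop
  have ct0 : Continuous (fun q : ℝ × ℝ => tr4 Λ (vort S 0 q.1 q.2)) := by unfold tr4; fun_prop
  have h1 : intΩ Γ (fun x1 x2 => vort S t x1 x2 ^ 4) ≤
      intΩ Γ (fun x1 x2 => 8 * tr4 Λ (vort S t x1 x2) + 8 * Λ ^ 4) :=
    intΩ_mono (by fun_prop) (by fun_prop) fun x1 _ x2 _ => pow4_le_tr4 hΛ _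
  rw [intΩ_add (fun x1 x2 => 8 * tr4 Λ (vort S t x1 x2)) _ (by fun_prop) (by fun_prop), intΩ_cmul, intΩ_const hΓ] at h1
  have h2 : intΩ Γ (fun x1 x2 => tr4 Λ (vort S 0 x1 x2)) ≤ intΩ Γ (fun x1 x2 => vort S 0 x1 x2 ^ 4) :=
    intΩ_mono (by fun_prop) (by fun_prop) fun x1 _ x2 _ => tr4_le hΛ _
  have h3 : 0 ≤ intΩ Γ (fun x1 x2 => vort S 0 x1 x2 ^ 4) := intΩ_nonneg fun _ _ _ _ => by positivity
  have h4 : max (intΩ Γ (fun x1 x2 => tr4 Λ (vort S 0 x1 x2))) (288 * Γ * Ra ^ 4) ≤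
    intΩ Γ (fun x1 x2 => vort S 0 x1 x2 ^ 4) + 288 * Γ * Ra ^ 4 := max_le (by
      have : 0 ≤ 288 * Γ * Ra ^ 4 := by positivity
      linarith) (by linarith)
  nlinarith

lemma E_hasDeriv (S : Sol Γ Ra Pr Ls) (t : ℝ) :
    HasDerivAt (fun s => intΩ Γ (fun x1 x2 => S.u1 s x1 x2 ^ 2 + S.u2 s x1 x2 ^ 2))
      (2 * intΩ Γ (fun x1 x2 => S.u1 t x1 x2 * dt S.u1 t x1 x2 + S.u2 t x1 x2 * dt S.u2 t x1 x2)) t := by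
  have c1 := ts_cont S.smooth_u1
  have c2 := ts_cont S.smooth_u2
  have c3 := ts_cont (ts_dt S.smooth_u1)
  have c4 := ts_cont (ts_dt S.smooth_u2)
  rw [← intΩ_cmul]
  refine intΩ_hasDerivAt (F := fun s x1 x2 => S.u1 s x1 x2 ^ 2 + S.u2 s x1 x2 ^ 2)
    (F' := fun t x1 x2 => 2 * (S.u1 t x1 x2 * dt S.u1 t x1 x2 + S.u2 t x1 x2 * dt S.u2 t x1 x2))
    (by fun_prop) (by fun_prop) (fun t x1 x2 => ?_) t
  refine (((ts_hdt S.smooth_u1 t x1 x2).pow 2).add ((ts_hdt S.smooth_u2 t x1 x2).pow 2)).congr_deriv ?_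
  push_cast; ring

lemma E_bound (hΓ : 0 < Γ) (hPr : 0 < Pr) (S : Sol Γ Ra Pr Ls) (hT0 : T0cond S) {b : ℝ}
    (hbe : b = (Ls⁻¹).toReal) (hb : 0 < b) {t : ℝ} (ht : 0 ≤ t) :
    intΩ Γ (fun x1 x2 => S.u1 t x1 x2 ^ 2 + S.u2 t x1 x2 ^ 2) ≤
      max (intΩ Γ (fun x1 x2 => S.u1 0 x1 x2 ^ 2 + S.u2 0 x1 x2 ^ 2)) (16 * Γ * Ra ^ 2 / (min 1 b) ^ 2) := by
  have hm : 0 < min 1 b := lt_min one_pos hb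
  have := ode_bound (a := Pr * min 1 b / 4) (b := 4 * Γ * Ra ^ 2 * Pr / min 1 b) (t := t) (by positivity) ht
    (E_hasDeriv S) (fun s hs => by
      have st := stat hΓ S hT0 hs.1
      rw [← hbe] at st
      exact st.energy_le hΓ hb hPr)
  have e : 4 * Γ * Ra ^ 2 * Pr / min 1 b / (Pr * min 1 b / 4) = 16 * Γ * Ra ^ 2 / (min 1 b) ^ 2 := by
    field_simp; ring
  rw [e] at this
  exact this

lemma W_nonneg (S : Sol Γ Ra Pr Ls) : 0 ≤ W14u0 S :=
  Real.rpow_nonneg (intΩ_nonneg fun _ _ _ _ => by positivity) _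

lemma W_pow4 (S : Sol Γ Ra Pr Ls) : W14u0 S ^ 4 = intΩ Γ (fun x1 x2 =>
    (S.u1 0 x1 x2 ^ 2 + S.u2 0 x1 x2 ^ 2) ^ 2 + (gradSq S 0 x1 x2) ^ 2) := by
  unfold W14u0
  rw [← Real.rpow_natCast, ← Real.rpow_mul (intΩ_nonneg fun _ _ _ _ => by positivity)]
  norm_num

lemma cont_grad (S : Sol Γ Ra Pr Ls) (t : ℝ) : Continuous (fun q : ℝ × ℝ => gradSq S t q.1 q.2) := by
  have c1 := ss_cont (ts_slice (ts_d1 S.smooth_u1) t)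
  have c2 := ss_cont (ts_slice (ts_d2 S.smooth_u1) t)
  have c3 := ss_cont (ts_slice (ts_d1 S.smooth_u2) t)
  have c4 := ss_cont (ts_slice (ts_d2 S.smooth_u2) t)
  unfold gradSq
  fun_prop

lemma om0_le (S : Sol Γ Ra Pr Ls) : intΩ Γ (fun x1 x2 => vort S 0 x1 x2 ^ 4) ≤ 4 * W14u0 S ^ 4 := by
  have c := cont_grad S 0
  have c0 : Continuous (fun q : ℝ × ℝ => vort S 0 q.1 q.2) := ss_cont (ts_slice (ts_vort S) 0)
  have c1 := ss_cont (ts_slice S.smooth_u1 0)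
  have c2 := ss_cont (ts_slice S.smooth_u2 0)
  rw [W_pow4, ← intΩ_cmul]
  refine intΩ_mono (by fun_prop) (by fun_prop) fun x1 _ x2 _ => ?_
  have h1 : vort S 0 x1 x2 ^ 2 ≤ 2 * gradSq S 0 x1 x2 := by
    unfold vort gradSq
    nlinarith [sq_nonneg (d1 S.u2 0 x1 x2 + d2 S.u1 0 x1 x2), sq_nonneg (d1 S.u1 0 x1 x2), sq_nonneg (d2 S.u2 0 x1 x2)]
  have h2 := pow_le_pow_left₀ (sq_nonneg _) h1 2
  nlinarith [sq_nonneg (S.u1 0 x1 x2 ^ 2 + S.u2 0 x1 x2 ^ 2)]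

lemma E0_le (hΓ : 0 < Γ) (S : Sol Γ Ra Pr Ls) :
    intΩ Γ (fun x1 x2 => S.u1 0 x1 x2 ^ 2 + S.u2 0 x1 x2 ^ 2) ≤ (1 + Γ) * W14u0 S ^ 2 := by
  have c := cont_grad S 0
  have c1 := ss_cont (ts_slice S.smooth_u1 0)
  have c2 := ss_cont (ts_slice S.smooth_u2 0)
  have cs := intΩ_CS (Γ := Γ) (f := fun x1 x2 => S.u1 0 x1 x2 ^ 2 + S.u2 0 x1 x2 ^ 2) (g := fun _ _ => 1)
    (by fun_prop) (by fun_prop)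
  simp only [mul_one, one_pow] at cs
  rw [intΩ_const hΓ] at cs
  have h2 : intΩ Γ (fun x1 x2 => (S.u1 0 x1 x2 ^ 2 + S.u2 0 x1 x2 ^ 2) ^ 2) ≤ W14u0 S ^ 4 := by
    rw [W_pow4]
    exact intΩ_mono (by fun_prop) (by fun_prop) fun x1 _ x2 _ => by nlinarith [sq_nonneg (gradSq S 0 x1 x2)]
  refine le_of_sq_le_sq ?_ (by positivity)
  have h3 : (0:ℝ) ≤ W14u0 S ^ 4 := by positivity
  calc _ ≤ _ := cs
    _ ≤ W14u0 S ^ 4 * (Γ * 1) := by gcongr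
    _ ≤ W14u0 S ^ 4 * (1 + Γ) ^ 2 := by gcongr; nlinarith
    _ = _ := by ring

lemma wall_per (S : Sol Γ Ra Pr Ls) (hΓ : 0 < Γ) {t : ℝ} (ht : 0 ≤ t) :
    ∃ s0 ∈ Icc 0 t, ∃ X a, (X = |S.u1 s0 a 0| ∨ X = |S.u1 s0 a 1|) ∧
      (∀ s ∈ Icc 0 t, ∀ x1, |S.u1 s x1 0| ≤ X ∧ |S.u1 s x1 1| ≤ X) := by
  have c1 := ts_cont S.smooth_u1
  have c : Continuous (fun q : ℝ × ℝ => max |S.u1 q.1 q.2 0| |S.u1 q.1 q.2 1|) := by fun_prop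
  obtain ⟨q, hq, hmax⟩ := (isCompact_Icc (a := (0:ℝ)) (b := t)).prod (isCompact_Icc (a := (0:ℝ)) (b := Γ))
    |>.exists_isMaxOn ⟨(0, 0), ⟨left_mem_Icc.2 ht, left_mem_Icc.2 hΓ.le⟩⟩ c.continuousOn
  refine ⟨q.1, hq.1, max |S.u1 q.1 q.2 0| |S.u1 q.1 q.2 1|, q.2, ?_, fun s hs x1 => ?_⟩
  · rcases max_choice |S.u1 q.1 q.2 0| |S.u1 q.1 q.2 1| with h | h
    · exact Or.inl h
    · exact Or.inr h
  · have hp0 : Function.Periodic (fun x => (S.u1 s x 0, S.u1 s x 1)) Γ := fun x => by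
      simp only [S.periodic_u1 s x]
    obtain ⟨y, hy, e⟩ := hp0.exists_mem_Ico₀ hΓ x1
    simp only [Prod.mk.injEq] at e
    rw [e.1, e.2]
    have : max |S.u1 s y 0| |S.u1 s y 1| ≤ _ := hmax (show (s, y) ∈ _ from ⟨hs, Ico_subset_Icc_self hy⟩)
    exact ⟨(le_max_left _ _).trans this, (le_max_right _ _).trans this⟩

/-- constant in the vorticity bound -/
def KL4 (Γ : ℝ) : ℝ := 8 * (1 + Γ) * (1 + 32 * (1 + Γ) * ((1 + 2 / Γ) + (32 * (1 + Γ)) ^ 2) + 32 * (1 + Γ))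

lemma KL4_pos (hΓ : 0 < Γ) : 0 < KL4 Γ := by unfold KL4; positivity

lemma pow4_sum {G w R L : ℝ} (hG : 0 ≤ G) (hw : 0 ≤ w) (hR : 0 ≤ R) (hL : 0 ≤ L) :
    8 * (4 * w ^ 4 + 288 * G * R ^ 4) + 8 * G * L ^ 4 ≤ (8 * (1 + G) * (w + R + L)) ^ 4 := by
  have h1 : w ^ 4 + R ^ 4 + L ^ 4 ≤ (w + R + L) ^ 4 := by
    have a1 : w ^ 4 + R ^ 4 ≤ (w + R) ^ 4 := pow_add_pow_le hw hR (by norm_num)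
    have a2 : (w + R) ^ 4 + L ^ 4 ≤ (w + R + L) ^ 4 := pow_add_pow_le (by positivity) hL (by norm_num)
    linarith
  have h2 : 1 + G ≤ (1 + G) ^ 4 := le_self_pow₀ (by linarith) (by norm_num)
  calc _ ≤ 4096 * ((1 + G) * (w ^ 4 + R ^ 4 + L ^ 4)) := by
        have := pow_nonneg hw 4
        have := pow_nonneg hR 4
        have := pow_nonneg hL 4
        have := mul_nonneg hG (pow_nonneg hw 4)
        have := mul_nonneg hG (pow_nonneg hR 4)
        have := mul_nonneg hG (pow_nonneg hL 4)
        nlinarith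
    _ ≤ 4096 * ((1 + G) ^ 4 * (w + R + L) ^ 4) := by gcongr
    _ = _ := by ring

lemma X_alg {G w b r X M n : ℝ} (hG : 0 < G) (hw : 0 < w) (hb : 0 < b) (hX : 0 ≤ X)
    (hM : M = max 1 b⁻¹) (hn : n = max 1 b)
    (hr : r = min 1 (min (G / 2) (((32 * (1 + G)) * b)⁻¹ ^ 2)))
    (h : X ≤ 2 * (8 * (1 + G) * w * M / r + Real.sqrt r * (8 * (1 + G) * (w + b * X)))) :
    8 * (1 + G) * (w + b * X) ≤ KL4 G * w * n ^ 3 := by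
  have hq : (0:ℝ) < 32 * (1 + G) * b := by positivity
  have hr0 : 0 < r := by rw [hr]; refine lt_min one_pos (lt_min (by positivity) (by positivity))
  have s1 : Real.sqrt r ≤ 1 := Real.sqrt_le_one.2 (by rw [hr]; exact min_le_left _ _)
  have s2 : Real.sqrt r ≤ (32 * (1 + G) * b)⁻¹ := by
    rw [Real.sqrt_le_left (by positivity), hr]
    exact (min_le_right _ _).trans (min_le_right _ _)
  have s3 : Real.sqrt r * (32 * (1 + G) * b) ≤ 1 := by
    calc _ ≤ (32 * (1 + G) * b)⁻¹ * (32 * (1 + G) * b) := by gcongr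
      _ = 1 := inv_mul_cancel₀ hq.ne'
  have hri : 1 / r ≤ (1 + 2 / G) + (32 * (1 + G)) ^ 2 * b ^ 2 := by
    have hp1 : 0 < 2 / G := by positivity
    have hp2 : 0 < (32 * (1 + G)) ^ 2 * b ^ 2 := by positivity
    rcases min_choice 1 (min (G / 2) (((32 * (1 + G)) * b)⁻¹ ^ 2)) with e | e
    · rw [hr, e]; norm_num; linarith
    · rcases min_choice (G / 2) (((32 * (1 + G)) * b)⁻¹ ^ 2) with e' | e'
      · rw [hr, e, e']
        have : 1 / (G / 2) = 2 / G := by field_simp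
        linarith
      · rw [hr, e, e']
        have : 1 / ((32 * (1 + G) * b)⁻¹ ^ 2) = (32 * (1 + G)) ^ 2 * b ^ 2 := by field_simp
        linarith
  have hM0 : 1 ≤ M := by rw [hM]; exact le_max_left _ _
  have hn1 : 1 ≤ n := by rw [hn]; exact le_max_left _ _
  have hnb : b ≤ n := by rw [hn]; exact le_max_right _ _
  have hbM : b * M ≤ n := by
    rw [hM, hn]
    rcases le_total 1 b⁻¹ with e | e
    · rw [max_eq_right e, mul_inv_cancel₀ hb.ne']; exact le_max_left _ _
    · rw [max_eq_left e, mul_one]; exact le_max_right _ _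
  have hX2 : X ≤ 4 * (8 * (1 + G) * w * M * (1 / r)) + 32 * (1 + G) * w := by
    have e1 : Real.sqrt r * (32 * (1 + G) * b) * X ≤ 1 * X := by gcongr
    have e2 : Real.sqrt r * (1 + G) * w ≤ 1 * (1 + G) * w := by gcongr
    have e3 : 8 * (1 + G) * w * M / r = 8 * (1 + G) * w * M * (1 / r) := by ring
    rw [e3] at h
    nlinarith
  have hn3 : n ≤ n ^ 3 := le_self_pow₀ hn1 (by norm_num)
  have hbX : b * X ≤ w * (32 * (1 + G) * ((1 + 2 / G) + (32 * (1 + G)) ^ 2) + 32 * (1 + G)) * n ^ 3 := by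
    calc b * X ≤ b * (4 * (8 * (1 + G) * w * M * (1 / r)) + 32 * (1 + G) * w) := by gcongr
      _ = 32 * (1 + G) * w * ((b * M) * (1 / r)) + 32 * (1 + G) * w * b := by ring
      _ ≤ 32 * (1 + G) * w * (n * ((1 + 2 / G) * n ^ 2 + (32 * (1 + G)) ^ 2 * n ^ 2)) + 32 * (1 + G) * w * n ^ 3 := by
          have : 1 / r ≤ (1 + 2 / G) * n ^ 2 + (32 * (1 + G)) ^ 2 * n ^ 2 := by
            refine hri.trans ?_
            have : (1:ℝ) ≤ n ^ 2 := one_le_pow₀ hn1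
            have h0 : 0 ≤ 1 + 2 / G := by positivity
            have : (1 + 2 / G) * 1 ≤ (1 + 2 / G) * n ^ 2 := by gcongr
            have : (32 * (1 + G)) ^ 2 * b ^ 2 ≤ (32 * (1 + G)) ^ 2 * n ^ 2 := by gcongr
            linarith
          gcongr
          exact hnb.trans hn3
      _ = _ := by ring
  have hw3 : w ≤ w * n ^ 3 := by
    have : (1:ℝ) ≤ n ^ 3 := one_le_pow₀ hn1
    nlinarith
  unfold KL4
  calc 8 * (1 + G) * (w + b * X) ≤ 8 * (1 + G) * (w * n ^ 3 + w * (32 * (1 + G) * ((1 + 2 / G) + (32 * (1 + G)) ^ 2) + 32 * (1 + G)) * n ^ 3) := by gcongr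
    _ = _ := by ring

set_option maxHeartbeats 400000 in
lemma vort_L4 (hΓ : 0 < Γ) (hPr : 0 < Pr) (hRa : 0 < Ra) (S : Sol Γ Ra Pr Ls) (hT0 : T0cond S) {b : ℝ}
    (hbe : b = (Ls⁻¹).toReal) (hb : 0 < b) {t : ℝ} (ht : 0 ≤ t) :
    intΩ Γ (fun x1 x2 => vort S t x1 x2 ^ 4) ≤ (KL4 Γ * (W14u0 S + Ra) * (max 1 b) ^ 3) ^ 4 := by
  obtain ⟨s0, hs0, X, a, hXa, hX⟩ := wall_per S hΓ ht
  have hX0 : 0 ≤ X := (abs_nonneg _).trans (hX 0 (left_mem_Icc.2 ht) 0).1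
  have hW := W_nonneg S
  have hw0 : ∀ s ∈ Icc 0 t, ∀ x1, |vort S s x1 0| ≤ b * X := by
    intro s hs x1
    have st := stat hΓ S hT0 hs.1
    have e : vort S s x1 0 = _ := st.om0 x1
    rw [← hbe] at e
    rw [e]; simp only [abs_neg, abs_mul, abs_of_pos hb]
    gcongr; exact (hX s hs x1).1
  have hw1 : ∀ s ∈ Icc 0 t, ∀ x1, |vort S s x1 1| ≤ b * X := by
    intro s hs x1
    have st := stat hΓ S hT0 hs.1
    have e : vort S s x1 1 = _ := st.om1 x1
    rw [← hbe] at e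
    rw [e]; simp only [abs_neg, abs_mul, abs_of_pos hb]
    gcongr; exact (hX s hs x1).2
  have hL : ∀ s ∈ Icc 0 t, intΩ Γ (fun x1 x2 => vort S s x1 x2 ^ 4) ≤
      (8 * (1 + Γ) * (W14u0 S + Ra + b * X)) ^ 4 := by
    intro s hs
    have h1 := vort_trunc hΓ hPr S hT0 hs.1 (Λ := b * X) (by positivity)
      (fun s' hs' => hw0 s' ⟨hs'.1, hs'.2.trans hs.2⟩) (fun s' hs' => hw1 s' ⟨hs'.1, hs'.2.trans hs.2⟩)
    have h2 := om0_le S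
    have h3 := pow4_sum hΓ.le hW hRa.le (L := b * X) (by positivity)
    linarith
  set w := W14u0 S + Ra with hwdef
  have hwpos : 0 < w := by positivity
  have hU : intΩ Γ (fun x1 x2 => S.u1 s0 x1 x2 ^ 2) ≤ (8 * (1 + Γ) * w * (max 1 b⁻¹)) ^ 2 := by
    have c1 := ss_cont (ts_slice S.smooth_u1 s0)
    have c2 := ss_cont (ts_slice S.smooth_u2 s0)
    have h1 : intΩ Γ (fun x1 x2 => S.u1 s0 x1 x2 ^ 2) ≤ intΩ Γ (fun x1 x2 => S.u1 s0 x1 x2 ^ 2 + S.u2 s0 x1 x2 ^ 2) :=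
      intΩ_mono (by fun_prop) (by fun_prop) fun x1 _ x2 _ => by nlinarith [sq_nonneg (S.u2 s0 x1 x2)]
    refine (h1.trans (E_bound hΓ hPr S hT0 hbe hb hs0.1)).trans (max_le ?_ ?_)
    · refine (E0_le hΓ S).trans ?_
      have hM : (1:ℝ) ≤ max 1 b⁻¹ := le_max_left _ _
      calc (1 + Γ) * W14u0 S ^ 2 ≤ (1 + Γ) ^ 2 * w ^ 2 := by
            gcongr
            · nlinarith
            · linarith
        _ ≤ 64 * ((1 + Γ) ^ 2 * w ^ 2) * 1 := by nlinarith [show 0 ≤ (1 + Γ) ^ 2 * w ^ 2 by positivity]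
        _ ≤ 64 * ((1 + Γ) ^ 2 * w ^ 2) * (max 1 b⁻¹) ^ 2 := by gcongr; exact one_le_pow₀ hM
        _ = _ := by ring
    · have hm : 0 < min 1 b := lt_min one_pos hb
      have hM : (1 / min 1 b) ≤ max 1 b⁻¹ := by
        rcases min_choice 1 b with e | e
        · rw [e]; simp
        · rw [e]; simp
      calc 16 * Γ * Ra ^ 2 / (min 1 b) ^ 2 = 16 * Γ * Ra ^ 2 * (1 / min 1 b) ^ 2 := by field_simp
        _ ≤ 64 * (1 + Γ) ^ 2 * w ^ 2 * (max 1 b⁻¹) ^ 2 := by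
            gcongr
            · norm_num
            · nlinarith
            · linarith
        _ = _ := by ring
  set r := min 1 (min (Γ / 2) (((32 * (1 + Γ)) * b)⁻¹ ^ 2)) with hr
  have hr0 : 0 < r := by rw [hr]; refine lt_min one_pos (lt_min (by positivity) (by positivity))
  have hr1 : r ≤ 1 := min_le_left _ _
  have hr2 : r ≤ Γ / 2 := (min_le_right _ _).trans (min_le_left _ _)
  have hM0 : (0:ℝ) < max 1 b⁻¹ := lt_of_lt_of_le one_pos (le_max_left _ _)
  have hXle : X ≤ 2 * (8 * (1 + Γ) * w * (max 1 b⁻¹) / r + Real.sqrt r * (8 * (1 + Γ) * (w + b * X))) := by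
    rcases hXa with e | e
    · rw [e]
      rw [← e]
      refine e.le.trans ?_
      exact wall_bound (a := a) hr0 hr1 hr2 (by positivity) (by positivity) (ts_slice S.smooth_u1 s0)
        (ts_slice S.smooth_u2 s0) (S.periodic_u1 s0) (S.periodic_u2 s0) (fun x1 x2 hx => S.incomp s0 x1 x2 hs0.1 hx)
        (fun x1 => S.u2_bot s0 x1 hs0.1) hU (hL s0 hs0)
    · refine e.le.trans ?_
      exact wall_bound_top (a := a) hr0 hr1 hr2 (by positivity) (by positivity) (ts_slice S.smooth_u1 s0)
        (ts_slice S.smooth_u2 s0) (S.periodic_u1 s0) (S.periodic_u2 s0) (fun x1 x2 hx => S.incomp s0 x1 x2 hs0.1 hx)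
        (fun x1 => S.u2_top s0 x1 hs0.1) hU (hL s0 hs0)
  have hf := X_alg hΓ hwpos hb hX0 rfl rfl hr hXle
  exact (hL t (right_mem_Icc.2 ht)).trans (pow_le_pow_left₀ (by positivity) hf 4)

lemma intΩ_x1 (hΓ : 0 < Γ) (g : ℝ → ℝ) : intΩ Γ (fun x1 _ => g x1) = ∫ x1 in (0:ℝ)..Γ, g x1 := by
  rw [intΩ_eq_iter hΓ]; simp

lemma Z1_hasDeriv (S : Sol Γ Ra Pr Ls) (t : ℝ) :
    HasDerivAt (fun s => intΩ Γ (fun x1 x2 => vort S s x1 x2 ^ 2))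
      (2 * intΩ Γ (fun x1 x2 => om (S.u1 t) (S.u2 t) x1 x2 * om (dt S.u1 t) (dt S.u2 t) x1 x2)) t := by
  have c1 := ts_cont (ts_vort S)
  have c2 := ts_cont (ts_dt (ts_vort S))
  have := intΩ_hasDerivAt (Γ := Γ) (F := fun s x1 x2 => vort S s x1 x2 ^ 2)
    (F' := fun t x1 x2 => 2 * (vort S t x1 x2 * dt (vort S) t x1 x2))
    (by fun_prop) (by fun_prop) (fun t x1 x2 => by
      refine ((ts_hdt (ts_vort S) t x1 x2).pow 2).congr_deriv ?_
      push_cast; ring) t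
  rw [intΩ_cmul] at this
  simp only [dt_vort] at this
  exact this

lemma Z2_hasDeriv (hΓ : 0 < Γ) (S : Sol Γ Ra Pr Ls) (t : ℝ) :
    HasDerivAt (fun s => ∫ x1 in (0:ℝ)..Γ, (S.u1 s x1 1 ^ 2 + S.u1 s x1 0 ^ 2))
      (2 * ∫ x1 in (0:ℝ)..Γ, (S.u1 t x1 1 * dt S.u1 t x1 1 + S.u1 t x1 0 * dt S.u1 t x1 0)) t := by
  have c1 := ts_cont S.smooth_u1
  have c2 := ts_cont (ts_dt S.smooth_u1)
  have := intΩ_hasDerivAt (Γ := Γ) (F := fun s x1 x2 => S.u1 s x1 1 ^ 2 + S.u1 s x1 0 ^ 2)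
    (F' := fun t x1 x2 => 2 * (S.u1 t x1 1 * dt S.u1 t x1 1 + S.u1 t x1 0 * dt S.u1 t x1 0))
    (by fun_prop) (by fun_prop) (fun t x1 x2 => by
      refine (((ts_hdt S.smooth_u1 t x1 1).pow 2).add ((ts_hdt S.smooth_u1 t x1 0).pow 2)).congr_deriv ?_
      push_cast; ring) t
  rw [intΩ_cmul, intΩ_x1 hΓ] at this
  simp only [intΩ_x1 hΓ] at this
  exact this

lemma F_hasDeriv (S : Sol Γ Ra Pr Ls) (t : ℝ) :
    HasDerivAt (fun s => intΩ Γ (fun x1 x2 => (S.T s x1 x2 - 1 + x2) ^ 2))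
      (2 * intΩ Γ (fun x1 x2 => (S.T t x1 x2 - 1 + x2) * dt S.T t x1 x2)) t := by
  have c1 := ts_cont S.smooth_T
  have c2 := ts_cont (ts_dt S.smooth_T)
  have := intΩ_hasDerivAt (Γ := Γ) (F := fun s x1 x2 => (S.T s x1 x2 - 1 + x2) ^ 2)
    (F' := fun t x1 x2 => 2 * ((S.T t x1 x2 - 1 + x2) * dt S.T t x1 x2))
    (by fun_prop) (by fun_prop) (fun t x1 x2 => by
      refine ((((ts_hdt S.smooth_T t x1 x2).sub_const 1).add_const x2).pow 2).congr_deriv ?_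
      push_cast; ring) t
  rw [intΩ_cmul] at this
  exact this

/-- integrated form of a differential inequality -/
lemma int_ineq {y y' g : ℝ → ℝ} (hg : Continuous g) (hd : ∀ s, HasDerivAt y (y' s) s)
    (h : ∀ s, 0 ≤ s → g s + y' s ≤ 0) {t : ℝ} (ht : 0 ≤ t) : (∫ s in (0:ℝ)..t, g s) + y t ≤ y 0 := by
  have hG : ∀ s, HasDerivAt (fun s => (∫ r in (0:ℝ)..s, g r) + y s) (g s + y' s) s := fun s =>
    (hg.integral_hasStrictDerivAt 0 s).hasDerivAt.add (hd s)
  have hanti : AntitoneOn (fun s => (∫ r in (0:ℝ)..s, g r) + y s) (Ici 0) := by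
    refine antitoneOn_of_deriv_nonpos (convex_Ici 0) (fun s _ => (hG s).continuousAt.continuousWithinAt)
      (fun s _ => (hG s).differentiableAt.differentiableWithinAt) (fun s hs => ?_)
    rw [(hG s).deriv]
    rw [interior_Ici] at hs
    exact h s (le_of_lt hs)
  have := hanti (mem_Ici.2 le_rfl) (mem_Ici.2 ht) ht
  simpa using this

/-- convective heat flux -/
def qf (S : Sol Γ Ra Pr Ls) (t : ℝ) : ℝ := intΩ Γ (fun x1 x2 => S.u2 t x1 x2 * S.T t x1 x2)

lemma qf_cont (S : Sol Γ Ra Pr Ls) : Continuous (qf S) := by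
  have : tsmooth (fun t x1 x2 => S.u2 t x1 x2 * S.T t x1 x2) := ContDiff.mul S.smooth_u2 S.smooth_T
  exact ts_intΩ_cont this

lemma hess_cont (S : Sol Γ Ra Pr Ls) : Continuous (fun t => intΩ Γ (hessSq S t)) := by
  have h11 := ts_d1 (ts_d1 S.smooth_u1)
  have h12 := ts_d1 (ts_d2 S.smooth_u1)
  have h21 := ts_d2 (ts_d1 S.smooth_u1)
  have h22 := ts_d2 (ts_d2 S.smooth_u1)
  have k11 := ts_d1 (ts_d1 S.smooth_u2)
  have k12 := ts_d1 (ts_d2 S.smooth_u2)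
  have k21 := ts_d2 (ts_d1 S.smooth_u2)
  have k22 := ts_d2 (ts_d2 S.smooth_u2)
  refine ts_intΩ_cont (F := hessSq S) ?_
  unfold tsmooth at *
  unfold hessSq
  fun_prop

lemma theta_le (hΓ : 0 < Γ) (S : Sol Γ Ra Pr Ls) (hT0 : T0cond S) {t : ℝ} (ht : 0 ≤ t) :
    intΩ Γ (fun x1 x2 => (S.T t x1 x2 - 1 + x2) * dt S.T t x1 x2)
      + intΩ Γ (fun x1 x2 => q1 (S.T t) x1 x2 ^ 2) ≤ qf S t := by
  have h := (stat hΓ S hT0 ht).theta hΓ (ts_slice (ts_dt S.smooth_T) t) (fun x1 x2 hx => S.heat t x1 x2 ht hx)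
  have c1 := ss_cont (ss_q1 (ts_slice S.smooth_T t))
  have c2 := ss_cont (ss_q2 (ts_slice S.smooth_T t))
  have : intΩ Γ (fun x1 x2 => q1 (S.T t) x1 x2 ^ 2) ≤
      intΩ Γ (fun x1 x2 => q1 (S.T t) x1 x2 ^ 2 + (q2 (S.T t) x1 x2 + 1) ^ 2) :=
    intΩ_mono (by fun_prop) (by fun_prop) fun x1 _ x2 _ => by nlinarith [sq_nonneg (q2 (S.T t) x1 x2 + 1)]
  unfold qf
  linarith

lemma qf_lower (hΓ : 0 < Γ) (S : Sol Γ Ra Pr Ls) (hT0 : T0cond S) :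
    ∃ F0 : ℝ, ∀ t, 0 ≤ t → -F0 ≤ ∫ s in (0:ℝ)..t, qf S s := by
  refine ⟨1/2 * intΩ Γ (fun x1 x2 => (S.T 0 x1 x2 - 1 + x2) ^ 2), fun t ht => ?_⟩
  have := int_ineq (g := fun s => - qf S s) (qf_cont S).neg (fun s => (F_hasDeriv S s).const_mul (1/2))
    (fun s hs => by
      have h := theta_le hΓ S hT0 hs
      have : 0 ≤ intΩ Γ (fun x1 x2 => q1 (S.T s) x1 x2 ^ 2) := intΩ_nonneg fun _ _ _ _ => sq_nonneg _
      linarith) ht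
  rw [intervalIntegral.integral_neg] at this
  have h0 : 0 ≤ intΩ Γ (fun x1 x2 => (S.T t x1 x2 - 1 + x2) ^ 2) := intΩ_nonneg fun _ _ _ _ => sq_nonneg _
  linarith

lemma qf_upper (hΓ : 0 < Γ) (hPr : 0 < Pr) (S : Sol Γ Ra Pr Ls) (hT0 : T0cond S)
    (hb : 0 < (Ls⁻¹).toReal) : ∃ B : ℝ, ∀ t, 0 ≤ t → qf S t ≤ B := by
  refine ⟨max (intΩ Γ (fun x1 x2 => S.u1 0 x1 x2 ^ 2 + S.u2 0 x1 x2 ^ 2))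
    (16 * Γ * Ra ^ 2 / (min 1 (Ls⁻¹).toReal) ^ 2) + Γ * 1, fun t ht => ?_⟩
  have c0 := ss_cont (ts_slice S.smooth_u1 t)
  have c1 := ss_cont (ts_slice S.smooth_u2 t)
  have c2 := ss_cont (ts_slice S.smooth_T t)
  have h1 : qf S t ≤ intΩ Γ (fun x1 x2 => (S.u1 t x1 x2 ^ 2 + S.u2 t x1 x2 ^ 2) + 1) := by
    refine intΩ_mono (by fun_prop) (by fun_prop) fun x1 h1 x2 h2 => ?_
    have := T_sq hΓ S hT0 ht x1 h1 x2 h2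
    nlinarith [sq_nonneg (S.u2 t x1 x2 - S.T t x1 x2), sq_nonneg (S.u1 t x1 x2), sq_nonneg (S.u2 t x1 x2)]
  rw [intΩ_add (fun x1 x2 => S.u1 t x1 x2 ^ 2 + S.u2 t x1 x2 ^ 2) _ (by fun_prop) (by fun_prop), intΩ_const hΓ] at h1
  have h2 := E_bound hΓ hPr S hT0 rfl hb ht
  linarith

set_option maxHeartbeats 400000 in
/-- integrated Hessian inequality -/
lemma hess_int (hΓ : 0 < Γ) (hPr : 0 < Pr) (S : Sol Γ Ra Pr Ls) (hT0 : T0cond S) {b : ℝ}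
    (hbe : b = (Ls⁻¹).toReal) (hb : 0 < b) {m R lam β : ℝ} (hm : 0 ≤ m) (hR : 0 ≤ R) (hRa : Ra = R ^ 2)
    (hl : 0 < lam) (hω : ∀ t, 0 ≤ t → intΩ Γ (fun x1 x2 => vort S t x1 x2 ^ 4) ≤ m ^ 4)
    (hβ0 : 0 ≤ β) (hβ : β = c3K Γ * (b * Ra / lam + b * m * Pr⁻¹ + b ^ 2) + R / 2) :
    ∃ K0 : ℝ, ∀ t, 0 ≤ t → ∫ s in (0:ℝ)..t, intΩ Γ (hessSq S s) ≤
      K0 + (c3K Γ * (b * Ra * lam)) * t + (β * Ra + R ^ 3 / 2) * ∫ s in (0:ℝ)..t, qf S s := by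
  set α := c3K Γ * (b * Ra * lam) with hα
  have hK : ∀ t, HasDerivAt (fun s => Pr⁻¹ / 2 * (intΩ Γ (fun x1 x2 => vort S s x1 x2 ^ 2)
      + b * ∫ x1 in (0:ℝ)..Γ, (S.u1 s x1 1 ^ 2 + S.u1 s x1 0 ^ 2))
      + β * Pr⁻¹ / 2 * intΩ Γ (fun x1 x2 => S.u1 s x1 x2 ^ 2 + S.u2 s x1 x2 ^ 2)
      + R ^ 3 / 4 * intΩ Γ (fun x1 x2 => (S.T s x1 x2 - 1 + x2) ^ 2)) _ t := fun t =>
    ((((Z1_hasDeriv S t).add ((Z2_hasDeriv hΓ S t).const_mul b)).const_mul (Pr⁻¹ / 2)).add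
      ((E_hasDeriv S t).const_mul (β * Pr⁻¹ / 2))).add ((F_hasDeriv S t).const_mul (R ^ 3 / 4))
  refine ⟨Pr⁻¹ / 2 * (intΩ Γ (fun x1 x2 => vort S 0 x1 x2 ^ 2)
      + b * ∫ x1 in (0:ℝ)..Γ, (S.u1 0 x1 1 ^ 2 + S.u1 0 x1 0 ^ 2))
      + β * Pr⁻¹ / 2 * intΩ Γ (fun x1 x2 => S.u1 0 x1 x2 ^ 2 + S.u2 0 x1 x2 ^ 2)
      + R ^ 3 / 4 * intΩ Γ (fun x1 x2 => (S.T 0 x1 x2 - 1 + x2) ^ 2), fun t ht => ?_⟩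
  have ch := hess_cont S
  have cq := qf_cont S
  have main := int_ineq (g := fun s => intΩ Γ (hessSq S s) - α - (β * Ra + R ^ 3 / 2) * qf S s)
    (by fun_prop) hK (fun s hs => by
      have st := stat hΓ S hT0 hs
      rw [← hbe] at st
      have e1 := st.diss hΓ hb.le hPr rfl hm hR hRa hl (hω s hs)
      rw [← hβ, ← hα] at e1
      have e2 : intΩ Γ (hessSq S s) ≤ _ := st.hess_le hΓ hb.le
      have e3 := st.energy hΓ
      have e4 := theta_le hΓ S hT0 hs
      have e5 : 0 ≤ ∫ x1 in (0:ℝ)..Γ, (S.u1 s x1 1 ^ 2 + S.u1 s x1 0 ^ 2) :=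
        intervalIntegral.integral_nonneg hΓ.le fun _ _ => by positivity
      have e6 : Pr⁻¹ * intΩ Γ (fun x1 x2 => S.u1 s x1 x2 * dt S.u1 s x1 x2 + S.u2 s x1 x2 * dt S.u2 s x1 x2)
        + intΩ Γ (fun x1 x2 => om (S.u1 s) (S.u2 s) x1 x2 ^ 2) ≤ Ra * qf S s := by
        unfold qf
        have := mul_nonneg hb.le e5
        linarith
      have e7 := mul_le_mul_of_nonneg_left e6 hβ0
      have e8 := mul_le_mul_of_nonneg_left e4 (show 0 ≤ R ^ 3 / 2 by positivity)
      have e9 := e2.trans (le_sub_iff_add_le.2 e1)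
      linarith) ht
  have i1 : (∫ s in (0:ℝ)..t, (intΩ Γ (hessSq S s) - α - (β * Ra + R ^ 3 / 2) * qf S s))
      = (∫ s in (0:ℝ)..t, intΩ Γ (hessSq S s)) - α * t - (β * Ra + R ^ 3 / 2) * ∫ s in (0:ℝ)..t, qf S s := by
    rw [intervalIntegral.integral_sub, intervalIntegral.integral_sub, intervalIntegral.integral_const_mul]
    · simp; ring
    · exact ch.intervalIntegrable _ _
    · exact continuous_const.intervalIntegrable _ _
    · exact (ch.sub continuous_const).intervalIntegrable _ _
    · exact (cq.const_mul _).intervalIntegrable _ _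
  rw [i1] at main
  have n1 : 0 ≤ intΩ Γ (fun x1 x2 => vort S t x1 x2 ^ 2) := intΩ_nonneg fun _ _ _ _ => sq_nonneg _
  have n2 : 0 ≤ ∫ x1 in (0:ℝ)..Γ, (S.u1 t x1 1 ^ 2 + S.u1 t x1 0 ^ 2) :=
        intervalIntegral.integral_nonneg hΓ.le fun _ _ => by positivity
  have n3 : 0 ≤ intΩ Γ (fun x1 x2 => S.u1 t x1 x2 ^ 2 + S.u2 t x1 x2 ^ 2) := intΩ_nonneg fun _ _ _ _ => by positivity
  have n4 : 0 ≤ intΩ Γ (fun x1 x2 => (S.T t x1 x2 - 1 + x2) ^ 2) := intΩ_nonneg fun _ _ _ _ => sq_nonneg _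
  have n5 : 0 ≤ Pr⁻¹ / 2 * (intΩ Γ (fun x1 x2 => vort S t x1 x2 ^ 2)
      + b * ∫ x1 in (0:ℝ)..Γ, (S.u1 t x1 1 ^ 2 + S.u1 t x1 0 ^ 2))
      + β * Pr⁻¹ / 2 * intΩ Γ (fun x1 x2 => S.u1 t x1 x2 ^ 2 + S.u2 t x1 x2 ^ 2)
      + R ^ 3 / 4 * intΩ Γ (fun x1 x2 => (S.T t x1 x2 - 1 + x2) ^ 2) := by positivity
  linarith

lemma nu_lower {q : ℝ → ℝ} {G F0 B : ℝ} (hG : 0 < G) {N : ℝ → ℝ}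
    (hN : ∀ t, 0 < t → N t = 1 + (1 / (G * t)) * ∫ s in (0:ℝ)..t, q s)
    (cq : Continuous q) (hq : ∀ t, 0 ≤ t → -F0 ≤ ∫ s in (0:ℝ)..t, q s) (hB : ∀ t, 0 ≤ t → q t ≤ B) :
    IsBoundedUnder (· ≤ ·) atTop N ∧ 1 ≤ limsup N atTop := by
  have hbd : IsBoundedUnder (· ≤ ·) atTop N := by
    refine ⟨1 + B / G, ?_⟩
    rw [eventually_map]
    filter_upwards [eventually_gt_atTop 0] with t ht
    rw [hN t ht]
    have h1 : ∫ s in (0:ℝ)..t, q s ≤ ∫ s in (0:ℝ)..t, B :=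
      intervalIntegral.integral_mono_on ht.le (cq.intervalIntegrable _ _) (continuous_const.intervalIntegrable _ _)
        fun s hs => hB s hs.1
    simp only [intervalIntegral.integral_const, sub_zero, smul_eq_mul] at h1
    have : 1 / (G * t) * ∫ s in (0:ℝ)..t, q s ≤ 1 / (G * t) * (t * B) := by gcongr
    have e : 1 / (G * t) * (t * B) = B / G := by field_simp
    linarith
  refine ⟨hbd, ?_⟩
  have hlim : Tendsto (fun t : ℝ => 1 + (-F0 / G) * t⁻¹) atTop (nhds (1 + (-F0 / G) * 0)) :=
    (tendsto_inv_atTop_zero.const_mul _).const_add _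
  have e := hlim.limsup_eq
  rw [mul_zero, add_zero] at e hlim
  rw [← e]
  refine limsup_le_limsup ?_ hlim.isCoboundedUnder_le hbd
  filter_upwards [eventually_gt_atTop 0] with t ht
  rw [hN t ht]
  have h1 := hq t ht.le
  have : 1 / (G * t) * (-F0) ≤ 1 / (G * t) * ∫ s in (0:ℝ)..t, q s := by gcongr
  have e : 1 / (G * t) * (-F0) = (-F0 / G) * t⁻¹ := by field_simp
  linarith

lemma hess_limsup {q hh : ℝ → ℝ} {G K0 α δ : ℝ} (hG : 0 < G) (hδ : 0 ≤ δ) {N H : ℝ → ℝ}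
    (hN : ∀ t, 0 < t → N t = 1 + (1 / (G * t)) * ∫ s in (0:ℝ)..t, q s)
    (hH : ∀ t, 0 < t → H t = (1 / (G * t)) * ∫ s in (0:ℝ)..t, hh s)
    (hbd : IsBoundedUnder (· ≤ ·) atTop N) (hpos : ∀ t, 0 ≤ t → 0 ≤ hh t)
    (hI : ∀ t, 0 ≤ t → ∫ s in (0:ℝ)..t, hh s ≤ K0 + α * t + δ * ∫ s in (0:ℝ)..t, q s) :
    limsup H atTop ≤ α / G + δ * (limsup N atTop - 1) := by
  have hbH : IsCoboundedUnder (· ≤ ·) atTop H := by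
    refine IsBoundedUnder.isCoboundedUnder_le ⟨0, ?_⟩
    rw [eventually_map]
    filter_upwards [eventually_gt_atTop 0] with t ht
    rw [hH t ht]
    have : 0 ≤ ∫ s in (0:ℝ)..t, hh s := intervalIntegral.integral_nonneg ht.le fun s hs => hpos s hs.1
    positivity
  have key : ∀ ε : ℝ, 0 < ε → limsup H atTop ≤ α / G + δ * (limsup N atTop - 1) + ε * (1 + δ) := by
    intro ε hε
    refine limsup_le_of_le hbH ?_
    have hlim : Tendsto (fun t : ℝ => (K0 / G) * t⁻¹) atTop (nhds ((K0 / G) * 0)) :=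
      tendsto_inv_atTop_zero.const_mul _
    rw [mul_zero] at hlim
    filter_upwards [eventually_gt_atTop 0, hlim.eventually_lt_const hε,
      eventually_lt_of_limsup_lt (show limsup N atTop < limsup N atTop + ε by linarith) hbd] with t ht h1 h2
    rw [hN t ht] at h2
    rw [hH t ht]
    have h3 : 1 / (G * t) * ∫ s in (0:ℝ)..t, hh s ≤ 1 / (G * t) * (K0 + α * t + δ * ∫ s in (0:ℝ)..t, q s) := by
      gcongr; exact hI t ht.le
    have e : 1 / (G * t) * (K0 + α * t + δ * ∫ s in (0:ℝ)..t, q s) =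
      (K0 / G) * t⁻¹ + α / G + δ * (1 / (G * t) * ∫ s in (0:ℝ)..t, q s) := by field_simp
    have h4 : δ * (1 / (G * t) * ∫ s in (0:ℝ)..t, q s) ≤ δ * (limsup N atTop + ε - 1) := by
      gcongr; linarith
    linarith
  refine le_of_forall_pos_le_add fun ε hε => ?_
  have := key (ε / (1 + δ)) (by positivity)
  rwa [div_mul_cancel₀ _ (by positivity)] at this

lemma c3K_nonneg (Γ : ℝ) : 0 ≤ c3K Γ := by unfold c3K c1K c2K; positivity

lemma inner_eq (g : SField) : (∫ x1 in Ioc (0:ℝ) Γ, ∫ x2 in (0:ℝ)..1, g x1 x2) = intΩ Γ g := by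
  unfold intΩ
  simp only [intervalIntegral.integral_of_le zero_le_one]

lemma flux_eq (hΓ : 0 < Γ) (S : Sol Γ Ra Pr Ls) {t : ℝ} (ht : 0 ≤ t) :
    intΩ Γ (fun x1 x2 => S.u2 t x1 x2 * S.T t x1 x2 - d2 S.T t x1 x2) = qf S t + Γ := by
  have c1 := ss_cont (ts_slice S.smooth_u2 t)
  have c2 := ss_cont (ts_slice S.smooth_T t)
  have c3 := ss_cont (ss_q2 (ts_slice S.smooth_T t))
  have h := intΩ_d2 hΓ (F := S.T t) (F' := d2 S.T t) (fun x1 x2 _ => ss_hd2 (ts_slice S.smooth_T t) x1 x2) c3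
  rw [intΩ_sub (fun x1 x2 => S.u2 t x1 x2 * S.T t x1 x2) (d2 S.T t) (by fun_prop) c3, h]
  simp only [S.T_bot t _ ht, S.T_top t _ ht]
  unfold qf
  simp

lemma Nfun (hΓ : 0 < Γ) (S : Sol Γ Ra Pr Ls) (t : ℝ) (ht : 0 < t) :
    (1/t) * ∫ s in Ioc (0:ℝ) t, (1/Γ) * ∫ x1 in Ioc (0:ℝ) Γ,
      (∫ x2 in (0:ℝ)..1, (S.u2 s x1 x2 * S.T s x1 x2 - d2 S.T s x1 x2))
      = 1 + (1 / (Γ * t)) * ∫ s in (0:ℝ)..t, qf S s := by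
  have e : ∫ s in Ioc (0:ℝ) t, (1/Γ) * ∫ x1 in Ioc (0:ℝ) Γ,
      (∫ x2 in (0:ℝ)..1, (S.u2 s x1 x2 * S.T s x1 x2 - d2 S.T s x1 x2))
      = ∫ s in Ioc (0:ℝ) t, (1/Γ) * (qf S s + Γ) := by
    refine setIntegral_congr_fun measurableSet_Ioc fun s hs => ?_
    rw [inner_eq (fun x1 x2 => S.u2 s x1 x2 * S.T s x1 x2 - d2 S.T s x1 x2), flux_eq hΓ S hs.1.le]
  rw [e, ← intervalIntegral.integral_of_le ht.le, intervalIntegral.integral_const_mul,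
    intervalIntegral.integral_add ((qf_cont S).intervalIntegrable _ _) (continuous_const.intervalIntegrable _ _)]
  simp only [intervalIntegral.integral_const, sub_zero, smul_eq_mul]
  field_simp
  ring

lemma Hfun (S : Sol Γ Ra Pr Ls) (t : ℝ) (ht : 0 < t) :
    (1/t) * ∫ s in Ioc (0:ℝ) t, (1/Γ) * ∫ x1 in Ioc (0:ℝ) Γ, (∫ x2 in (0:ℝ)..1, hessSq S s x1 x2)
      = (1 / (Γ * t)) * ∫ s in (0:ℝ)..t, intΩ Γ (hessSq S s) := by
  simp only [inner_eq]
  rw [← intervalIntegral.integral_of_le ht.le, intervalIntegral.integral_const_mul]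
  ring

lemma final_alg {G c k b w n Pr nu R s : ℝ} (hG : 0 < G) (hc : 0 ≤ c) (hk : 0 ≤ k) (hb : 0 < b) (hw : 0 ≤ w)
    (hn : 0 ≤ n) (hPr : 0 < Pr) (hR : 0 < R) (hs : 0 < s) (hnu : nu = s ^ 2) :
    c * (b * R ^ 2 * (s * R)) / G + ((c * (b * R ^ 2 / (s * R) + b * (k * w * n) * Pr⁻¹ + b ^ 2) + R / 2) * R ^ 2
      + R ^ 3 / 2) * (nu - 1)
    ≤ (c / G + c + c * k + 1) * (b ^ 2 + n * w / (Pr * b⁻¹) + b * s⁻¹ * R + R) * (nu * R ^ 2) := by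
  have h1 : ((c * (b * R ^ 2 / (s * R) + b * (k * w * n) * Pr⁻¹ + b ^ 2) + R / 2) * R ^ 2
      + R ^ 3 / 2) * (nu - 1) ≤ ((c * (b * R ^ 2 / (s * R) + b * (k * w * n) * Pr⁻¹ + b ^ 2) + R / 2) * R ^ 2
      + R ^ 3 / 2) * nu := by gcongr; linarith
  refine (add_le_add_right h1 _).trans ?_
  have e1 : n * w / (Pr * b⁻¹) = b * w * n * Pr⁻¹ := by field_simp
  have e2 : b * R ^ 2 / (s * R) = b * s⁻¹ * R := by field_simp
  have e3 : c * (b * R ^ 2 * (s * R)) / G = (c / G) * (b * s⁻¹ * R) * (nu * R ^ 2) := by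
    rw [hnu]; field_simp
  rw [e1, e2, e3]
  have p1 : 0 ≤ b ^ 2 := by positivity
  have p2 : 0 ≤ b * w * n * Pr⁻¹ := by positivity
  have p3 : 0 ≤ b * s⁻¹ * R := by positivity
  have p5 : 0 ≤ c / G := by positivity
  have p6 : 0 ≤ c * k := by positivity
  have p4 : 0 ≤ nu * R ^ 2 := by rw [hnu]; positivity
  have e4 : c / G * (b * s⁻¹ * R) * (nu * R ^ 2) + ((c * (b * s⁻¹ * R + b * (k * w * n) * Pr⁻¹ + b ^ 2) + R / 2) * R ^ 2
      + R ^ 3 / 2) * nu = (c / G * (b * s⁻¹ * R) + c * (b * s⁻¹ * R) + c * k * (b * w * n * Pr⁻¹) + c * b ^ 2 + R)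
        * (nu * R ^ 2) := by ring
  rw [e4]
  refine mul_le_mul_of_nonneg_right ?_ p4
  generalize b * w * n * Pr⁻¹ = A at *
  generalize b * s⁻¹ * R = D at *
  generalize c / G = x at *
  generalize c * k = y at *
  generalize b ^ 2 = z at *
  have := mul_nonneg p5 p1
  have := mul_nonneg p5 p2
  have := mul_nonneg p5 p3
  have := mul_nonneg p5 hR.le
  have := mul_nonneg hc p1
  have := mul_nonneg hc p2
  have := mul_nonneg hc p3
  have := mul_nonneg hc hR.le
  have := mul_nonneg p6 p1
  have := mul_nonneg p6 p2
  have := mul_nonneg p6 p3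
  have := mul_nonneg p6 hR.le
  linarith

/-- Hessian bound. -/
theorem hessian_bound (Γ : ℝ) (hΓ : 0 < Γ) :
    ∃ C : ℝ, 0 < C ∧ ∀ (Ra Pr Ls : ℝ), 0 < Ra → 0 < Pr → 0 < Ls →
      ∀ S : Sol Γ Ra Pr (ENNReal.ofReal Ls), T0cond S →
        ltavg Γ (fun t x1 => ∫ x2 in (0:ℝ)..1, hessSq S t x1 x2) ≤
          C * (Ls ^ (-(2:ℝ)) + max 1 (Ls ^ (-(3:ℝ))) * (W14u0 S + Ra) / (Pr * Ls)
            + Ls⁻¹ * Nu S ^ (-(1:ℝ)/2) * Ra ^ ((1:ℝ)/2) + Ra ^ ((1:ℝ)/2)) * (Nu S * Ra) := by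
  have hc := c3K_nonneg Γ
  have hk := KL4_pos hΓ
  refine ⟨c3K Γ / Γ + c3K Γ + c3K Γ * KL4 Γ + 1, by positivity, fun Ra Pr Ls hRa hPr hLs S hT0 => ?_⟩
  have hbe : Ls⁻¹ = ((ENNReal.ofReal Ls)⁻¹).toReal := by
    rw [ENNReal.toReal_inv, ENNReal.toReal_ofReal hLs.le]
  have hb : 0 < Ls⁻¹ := by positivity
  obtain ⟨F0, hF0⟩ := qf_lower hΓ S hT0
  obtain ⟨B, hB⟩ := qf_upper hΓ hPr S hT0 (by rw [← hbe]; exact hb)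
  obtain ⟨hbd, hnu⟩ := nu_lower hΓ (Nfun hΓ S) (qf_cont S) hF0 hB
  change 1 ≤ Nu S at hnu
  have hR := Real.sqrt_pos.2 hRa
  have hRa2 : Ra = Real.sqrt Ra ^ 2 := (Real.sq_sqrt hRa.le).symm
  have hs := Real.sqrt_pos.2 (lt_of_lt_of_le one_pos hnu)
  have hs2 : Nu S = Real.sqrt (Nu S) ^ 2 := (Real.sq_sqrt (by linarith)).symm
  have hW := W_nonneg S
  have hw : 0 ≤ W14u0 S + Ra := by linarith
  have hn0 : (0:ℝ) < max 1 Ls⁻¹ := lt_of_lt_of_le one_pos (le_max_left _ _)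
  obtain ⟨K0, hK0⟩ := hess_int hΓ hPr S hT0 hbe hb (m := KL4 Γ * (W14u0 S + Ra) * (max 1 Ls⁻¹) ^ 3)
    (lam := Real.sqrt (Nu S) * Real.sqrt Ra) (by positivity) hR.le hRa2 (by positivity)
    (fun t ht => vort_L4 hΓ hPr hRa S hT0 hbe hb ht) (by positivity) rfl
  have hfin := hess_limsup hΓ (by positivity) (Nfun hΓ S) (Hfun S) hbd
    (fun t _ => intΩ_nonneg fun _ _ _ _ => by unfold hessSq; positivity) hK0
  have hfin' : ltavg Γ (fun t x1 => ∫ x2 in (0:ℝ)..1, hessSq S t x1 x2) ≤ _ := hfin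
  refine hfin'.trans ?_
  have halg := final_alg (c := c3K Γ) (k := KL4 Γ) (b := Ls⁻¹) (w := W14u0 S + Ra) (n := (max 1 Ls⁻¹) ^ 3) (nu := Nu S)
    hΓ hc hk.le hb hw (by positivity) hPr hR hs hs2
  rw [← hRa2, inv_inv] at halg
  have r1 : Ls ^ (-(2:ℝ)) = Ls⁻¹ ^ 2 := by
    rw [Real.rpow_neg hLs.le, ← Real.inv_rpow hLs.le]; norm_num
  have r2 : max 1 (Ls ^ (-(3:ℝ))) = (max 1 Ls⁻¹) ^ 3 := by
    have e : Ls ^ (-(3:ℝ)) = Ls⁻¹ ^ 3 := by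
      rw [Real.rpow_neg hLs.le, ← Real.inv_rpow hLs.le]; norm_num
    rw [e]
    rcases le_total 1 Ls⁻¹ with h | h
    · rw [max_eq_right h, max_eq_right (one_le_pow₀ h)]
    · rw [max_eq_left h, max_eq_left (pow_le_one₀ hb.le h), one_pow]
  have r3 : Nu S ^ (-(1:ℝ)/2) = (Real.sqrt (Nu S))⁻¹ := by
    rw [Real.sqrt_eq_rpow, ← Real.rpow_neg (by linarith)]; norm_num
  rw [r1, r2, r3, ← Real.sqrt_eq_rpow]
  exact halg

end RB
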